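/- arXiv:1903.03870 — 3 statements merged into one kernel-verified Lean document; each statement's English description precedes it below -/
import Mathlib

section
/- Let K be a number field (a finite extension of ℚ) and let 𝒪_K be its ring of integers (the integral closure of ℤ in K). Then 𝒪_K is an IDPD if and only if 𝒪_K is an HFD, if and only if the class number of K is 1 or 2. -/
/-- An integral domain (here: commutative ring) is *atomic* if every nonzero nonunit
is a finite product of irreducible elements. -/
def IsAtomicDomain (D : Type*) [CommRing D] : Prop :=
  ∀ z : D, z ≠ 0 → ¬IsUnit z →
    ∃ l : Multiset D, (∀ p ∈ l, Irreducible p) ∧ l.prod = z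

/-- An *irreducible divisor pair domain (IDPD)* is an atomic integral domain such that
for every nonzero nonunit `z` and every pair of non-associate irreducible divisors
`p, q` of `z`, there are irreducibles `p', q'` with `p*p' ~ q*q' ∣ z`. -/
def IsIDPD (D : Type*) [CommRing D] : Prop :=
  IsDomain D ∧ IsAtomicDomain D ∧
    ∀ z p q : D, z ≠ 0 → ¬IsUnit z → Irreducible p → Irreducible q →
      p ∣ z → q ∣ z → ¬Associated p q →
      ∃ p' q' : D, Irreducible p' ∧ Irreducible q' ∧
        Associated (p * p') (q * q') ∧ q * q' ∣ z

/-- A *half-factorial domain (HFD)* is an atomic integral domain in which any two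
irreducible factorizations of the same element have the same length. -/
def IsHFD (D : Type*) [CommRing D] : Prop :=
  IsDomain D ∧ IsAtomicDomain D ∧
    ∀ s t : Multiset D, (∀ p ∈ s, Irreducible p) → (∀ q ∈ t, Irreducible q) →
      s.prod = t.prod → Multiset.card s = Multiset.card t


section part1
open Real

/-- constant -/
noncomputable def gC : ℝ := ∑' n : ℤ, Real.exp (-π / 2 * (n : ℝ) ^ 2)

lemma gauss_summable_int {a : ℝ} (ha : 0 < a) : Summable fun n : ℤ => Real.exp (-a * (n : ℝ) ^ 2) := by
  have := summable_pow_mul_jacobiTheta₂_term_bound 0 (T := a / π) (by positivity) 0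
  refine this.congr fun n => ?_
  simp only [pow_zero, one_mul, mul_zero, zero_mul, sub_zero]
  congr 1
  field_simp

lemma gC_nonneg : 0 ≤ gC := tsum_nonneg fun _ => (Real.exp_pos _).le

lemma gauss1D_summable {a : ℝ} (ha : 0 < a) (x : ℝ) :
    Summable fun n : ℤ => Real.exp (-π * a * ((n : ℝ) + x) ^ 2) := by
  have h := (gauss_summable_int (a := π * a / 2) (by positivity)).mul_left (Real.exp (π * a * x ^ 2))
  refine Summable.of_nonneg_of_le (fun _ => (Real.exp_pos _).le) (fun n => ?_) h
  rw [← Real.exp_add]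
  apply Real.exp_le_exp.mpr
  have : 0 ≤ π * a * ((n : ℝ) + 2 * x) ^ 2 / 2 := by positivity
  nlinarith

lemma gauss1D_eq {a : ℝ} (ha : 0 < a) (x : ℝ) :
    ((√a * ∑' n : ℤ, Real.exp (-π * a * ((n : ℝ) + x) ^ 2) : ℝ) : ℂ) =
      ∑' n : ℤ, Complex.exp (-π / a * n ^ 2 + 2 * π * Complex.I * n * x) := by
  have h := Complex.tsum_exp_neg_quadratic (a := (a : ℂ)) (by simpa using ha) (-(a * x : ℝ) : ℂ)
  have ha' : (a : ℂ) ≠ 0 := by exact_mod_cast ha.ne'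
  have hs : ((a : ℂ) ^ (1 / 2 : ℂ)) = ((√a : ℝ) : ℂ) := by
    rw [Real.sqrt_eq_rpow, Complex.ofReal_cpow ha.le]; simp
  have hs0 : ((√a : ℝ) : ℂ) ≠ 0 := by
    exact_mod_cast (Real.sqrt_pos.mpr ha).ne'
  have e1 : ((∑' n : ℤ, Real.exp (-π * a * ((n : ℝ) + x) ^ 2) : ℝ) : ℂ) =
      Complex.exp (-π * a * x ^ 2) *
      ∑' n : ℤ, Complex.exp (-π * a * n ^ 2 + 2 * π * (-(a * x : ℝ)) * n) := by
    rw [Complex.ofReal_tsum, ← tsum_mul_left]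
    congr 1; ext n
    rw [← Complex.exp_add, Complex.ofReal_exp]
    congr 1; push_cast; ring
  rw [Complex.ofReal_mul, e1, h, hs]
  rw [show ∀ p q r : ℂ, ((√a : ℝ) : ℂ) * (p * (1 / ((√a : ℝ) : ℂ) * r)) = p * r by
    intro p q r; field_simp] <;> try exact 0
  rw [← tsum_mul_left]
  congr 1; ext n
  rw [← Complex.exp_add]
  congr 1
  have := Complex.I_sq
  push_cast
  field_simp
  ring_nf
  rw [this]; ring

lemma gauss1D_bound {a : ℝ} (ha : 0 < a) (ha1 : a ≤ 1) (x : ℝ) :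
    |√a * ∑' n : ℤ, Real.exp (-π * a * ((n : ℝ) + x) ^ 2) - 1| ≤ gC * Real.exp (-π / (2 * a)) := by
  have hnorm : ∀ n : ℤ, ‖Complex.exp (-π / a * n ^ 2 + 2 * π * Complex.I * n * x)‖ =
      Real.exp (-(π / a) * (n : ℝ) ^ 2) := by
    intro n
    rw [Complex.norm_exp]
    congr 1
    have : (-π / a * n ^ 2 + 2 * π * Complex.I * n * x : ℂ) =
      ((-(π / a) * (n : ℝ) ^ 2 : ℝ) : ℂ) + ((2 * π * n * x : ℝ) : ℂ) * Complex.I := by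
      push_cast; ring
    rw [this, Complex.add_re, Complex.ofReal_re, Complex.re_ofReal_mul, Complex.I_re]
    simp
  have hsn : Summable fun n : ℤ => ‖Complex.exp (-π / a * n ^ 2 + 2 * π * Complex.I * n * x)‖ := by
    simp_rw [hnorm]; exact gauss_summable_int (by positivity)
  have hs := hsn.of_norm
  have hg := gauss_summable_int (a := π / 2) (by positivity)
  have e := gauss1D_eq ha x
  have e2 : ((√a * ∑' n : ℤ, Real.exp (-π * a * ((n : ℝ) + x) ^ 2) - 1 : ℝ) : ℂ) =
     ∑' n : ℤ, if n = 0 then 0 else Complex.exp (-π / a * n ^ 2 + 2 * π * Complex.I * n * x) := by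
    rw [Complex.ofReal_sub, e, hs.tsum_eq_add_tsum_ite 0]
    simp
  rw [← Real.norm_eq_abs, ← Complex.norm_real, e2]
  rw [gC, ← tsum_mul_right]
  have hg' : Summable fun n : ℤ => Real.exp (-π / 2 * (n : ℝ) ^ 2) * Real.exp (-π / (2 * a)) := by
    apply Summable.mul_right
    refine hg.congr fun n => ?_
    congr 1; ring
  refine tsum_of_norm_bounded hg'.hasSum fun n => ?_
  by_cases hn : n = 0
  · simp only [hn, if_true, norm_zero]; positivity
  · simp only [hn, if_false]
    rw [hnorm, ← Real.exp_add]
    apply Real.exp_le_exp.mpr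
    have h1 : (1 : ℝ) ≤ (n : ℝ) ^ 2 := by
      have : 0 < n ^ 2 := by positivity
      exact_mod_cast this
    have h2 : 1 ≤ 1 / a := by rw [le_div_iff₀ ha]; linarith
    have h3 : -(π / a) * (n : ℝ) ^ 2 = -π * (1 / a) * n ^ 2 := by ring
    have h4 : -π / (2 * a) = -π * (1 / a) / 2 := by field_simp
    rw [h3, h4]
    have hp := Real.pi_pos
    nlinarith [mul_nonneg hp.le (mul_nonneg (sub_nonneg.mpr h2) (sq_nonneg (n:ℝ))),
      mul_nonneg (mul_nonneg hp.le (by linarith : (0:ℝ) ≤ 1 / a)) (sub_nonneg.mpr h1)]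

end part1

section part2
open Real

section
variable {E : Type*} [NormedAddCommGroup E] [InnerProductSpace ℝ E]

/-- projection orthogonal to `b` -/
noncomputable def oproj (b : E) : E →ₗ[ℝ] E where
  toFun w := w - (inner ℝ b w / ‖b‖ ^ 2) • b
  map_add' x y := by rw [inner_add_right, add_div, add_smul]; abel
  map_smul' r x := by
    simp only [inner_smul_right, RingHom.id_apply, smul_sub, smul_smul, mul_div_assoc]

lemma oproj_apply (b w : E) : oproj b w = w - (inner ℝ b w / ‖b‖ ^ 2) • b := rfl

lemma oproj_self {b : E} (hb : b ≠ 0) : oproj b b = 0 := by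
  rw [oproj_apply, real_inner_self_eq_norm_sq, div_self (by positivity), one_smul, sub_self]

lemma norm_oproj {b : E} (hb : b ≠ 0) (w : E) (k : ℝ) :
    ‖k • b + w‖ ^ 2 = ‖b‖ ^ 2 * (k + inner ℝ b w / ‖b‖ ^ 2) ^ 2 + ‖oproj b w‖ ^ 2 := by
  have hb' : ‖b‖ ≠ 0 := by positivity
  rw [oproj_apply, norm_sub_sq_real, norm_add_sq_real, inner_smul_right, inner_smul_left, norm_smul,
    norm_smul, real_inner_comm b w, mul_pow, mul_pow, Real.norm_eq_abs, Real.norm_eq_abs, sq_abs, sq_abs]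
  simp only [conj_trivial]
  field_simp
  ring

lemma norm_oproj_le (b : E) (w : E) : ‖oproj b w‖ ≤ ‖w‖ := by
  by_cases hb : b = 0
  · simp [oproj_apply, hb]
  have := norm_oproj hb w 0
  have h2 : ‖oproj b w‖ ^ 2 ≤ ‖w‖ ^ 2 := by
    rw [zero_smul, zero_add] at this
    rw [this]; nlinarith [sq_nonneg (‖b‖ * (0 + inner ℝ b w / ‖b‖ ^ 2))]
  exact le_of_sq_le_sq h2 (norm_nonneg _)
end

set_option maxHeartbeats 400000 in
theorem gaussMulti (n : ℕ) : ∀ {E : Type*} [NormedAddCommGroup E] [InnerProductSpace ℝ E]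
    (b : Fin n → E) (_ : LinearIndependent ℝ b),
    ∃ D : ℝ, 0 < D ∧ ∀ (B u : ℝ) (_ : ∀ i, ‖b i‖ ^ 2 ≤ B), 0 < u → u ^ 2 * B ≤ 1 →
      ∀ v ∈ Submodule.span ℝ (Set.range b),
      (Summable fun k : Fin n → ℤ => Real.exp (-π * u ^ 2 * ‖∑ i, (k i : ℝ) • b i + v‖ ^ 2)) ∧
      |D * u ^ n * (∑' k : Fin n → ℤ, Real.exp (-π * u ^ 2 * ‖∑ i, (k i : ℝ) • b i + v‖ ^ 2)) - 1|
        ≤ (1 + gC * Real.exp (-π / (2 * (u ^ 2 * B)))) ^ n - 1 := by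
  induction n with
  | zero =>
    intro E _ _ b _
    refine ⟨1, one_pos, fun B u _ _ _ v hv => ⟨(hasSum_fintype _).summable, ?_⟩⟩
    rw [Set.range_eq_empty b, Submodule.span_empty, Submodule.mem_bot] at hv
    simp [hv]
  | succ n ih =>
    intro E _ _ b hb
    have hb0 : b 0 ≠ 0 := hb.ne_zero 0
    set p := oproj (b 0) with hp
    have hli : LinearIndependent ℝ (fun i : Fin n => p (b i.succ)) := by
      rw [Fintype.linearIndependent_iff]
      intro g hg
      have h1 : ∑ i, g i • b i.succ - (inner ℝ (b 0) (∑ i, g i • b i.succ) / ‖b 0‖ ^ 2) • b 0 = 0 := by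
        rw [← oproj_apply, map_sum]
        simpa using hg
      rw [Fintype.linearIndependent_iff] at hb
      have := hb (Fin.cons (-(inner ℝ (b 0) (∑ i, g i • b i.succ) / ‖b 0‖ ^ 2)) g) (by
        rw [Fin.sum_univ_succ]
        simp only [Fin.cons_zero, Fin.cons_succ, neg_smul]
        rw [← h1]; abel)
      intro i
      simpa using this i.succ
    obtain ⟨D', hD', H⟩ := ih (fun i : Fin n => p (b i.succ)) hli
    refine ⟨D' * ‖b 0‖, by positivity, ?_⟩
    intro B u hB hu huB v hv
    have hb0' : 0 < ‖b 0‖ := by positivity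
    obtain ⟨H1, H2⟩ := H B u (fun i => le_trans (by
      have := norm_oproj_le (b 0) (b i.succ)
      gcongr) (hB i.succ)) hu huB (p v) (by
        have h1 : p v ∈ Submodule.map p (Submodule.span ℝ (Set.range b)) := ⟨v, hv, rfl⟩
        rw [Submodule.map_span] at h1
        refine Submodule.span_le.mpr ?_ h1
        rintro _ ⟨_, ⟨i, rfl⟩, rfl⟩
        refine Fin.cases ?_ (fun j => ?_) i
        · rw [hp, oproj_self hb0]; exact Submodule.zero_mem _
        · exact Submodule.subset_span ⟨j, rfl⟩)
    set ε := gC * Real.exp (-π / (2 * (u ^ 2 * B))) with hε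
    have hε0 : 0 ≤ ε := mul_nonneg gC_nonneg (Real.exp_pos _).le
    set a := u ^ 2 * ‖b 0‖ ^ 2 with ha
    have ha0 : 0 < a := by positivity
    have haB : a ≤ u ^ 2 * B := by rw [ha]; gcongr; exact hB 0
    have hsqrt : √a = u * ‖b 0‖ := by
      rw [ha, ← mul_pow, Real.sqrt_sq (by positivity)]
    set w : (Fin n → ℤ) → E := fun k => ∑ i, (k i : ℝ) • b i.succ + v with hw
    set x : (Fin n → ℤ) → ℝ := fun k => inner ℝ (b 0) (w k) / ‖b 0‖ ^ 2 with hx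
    set g : (Fin n → ℤ) → ℝ := fun k => Real.exp (-π * u ^ 2 * ‖∑ i, (k i : ℝ) • p (b i.succ) + p v‖ ^ 2) with hg
    have key : ∀ (k : Fin n → ℤ) (m : ℤ),
        Real.exp (-π * u ^ 2 * ‖∑ i, ((Fin.cons m k : Fin (n+1) → ℤ) i : ℝ) • b i + v‖ ^ 2) =
        Real.exp (-π * a * ((m : ℝ) + x k) ^ 2) * g k := by
      intro k m
      rw [Fin.sum_univ_succ]
      simp only [Fin.cons_zero, Fin.cons_succ]
      rw [add_assoc, norm_oproj hb0, hg, ← Real.exp_add]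
      congr 1
      have : oproj (b 0) (w k) = ∑ i, (k i : ℝ) • p (b i.succ) + p v := by
        rw [hw]; simp only [map_add, map_sum, map_smul, hp]
      rw [← this]
      simp only [hx, ha, hw]
      ring
    set e := Fin.consEquiv (fun _ : Fin (n+1) => ℤ) with he
    set f : (Fin (n+1) → ℤ) → ℝ := fun k => Real.exp (-π * u ^ 2 * ‖∑ i, (k i : ℝ) • b i + v‖ ^ 2) with hf
    set A : (Fin n → ℤ) → ℝ := fun k => ∑' m : ℤ, Real.exp (-π * a * ((m : ℝ) + x k) ^ 2) with hA
    have hAb : ∀ k, |√a * A k - 1| ≤ ε := by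
      intro k
      refine (gauss1D_bound ha0 (haB.trans huB) (x k)).trans ?_
      rw [hε]
      have := gC_nonneg
      gcongr gC * Real.exp ?_
      rw [neg_div, neg_div, neg_le_neg_iff]
      gcongr
    have hsA : 0 < √a := Real.sqrt_pos.mpr ha0
    have hAup : ∀ k, A k ≤ (1 + ε) / √a := by
      intro k
      rw [le_div_iff₀ hsA]
      have := (abs_le.mp (hAb k)).2
      linarith
    have hA0 : ∀ k, 0 ≤ A k := fun k => tsum_nonneg fun _ => (Real.exp_pos _).le
    have hg0 : ∀ k, 0 ≤ g k := fun k => (Real.exp_pos _).le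
    have hAg : Summable fun k => A k * g k := by
      refine Summable.of_nonneg_of_le (fun k => mul_nonneg (hA0 k) (hg0 k)) (fun k => ?_) (H1.mul_left ((1 + ε) / √a))
      exact mul_le_mul_of_nonneg_right (hAup k) (hg0 k)
    have hk : ∀ k, Summable fun m : ℤ => Real.exp (-π * a * ((m : ℝ) + x k) ^ 2) * g k :=
      fun k => Summable.mul_right (g k) (gauss1D_summable ha0 (x k))
    have hkt : ∀ k, ∑' m : ℤ, Real.exp (-π * a * ((m : ℝ) + x k) ^ 2) * g k = A k * g k :=
      fun k => tsum_mul_right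
    have hprod : Summable fun q : (Fin n → ℤ) × ℤ => Real.exp (-π * a * ((q.2 : ℝ) + x q.1) ^ 2) * g q.1 := by
      rw [summable_prod_of_nonneg (fun q => mul_nonneg (Real.exp_pos _).le (hg0 _))]
      refine ⟨hk, ?_⟩
      refine hAg.congr fun k => ?_
      exact (hkt k).symm
    set e2 : (Fin n → ℤ) × ℤ ≃ (Fin (n+1) → ℤ) := (Equiv.prodComm _ _).trans e with he2
    have hfe : ∀ q, f (e2 q) = Real.exp (-π * a * ((q.2 : ℝ) + x q.1) ^ 2) * g q.1 := by
      intro q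
      exact key q.1 q.2
    have hsf : Summable f := by
      have h0 : Summable (fun q => f (e2 q)) := by
        simp only [hfe]; exact hprod
      exact (Equiv.summable_iff e2 (f := f)).mp h0
    refine ⟨hsf, ?_⟩
    have htf : ∑' k, f k = ∑' k, A k * g k := by
      rw [← e2.tsum_eq f, tsum_congr hfe, hprod.tsum_prod' hk]
      exact tsum_congr hkt
    change |D' * ‖b 0‖ * u ^ (n+1) * (∑' k, f k) - 1| ≤ _
    have hS' : (0:ℝ) ≤ ∑' k, g k := tsum_nonneg hg0
    have h1 : |√a * (∑' k, A k * g k) - ∑' k, g k| ≤ ε * ∑' k, g k := by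
      rw [← tsum_mul_left, ← (hAg.mul_left _).tsum_sub H1, ← tsum_mul_left, ← Real.norm_eq_abs]
      refine tsum_of_norm_bounded (H1.mul_left ε).hasSum fun k => ?_
      rw [Real.norm_eq_abs, show √a * (A k * g k) - Real.exp (-π * u ^ 2 * ‖∑ i, (k i : ℝ) • p (b i.succ) + p v‖ ^ 2)
        = (√a * A k - 1) * g k by rw [hg]; ring, abs_mul, abs_of_nonneg (hg0 k)]
      exact mul_le_mul_of_nonneg_right (hAb k) (hg0 k)
    have h2 : D' * ‖b 0‖ * u ^ (n+1) * (∑' k, f k) = (D' * u ^ n) * (√a * (∑' k, A k * g k)) := by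
      rw [htf, hsqrt]; ring
    rw [h2]
    change |D' * u ^ n * (∑' k, g k) - 1| ≤ _ at H2
    have hc : 0 < D' * u ^ n := by positivity
    have hup := (abs_le.mp H2).2
    have h3 : |D' * u ^ n * (√a * (∑' k, A k * g k)) - D' * u ^ n * (∑' k, g k)| ≤ ε * (1 + ε) ^ n := by
      rw [← mul_sub, abs_mul, abs_of_pos hc]
      calc _ ≤ D' * u ^ n * (ε * ∑' k, g k) := by gcongr
        _ = ε * (D' * u ^ n * ∑' k, g k) := by ring
        _ ≤ _ := by gcongr; linarith
    calc _ ≤ |D' * u ^ n * (√a * (∑' k, A k * g k)) - D' * u ^ n * (∑' k, g k)| +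
        |D' * u ^ n * (∑' k, g k) - 1| := abs_sub_le _ _ _
      _ ≤ ε * (1 + ε) ^ n + ((1 + ε) ^ n - 1) := add_le_add h3 H2
      _ = _ := by ring

end part2

section part3
open Real MeasureTheory Filter Topology Asymptotics ENNReal

universe u1 u2
set_option linter.unusedSectionVars false

/-- package of data for an averaged theta function -/
structure ThetaData (n : ℕ) (T : Type u1) [MeasurableSpace T] (μ : Measure T) where
  E : Type u2
  [i1 : NormedAddCommGroup E]
  [i2 : InnerProductSpace ℝ E]
  b : T → Fin n → E
  b0 : Fin n → E
  B : ℝ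
  δ : ℝ
  hB : 0 < B
  hδ : 0 < δ
  li : ∀ c, LinearIndependent ℝ (b c)
  li0 : LinearIndependent ℝ b0
  bd : ∀ᵐ c ∂μ, ∀ i, ‖b c i‖ ^ 2 ≤ B
  lower : ∀ᵐ c ∂μ, ∀ k : Fin n → ℤ, δ * ‖∑ i, (k i : ℝ) • b0 i‖ ^ 2 ≤ ‖∑ i, (k i : ℝ) • b c i‖ ^ 2
  one_le : ∀ k : Fin n → ℤ, k ≠ 0 → 1 ≤ ‖∑ i, (k i : ℝ) • b0 i‖ ^ 2
  meas : ∀ k : Fin n → ℤ, Measurable fun c => ‖∑ i, (k i : ℝ) • b c i‖ ^ 2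

attribute [instance] ThetaData.i1 ThetaData.i2

namespace ThetaData
variable {n : ℕ} {T : Type u1} [MeasurableSpace T] {μ : Measure T} (d : ThetaData.{u1, u2} n T μ)

/-- the quadratic form -/
noncomputable def q (c : T) (k : Fin n → ℤ) : ℝ := ‖∑ i, (k i : ℝ) • d.b c i‖ ^ 2

/-- the full theta series -/
noncomputable def S (c : T) (u : ℝ) : ℝ := ∑' k, Real.exp (-u ^ 2 * d.q c k)

/-- the extended nonnegative valued theta series without the zero term -/
noncomputable def Se (c : T) (u : ℝ) : ℝ≥0∞ :=
  ∑' k : {k : Fin n → ℤ // k ≠ 0}, ENNReal.ofReal (Real.exp (-u ^ 2 * d.q c k))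

/-- the averaged theta function -/
noncomputable def F (u : ℝ) : ℝ := (∫⁻ c, d.Se c u ∂μ).toReal

lemma summable_of_li {E : Type u2} [NormedAddCommGroup E] [InnerProductSpace ℝ E] (b : Fin n → E)
    (hb : LinearIndependent ℝ b) {a : ℝ} (ha : 0 < a) :
    Summable fun k : Fin n → ℤ => Real.exp (-a * ‖∑ i, (k i : ℝ) • b i‖ ^ 2) := by
  obtain ⟨D, hD, H⟩ := gaussMulti n b hb
  set B := 1 + ∑ i, ‖b i‖ ^ 2
  have hB : 0 < B := by positivity
  have hB' : ∀ i, ‖b i‖ ^ 2 ≤ B := fun i => by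
    have := Finset.single_le_sum (f := fun i => ‖b i‖ ^ 2) (fun i _ => sq_nonneg _) (Finset.mem_univ i)
    simp only [B]; linarith
  set u := √(min (a / π) (1 / B)) with hu
  have hu0 : 0 < min (a / π) (1 / B) := by positivity
  have hu2 : u ^ 2 = min (a / π) (1 / B) := Real.sq_sqrt hu0.le
  have h1 := (H B u hB' (Real.sqrt_pos.mpr hu0) (by
    rw [hu2]
    calc _ ≤ 1 / B * B := by gcongr; exact min_le_right _ _
      _ = 1 := by field_simp) 0 (Submodule.zero_mem _)).1
  refine Summable.of_nonneg_of_le (fun _ => (Real.exp_pos _).le) (fun k => ?_) h1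
  apply Real.exp_le_exp.mpr
  rw [add_zero]
  have : π * u ^ 2 ≤ a := by
    rw [hu2]
    calc _ ≤ π * (a / π) := by gcongr; exact min_le_left _ _
      _ = a := by field_simp
  nlinarith [sq_nonneg ‖∑ i, (k i : ℝ) • b i‖]

lemma summable (c : T) {u : ℝ} (hu : 0 < u) : Summable fun k => Real.exp (-u ^ 2 * d.q c k) :=
  summable_of_li _ (d.li c) (by positivity : 0 < u ^ 2)

lemma Se_eq (c : T) {u : ℝ} (hu : 0 < u) : d.Se c u = ENNReal.ofReal (d.S c u - 1) := by
  have h := d.summable c hu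
  have h0 : d.S c u = 1 + ∑' k : {k : Fin n → ℤ // k ≠ 0}, Real.exp (-u ^ 2 * d.q c k) := by
    have := h.tsum_subtype_add_tsum_subtype_compl ({0} : Set (Fin n → ℤ))
    rw [S, ← this]
    congr 1
    rw [tsum_singleton (0 : Fin n → ℤ) (fun k => Real.exp (-u ^ 2 * d.q c k))]
    simp [q]
  rw [h0, add_sub_cancel_left, ENNReal.ofReal_tsum_of_nonneg (fun _ => (Real.exp_pos _).le)
    (h.subtype _)]
  rfl

/-- a uniform bound -/
noncomputable def S0 (u : ℝ) : ℝ := ∑' k : Fin n → ℤ, Real.exp (-(u ^ 2 * d.δ) * ‖∑ i, (k i : ℝ) • d.b0 i‖ ^ 2)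

lemma S_le : ∀ᵐ c ∂μ, ∀ u : ℝ, 0 < u → d.S c u ≤ d.S0 u := by
  filter_upwards [d.lower] with c hc u hu
  refine (d.summable c hu).tsum_le_tsum (fun k => ?_) (summable_of_li _ d.li0 (by have := d.hδ; positivity))
  apply Real.exp_le_exp.mpr
  have := mul_le_mul_of_nonneg_left (hc k) (sq_nonneg u)
  simp only [q]
  linarith

lemma one_le_S (c : T) {u : ℝ} (hu : 0 < u) : 1 ≤ d.S c u := by
  have := (d.summable c hu).le_tsum 0 (fun _ _ => (Real.exp_pos _).le)
  simpa [q, S] using this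

lemma measurable_Se (u : ℝ) : Measurable fun c => d.Se c u := by
  refine Measurable.tsum fun k => ENNReal.measurable_ofReal.comp (Real.measurable_exp.comp ?_)
  exact (d.meas k).const_mul _

lemma measurable_S {u : ℝ} (hu : 0 < u) : Measurable fun c => d.S c u := by
  have : (fun c => d.S c u) = fun c => (d.Se c u).toReal + 1 := by
    ext c
    rw [d.Se_eq c hu, ENNReal.toReal_ofReal (by linarith [d.one_le_S c hu])]; ring
  rw [this]
  exact (d.measurable_Se u).ennreal_toReal.add_const _

variable [IsFiniteMeasure μ]

lemma integrable_S {u : ℝ} (hu : 0 < u) : Integrable (fun c => d.S c u) μ := by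
  refine Integrable.of_bound (C := d.S0 u) (d.measurable_S hu).aestronglyMeasurable ?_
  filter_upwards [d.S_le] with c hc
  rw [Real.norm_eq_abs, abs_of_nonneg (by linarith [d.one_le_S c hu])]
  exact hc u hu

lemma lintegral_Se {u : ℝ} (hu : 0 < u) :
    ∫⁻ c, d.Se c u ∂μ = ENNReal.ofReal (∫ c, (d.S c u - 1) ∂μ) := by
  have hi : Integrable (fun c => d.S c u - 1) μ := (d.integrable_S hu).sub (integrable_const 1)
  rw [ofReal_integral_eq_lintegral_ofReal hi
    (ae_of_all _ fun c => by simpa using d.one_le_S c hu)]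
  exact lintegral_congr fun c => d.Se_eq c hu

lemma F_eq {u : ℝ} (hu : 0 < u) : d.F u = ∫ c, (d.S c u - 1) ∂μ := by
  rw [F, d.lintegral_Se hu, ENNReal.toReal_ofReal]
  exact integral_nonneg fun c => by simpa using d.one_le_S c hu

lemma ofReal_F {u : ℝ} (hu : 0 < u) : ENNReal.ofReal (d.F u) = ∫⁻ c, d.Se c u ∂μ := by
  rw [F_eq d hu, lintegral_Se d hu]

lemma F_nonneg (u : ℝ) : 0 ≤ d.F u := ENNReal.toReal_nonneg

lemma F_anti : AntitoneOn d.F (Set.Ioi 0) := by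
  intro u hu v hv huv
  rw [d.F_eq hu, d.F_eq hv]
  refine integral_mono ((d.integrable_S hv).sub (integrable_const 1)) ((d.integrable_S hu).sub (integrable_const 1)) fun c => ?_
  simp only [sub_le_sub_iff_right]
  refine (d.summable c hv).tsum_le_tsum (fun k => ?_) (d.summable c hu)
  apply Real.exp_le_exp.mpr
  have : 0 ≤ d.q c k := sq_nonneg _
  have h2 : u ^ 2 ≤ v ^ 2 := by have : 0 < u := hu; gcongr
  nlinarith

lemma F_top_bound {u : ℝ} (hu : 1 ≤ u) : d.F u ≤ Real.exp (-(u ^ 2 - 1) * d.δ) * d.F 1 := by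
  have hu0 : 0 < u := by linarith
  have h1 : ∀ᵐ c ∂μ, d.Se c u ≤ ENNReal.ofReal (Real.exp (-(u ^ 2 - 1) * d.δ)) * d.Se c 1 := by
    filter_upwards [d.lower] with c hc
    rw [Se, Se, ← ENNReal.tsum_mul_left]
    refine ENNReal.tsum_le_tsum fun k => ?_
    rw [← ENNReal.ofReal_mul (Real.exp_pos _).le, ← Real.exp_add]
    apply ENNReal.ofReal_le_ofReal
    apply Real.exp_le_exp.mpr
    have h1 := hc k
    have h2 := d.one_le k k.2
    have h3 : d.δ ≤ d.q c k := by
      refine le_trans ?_ h1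
      have := d.hδ
      nlinarith
    nlinarith [mul_nonneg (by nlinarith : (0:ℝ) ≤ u ^ 2 - 1) (sub_nonneg.mpr h3)]
  have h2 := lintegral_mono_ae h1
  rw [lintegral_const_mul _ (d.measurable_Se 1), ← d.ofReal_F hu0, ← d.ofReal_F one_pos,
    ← ENNReal.ofReal_mul (Real.exp_pos _).le] at h2
  rwa [ENNReal.ofReal_le_ofReal_iff (mul_nonneg (Real.exp_pos _).le (d.F_nonneg 1))] at h2

lemma F_top (N : ℝ) : d.F =O[atTop] fun u => u ^ (-N) := by
  have h1 : d.F =O[atTop] fun u => Real.exp (-d.δ * u) := by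
    refine IsBigO.of_bound (Real.exp d.δ * d.F 1) ?_
    filter_upwards [eventually_ge_atTop 1] with u hu
    rw [Real.norm_eq_abs, abs_of_nonneg (d.F_nonneg u), Real.norm_eq_abs, abs_of_pos (Real.exp_pos _)]
    refine (d.F_top_bound hu).trans ?_
    rw [mul_right_comm, ← Real.exp_add]
    gcongr
    · exact d.F_nonneg 1
    · have := d.hδ; nlinarith [mul_nonneg d.hδ.le (by nlinarith : (0:ℝ) ≤ u ^ 2 - u)]
  exact h1.trans (isLittleO_exp_neg_mul_rpow_atTop d.hδ (-N)).isBigO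

/-- the error function -/
noncomputable def err (u : ℝ) : ℝ := (1 + gC * Real.exp (-(π ^ 2 / (2 * d.B)) / u ^ 2)) ^ n - 1

lemma main_bound : ∃ D : T → ℝ, (∀ c, 0 < D c) ∧ ∀ᵐ c ∂μ, ∀ u : ℝ, 0 < u → u ^ 2 * d.B ≤ π →
    |D c * u ^ n * d.S c u - 1| ≤ d.err u := by
  have h : ∀ c, _ := fun c => gaussMulti n (d.b c) (d.li c)
  choose D hD H using h
  refine ⟨fun c => D c / √π ^ n, fun c => by have := hD c; positivity, ?_⟩
  filter_upwards [d.bd] with c hc u hu huB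
  have hpi : √π ^ 2 = π := Real.sq_sqrt Real.pi_pos.le
  have hB := d.hB
  have := (H c d.B (u / √π) hc (by positivity) (by
    rw [div_pow, hpi, div_mul_eq_mul_div, div_le_one Real.pi_pos]; exact huB) 0 (Submodule.zero_mem _)).2
  rw [div_pow, div_pow, hpi] at this
  simp only [add_zero] at this
  have e1 : ∀ x : ℝ, -π * (u ^ 2 / π) * x = -u ^ 2 * x := fun x => by field_simp
  simp only [e1] at this
  have e2 : -π / (2 * (u ^ 2 / π * d.B)) = -(π ^ 2 / (2 * d.B)) / u ^ 2 := by field_simp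
  rw [e2] at this
  rw [err]
  convert this using 3
  rw [S]; simp only [q]; ring

lemma err_nonneg (u : ℝ) : 0 ≤ d.err u := by
  have := gC_nonneg
  rw [err, sub_nonneg]
  exact one_le_pow₀ (by have : 0 ≤ gC * Real.exp (-(π ^ 2 / (2 * d.B)) / u ^ 2) := by positivity
                        linarith)

lemma exp_bigO {κ : ℝ} (hκ : 0 < κ) (N : ℝ) :
    (fun u : ℝ => Real.exp (-κ / u ^ 2)) =O[𝓝[>] 0] fun u => u ^ N := by
  have h1 := (isLittleO_exp_neg_mul_rpow_atTop hκ (-(N / 2))).isBigO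
  have h2 : Tendsto (fun u : ℝ => (u ^ 2)⁻¹) (𝓝[>] 0) atTop := by
    refine tendsto_inv_nhdsGT_zero.comp ?_
    refine tendsto_nhdsWithin_iff.mpr ⟨?_, ?_⟩
    · have : Tendsto (fun u : ℝ => u ^ 2) (𝓝 0) (𝓝 (0 ^ 2)) := (continuous_pow 2).tendsto 0
      rw [zero_pow two_ne_zero] at this
      exact this.mono_left nhdsWithin_le_nhds
    · filter_upwards [self_mem_nhdsWithin] with u hu
      have : (0 : ℝ) < u := hu
      exact pow_pos this 2
  refine (h1.comp_tendsto h2).congr' ?_ ?_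
  · filter_upwards with u
    simp only [Function.comp, div_eq_mul_inv]
  · filter_upwards [self_mem_nhdsWithin] with u hu
    have : (0 : ℝ) < u := hu
    simp only [Function.comp]
    rw [← Real.rpow_neg_one, ← Real.rpow_natCast, ← Real.rpow_mul this.le, ← Real.rpow_mul this.le]
    congr 1; push_cast; ring

lemma err_bigO (N : ℝ) : d.err =O[𝓝[>] 0] fun u => u ^ N := by
  have hB := d.hB
  have hg := gC_nonneg
  refine IsBigO.trans ?_ (exp_bigO (κ := π ^ 2 / (2 * d.B)) (by positivity) N)
  refine IsBigO.of_bound ((1 + gC) ^ n * n * gC) ?_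
  filter_upwards [self_mem_nhdsWithin] with u hu
  have hu : (0 : ℝ) < u := hu
  rw [Real.norm_eq_abs, abs_of_nonneg (d.err_nonneg u), Real.norm_eq_abs, abs_of_pos (Real.exp_pos _), err]
  set x := Real.exp (-(π ^ 2 / (2 * d.B)) / u ^ 2) with hx
  have hx0 : 0 < x := Real.exp_pos _
  have hx1 : x ≤ 1 := by
    rw [hx, Real.exp_le_one_iff, neg_div]
    have : 0 ≤ π ^ 2 / (2 * d.B) / u ^ 2 := by positivity
    linarith
  have key : ∀ m : ℕ, (1 + gC * x) ^ m - 1 ≤ (1 + gC) ^ m * m * gC * x := by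
    intro m
    induction m with
    | zero => simp
    | succ m ih =>
      have h1 : (1 + gC * x) ^ m ≤ (1 + gC) ^ m := by gcongr; nlinarith
      have h2 : (1 : ℝ) ≤ (1 + gC) ^ m := one_le_pow₀ (by linarith)
      have h3 : (1 + gC * x) ^ (m + 1) - 1 = ((1 + gC * x) ^ m - 1) + gC * x * (1 + gC * x) ^ m := by ring
      rw [h3]
      have h4 : gC * x * (1 + gC * x) ^ m ≤ gC * x * (1 + gC) ^ m := by gcongr
      have h5 : (1 + gC) ^ (m + 1) * (m + 1 : ℕ) * gC * x =
        (1 + gC) ^ m * m * gC * x + gC * x * (1 + gC) ^ m + gC * ((1 + gC) ^ m * (m + 1) * gC * x) := by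
        push_cast; ring
      rw [h5]
      have : 0 ≤ gC * ((1 + gC) ^ m * (m + 1) * gC * x) := by positivity
      linarith
  exact key n


lemma F_bot_bound : ∃ A C u0 : ℝ, 0 < u0 ∧ ∀ u, 0 < u → u ≤ u0 →
    |u ^ n * (d.F u + μ.real Set.univ) - A| ≤ C * d.err u := by
  obtain ⟨D, hD, H⟩ := d.main_bound
  have herr0 : Tendsto d.err (𝓝[>] 0) (𝓝 0) := by
    refine (d.err_bigO 1).trans_tendsto ?_
    simp only [Real.rpow_one]
    exact (continuous_id.tendsto (0:ℝ)).mono_left nhdsWithin_le_nhds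
  have hB := d.hB
  have hev : ∀ᶠ u in 𝓝[>] (0:ℝ), d.err u ≤ 1 / 2 ∧ u ^ 2 * d.B ≤ π := by
    refine (herr0.eventually_le_const (by norm_num)).and ?_
    have : Tendsto (fun u : ℝ => u ^ 2 * d.B) (𝓝[>] 0) (𝓝 (0 ^ 2 * d.B)) :=
      ((continuous_pow 2).mul continuous_const).continuousAt.tendsto.mono_left nhdsWithin_le_nhds
    exact this.eventually_le_const (by simp [Real.pi_pos])
  obtain ⟨u0, hu0, hu0'⟩ := mem_nhdsGT_iff_exists_Ioc_subset.mp hev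
  have hu0 : 0 < u0 := hu0
  set C1 := 2 * u0 ^ n * d.S0 u0 with hC1
  have hDi : ∀ᵐ c ∂μ, (D c)⁻¹ ≤ C1 := by
    filter_upwards [H, d.S_le] with c hc hS
    have h1 := hu0' (Set.right_mem_Ioc.mpr hu0)
    have h2 := hc u0 hu0 h1.2
    have h3 := (abs_le.mp h2).1
    have h4 : 1 / 2 ≤ D c * u0 ^ n * d.S c u0 := by linarith [h1.1]
    have h5 := hS u0 hu0
    rw [inv_le_iff_one_le_mul₀ (hD c), hC1]
    have h6 : D c * u0 ^ n * d.S c u0 ≤ D c * u0 ^ n * d.S0 u0 := by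
      have := (hD c).le
      gcongr
    nlinarith
  set C2 := C1 * μ.real Set.univ with hC2
  set g : ℝ → ℝ := fun u => u ^ n * (d.F u + μ.real Set.univ) with hg
  have hgint : ∀ u, 0 < u → g u = ∫ c, u ^ n * d.S c u ∂μ := by
    intro u hu
    rw [hg]
    simp only
    rw [integral_const_mul, d.F_eq hu, integral_sub (d.integrable_S hu) (integrable_const 1)]
    simp
  have hpt : ∀ᵐ c ∂μ, ∀ u, 0 < u → u ≤ u0 → |u ^ n * d.S c u - (D c)⁻¹| ≤ C1 * d.err u := by
    filter_upwards [H, hDi] with c hc hDc u hu huu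
    have h2 := hc u hu (hu0' ⟨hu, huu⟩).2
    have : u ^ n * d.S c u - (D c)⁻¹ = (D c)⁻¹ * (D c * u ^ n * d.S c u - 1) := by
      have := (hD c).ne'
      field_simp
    rw [this, abs_mul, abs_of_pos (inv_pos.mpr (hD c))]
    exact mul_le_mul hDc h2 (abs_nonneg _) ((inv_pos.mpr (hD c)).le.trans hDc)
  have hdiff : ∀ u v, 0 < u → u ≤ u0 → 0 < v → v ≤ u0 → |g u - g v| ≤ C2 * (d.err u + d.err v) := by
    intro u v hu huu hv hvv
    rw [hgint u hu, hgint v hv, ← integral_sub ((d.integrable_S hu).const_mul _) ((d.integrable_S hv).const_mul _)]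
    have := norm_integral_le_of_norm_le_const (μ := μ) (f := fun c => u ^ n * d.S c u - v ^ n * d.S c v)
      (C := C1 * (d.err u + d.err v)) (by
        filter_upwards [hpt] with c hc
        have h1 := hc u hu huu
        have h2 := hc v hv hvv
        rw [Real.norm_eq_abs]
        calc _ ≤ |u ^ n * d.S c u - (D c)⁻¹| + |(D c)⁻¹ - v ^ n * d.S c v| := abs_sub_le _ _ _
          _ ≤ _ := by rw [abs_sub_comm (D c)⁻¹]; linarith)
    rw [Real.norm_eq_abs] at this
    refine this.trans (le_of_eq ?_)
    rw [hC2]; ring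
  -- limit
  have hcau : Cauchy (map g (𝓝[>] 0)) := by
    rw [Metric.cauchy_iff]
    refine ⟨inferInstance, fun ε hε => ?_⟩
    have h0 : Tendsto (fun u => |C2| * d.err u) (𝓝[>] 0) (𝓝 (|C2| * 0)) := herr0.const_mul _
    rw [mul_zero] at h0
    have h1 : ∀ᶠ u in 𝓝[>] (0:ℝ), |C2| * d.err u < ε / 2 := h0.eventually_lt_const (by linarith)
    have h2 : ∀ᶠ u in 𝓝[>] (0:ℝ), u ∈ Set.Ioc 0 u0 := Ioc_mem_nhdsGT hu0
    refine ⟨g '' {u | |C2| * d.err u < ε / 2 ∧ u ∈ Set.Ioc 0 u0}, image_mem_map (h1.and h2), ?_⟩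
    rintro _ ⟨u, ⟨hu1, hu2⟩, rfl⟩ _ ⟨v, ⟨hv1, hv2⟩, rfl⟩
    rw [Real.dist_eq]
    have := hdiff u v hu2.1 hu2.2 hv2.1 hv2.2
    have h3 : C2 * (d.err u + d.err v) ≤ |C2| * (d.err u + d.err v) := by
      have := d.err_nonneg u
      have := d.err_nonneg v
      gcongr
      exact le_abs_self _
    linarith
  obtain ⟨A, hA⟩ := CompleteSpace.complete hcau
  have hA : Tendsto g (𝓝[>] 0) (𝓝 A) := hA
  refine ⟨A, C2, u0, hu0, fun u hu huu => ?_⟩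
  have h1 : Tendsto (fun v => |g u - g v|) (𝓝[>] 0) (𝓝 |g u - A|) := (tendsto_const_nhds.sub hA).abs
  have h2 : Tendsto (fun v => C2 * (d.err u + d.err v)) (𝓝[>] 0) (𝓝 (C2 * (d.err u + 0))) :=
    (tendsto_const_nhds.add herr0).const_mul _
  rw [add_zero] at h2
  refine le_of_tendsto_of_tendsto h1 h2 ?_
  filter_upwards [Ioc_mem_nhdsGT hu0] with v hv
  exact hdiff u v hu huu hv.1 hv.2

lemma F_bot : ∃ A : ℝ, ∀ N : ℝ,
    (fun u => d.F u - (A * u ^ (-(n:ℝ)) - μ.real Set.univ)) =O[𝓝[>] 0] fun u => u ^ N := by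
  obtain ⟨A, C, u0, hu0, H⟩ := d.F_bot_bound
  refine ⟨A, fun N => ?_⟩
  have h1 : (fun u => d.F u - (A * u ^ (-(n:ℝ)) - μ.real Set.univ)) =O[𝓝[>] 0]
      fun u => u ^ (-(n:ℝ)) * d.err u := by
    refine IsBigO.of_bound C ?_
    filter_upwards [Ioc_mem_nhdsGT hu0] with u hu
    have hu' : 0 < u := hu.1
    have hr : u ^ (-(n:ℝ)) = (u ^ n)⁻¹ := by rw [Real.rpow_neg hu'.le, Real.rpow_natCast]
    have e : d.F u - (A * u ^ (-(n:ℝ)) - μ.real Set.univ) =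
        u ^ (-(n:ℝ)) * (u ^ n * (d.F u + μ.real Set.univ) - A) := by
      rw [hr]; field_simp; ring
    rw [e, Real.norm_eq_abs, abs_mul, Real.norm_eq_abs, abs_mul, abs_of_nonneg (d.err_nonneg u),
      abs_of_pos (Real.rpow_pos_of_pos hu' _)]
    have := H u hu' hu.2
    have h3 : 0 < u ^ (-(n:ℝ)) := Real.rpow_pos_of_pos hu' _
    nlinarith [mul_le_mul_of_nonneg_left this h3.le]
  refine h1.trans ?_
  refine ((isBigO_refl _ _).mul (d.err_bigO (N + n))).congr' (EventuallyEq.rfl) ?_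
  filter_upwards [self_mem_nhdsWithin] with u hu
  have hu : 0 < u := hu
  rw [← Real.rpow_add hu]; congr 1; ring

end ThetaData

end part3

section part4
open Real MeasureTheory Filter Topology Asymptotics ENNReal

universe u1 u2
set_option linter.unusedSectionVars false

namespace ThetaData
variable {n : ℕ} {T : Type u1} [MeasurableSpace T] {μ : Measure T} (d : ThetaData.{u1, u2} n T μ)

lemma mellin_cont [IsFiniteMeasure μ] : ∃ (G : ℂ → ℂ) (A B : ℝ), Differentiable ℂ G ∧
    ∀ s : ℝ, (n : ℝ) < s → ∃ m : ℝ, 0 ≤ m ∧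
      ∫⁻ u in Set.Ioi (0 : ℝ), ENNReal.ofReal (u ^ (s - 1)) * ∫⁻ c, d.Se c u ∂μ = ENNReal.ofReal m ∧
      (m : ℂ) = G s + A / ((s : ℂ) - n) - B / s := by
  obtain ⟨A, hA⟩ := d.F_bot
  set B := μ.real Set.univ with hB
  set Fc : ℝ → ℂ := fun u => (d.F u : ℂ) with hFc
  set p1 : ℝ → ℂ := Set.indicator (Set.Ioc 0 1) (fun u : ℝ => (u : ℂ) ^ (-(n : ℂ))) with hp1
  set p2 : ℝ → ℂ := Set.indicator (Set.Ioc 0 1) (fun _ : ℝ => (1 : ℂ)) with hp2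
  set h : ℝ → ℂ := fun u => Fc u - ((A : ℂ) • p1 u - (B : ℂ) • p2 u) with hh
  have hFint : LocallyIntegrableOn d.F (Set.Ioi 0) := by
    rw [locallyIntegrableOn_iff isOpen_Ioi.isLocallyClosed]
    intro k hk hkc
    exact (d.F_anti.mono hk).integrableOn_isCompact hkc
  have hFcint : LocallyIntegrableOn Fc (Set.Ioi 0) := fun x hx => by
    obtain ⟨t, ht, hi⟩ := hFint x hx
    exact ⟨t, ht, hi.ofReal⟩
  have hp1int : LocallyIntegrableOn p1 (Set.Ioi 0) := by
    rw [locallyIntegrableOn_iff isOpen_Ioi.isLocallyClosed]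
    intro k hk hkc
    rw [hp1]
    refine IntegrableOn.indicator ?_ measurableSet_Ioc
    refine ContinuousOn.integrableOn_compact hkc ?_
    intro u hu
    refine ContinuousAt.continuousWithinAt ?_
    exact ContinuousAt.cpow Complex.continuous_ofReal.continuousAt continuousAt_const (Or.inl (by simpa using hk hu))
  have hp2int : LocallyIntegrableOn p2 (Set.Ioi 0) := by
    rw [locallyIntegrableOn_iff isOpen_Ioi.isLocallyClosed]
    intro k hk hkc
    rw [hp2]
    refine IntegrableOn.indicator ?_ measurableSet_Ioc
    exact ContinuousOn.integrableOn_compact hkc continuousOn_const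
  have hhint : LocallyIntegrableOn h (Set.Ioi 0) := by
    rw [locallyIntegrableOn_iff isOpen_Ioi.isLocallyClosed] at *
    intro k hk hkc
    exact (hFcint k hk hkc).sub (((hp1int k hk hkc).smul (A : ℂ)).sub ((hp2int k hk hkc).smul (B : ℂ)))
  have hhtop : ∀ N : ℝ, h =O[atTop] fun u => u ^ (-N) := by
    intro N
    have h1 := d.F_top N
    refine IsBigO.congr' (f₁ := fun u => (d.F u : ℂ)) ?_ ?_ EventuallyEq.rfl
    · exact (Complex.isBigO_ofReal_left (f := d.F)).mpr h1
    · filter_upwards [eventually_gt_atTop 1] with u hu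
      have : u ∉ Set.Ioc (0 : ℝ) 1 := fun h => absurd h.2 (not_le.mpr hu)
      simp [hh, hp1, hp2, Set.indicator_of_notMem this, hFc]
  have hhbot : ∀ N : ℝ, h =O[𝓝[>] 0] fun u => u ^ N := by
    intro N
    refine IsBigO.congr' (f₁ := fun u => ((d.F u - (A * u ^ (-(n : ℝ)) - B) : ℝ) : ℂ)) ?_ ?_ EventuallyEq.rfl
    · exact (Complex.isBigO_ofReal_left (f := fun u => d.F u - (A * u ^ (-(n : ℝ)) - B))).mpr (hA N)
    · filter_upwards [Ioc_mem_nhdsGT (zero_lt_one' ℝ)] with u hu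
      simp only [hh, hp1, hp2, Set.indicator_of_mem hu, hFc]
      push_cast
      rw [Complex.ofReal_cpow hu.1.le]
      simp
  have hGdiff : Differentiable ℂ (mellin h) := fun s =>
    mellin_differentiableAt_of_isBigO_rpow (a := s.re + 1) (b := s.re - 1) hhint (hhtop _) (by linarith)
      (hhbot _) (by linarith)
  refine ⟨mellin h, A, B, hGdiff, fun s hs => ?_⟩
  have hs0 : (0 : ℝ) < s := lt_of_le_of_lt (Nat.cast_nonneg n) hs
  have hconvh : MellinConvergent h (s : ℂ) :=
    mellinConvergent_of_isBigO_rpow (a := s + 1) (b := s - 1) hhint (hhtop _) (by simp) (hhbot _) (by simp)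
  have hm1 := hasMellin_cpow_Ioc (-(n : ℂ)) (s := (s : ℂ)) (by simpa using hs)
  have hm2 := hasMellin_one_Ioc (s := (s : ℂ)) (by simpa using hs0)
  have hsum : HasMellin (fun u => h u + ((A : ℂ) • p1 u - (B : ℂ) • p2 u)) (s : ℂ) _ :=
    hasMellin_add hconvh (hasMellin_sub (hm1.1.const_smul (A : ℂ)) (hm2.1.const_smul (B : ℂ))).1
  have hFeq : (fun u => h u + ((A : ℂ) • p1 u - (B : ℂ) • p2 u)) = Fc := by
    funext u; simp [hh]
  rw [hFeq] at hsum
  obtain ⟨hFconv, hFval⟩ := hsum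
  have hval2 : mellin (fun u => (A : ℂ) • p1 u - (B : ℂ) • p2 u) (s : ℂ) = A / ((s : ℂ) - n) - B / s := by
    rw [(hasMellin_sub (hm1.1.const_smul (A : ℂ)) (hm2.1.const_smul (B : ℂ))).2,
      mellin_const_smul, mellin_const_smul, hm1.2, hm2.2]
    simp only [smul_eq_mul]
    ring
  rw [hval2] at hFval
  refine ⟨∫ u in Set.Ioi (0 : ℝ), u ^ (s - 1) * d.F u, ?_, ?_, ?_⟩
  · refine setIntegral_nonneg measurableSet_Ioi fun u hu => ?_
    exact mul_nonneg (Real.rpow_nonneg (le_of_lt hu) _) (d.F_nonneg u)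
  · have hcongr : ∀ u ∈ Set.Ioi (0 : ℝ), (u : ℂ) ^ ((s : ℂ) - 1) • Fc u = ((u ^ (s - 1) * d.F u : ℝ) : ℂ) := by
      intro u hu
      push_cast
      rw [Complex.ofReal_cpow (le_of_lt hu)]
      simp [hFc]
    have hI : IntegrableOn (fun u => u ^ (s - 1) * d.F u) (Set.Ioi 0) := by
      have h3 : IntegrableOn (fun u : ℝ => ((u ^ (s - 1) * d.F u : ℝ) : ℂ)) (Set.Ioi 0) :=
        (integrableOn_congr_fun hcongr measurableSet_Ioi).mp hFconv
      simpa using! h3.re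
    rw [ofReal_integral_eq_lintegral_ofReal hI]
    · refine setLIntegral_congr_fun measurableSet_Ioi fun u hu => ?_
      rw [ENNReal.ofReal_mul (Real.rpow_nonneg (le_of_lt hu) _), d.ofReal_F hu]
    · refine (ae_restrict_iff' measurableSet_Ioi).mpr (Eventually.of_forall fun u hu => ?_)
      exact mul_nonneg (Real.rpow_nonneg (le_of_lt hu) _) (d.F_nonneg u)
  · rw [← add_sub_assoc] at hFval
    rw [← hFval, mellin, ← integral_complex_ofReal]
    refine setIntegral_congr_fun measurableSet_Ioi fun u hu => ?_
    push_cast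
    rw [Complex.ofReal_cpow (le_of_lt hu)]
    simp [hFc]

end ThetaData

end part4

section part5
open Real MeasureTheory Filter Topology Asymptotics ENNReal

set_option linter.unusedSectionVars false

namespace Unfold

lemma lintegral_exp_sub (s : ℝ) (g : ℝ → ℝ≥0∞) :
    ∫⁻ u in Set.Ioi (0 : ℝ), ENNReal.ofReal (u ^ (s - 1)) * g u
      = ∫⁻ t : ℝ, ENNReal.ofReal (Real.exp (s * t)) * g (Real.exp t) := by
  have h := lintegral_image_eq_lintegral_abs_deriv_mul (s := Set.univ) (f := Real.exp) (f' := Real.exp)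
    MeasurableSet.univ (fun x _ => (Real.hasDerivAt_exp x).hasDerivWithinAt) Real.exp_injective.injOn
    (fun u => ENNReal.ofReal (u ^ (s - 1)) * g u)
  rw [Set.image_univ, Real.range_exp, Measure.restrict_univ] at h
  rw [h]
  refine lintegral_congr fun t => ?_
  rw [← mul_assoc, ← ENNReal.ofReal_mul (abs_nonneg _), abs_of_pos (Real.exp_pos t), ← Real.exp_mul,
    ← Real.exp_add]
  congr 3
  ring

lemma lintegral_gamma {a : ℝ} (ha : 0 < a) :
    ∫⁻ t : ℝ, ENNReal.ofReal (Real.exp (a * t)) * ENNReal.ofReal (Real.exp (-Real.exp t))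
      = ENNReal.ofReal (Real.Gamma a) := by
  rw [← lintegral_exp_sub a (fun u => ENNReal.ofReal (Real.exp (-u))), Real.Gamma_eq_integral ha,
    ofReal_integral_eq_lintegral_ofReal (Real.GammaIntegral_convergent ha)]
  · refine setLIntegral_congr_fun measurableSet_Ioi fun u hu => ?_
    rw [← ENNReal.ofReal_mul (Real.rpow_nonneg (le_of_lt hu) _), mul_comm]
  · refine (ae_restrict_iff' measurableSet_Ioi).mpr (Eventually.of_forall fun u hu => ?_)
    exact mul_nonneg (Real.exp_pos _).le (Real.rpow_nonneg (le_of_lt hu) _)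

/-- the unit cube -/
def cube (W : Type*) : Set (W → ℝ) := {c | ∀ w, c w ∈ Set.Ico (0 : ℝ) 1}

variable {W : Type*} [Fintype W]

lemma measurableSet_cube : MeasurableSet (cube W) := by
  have : cube W = Set.univ.pi fun _ => Set.Ico (0 : ℝ) 1 := by ext; simp [cube]
  rw [this]
  exact MeasurableSet.univ_pi fun _ => measurableSet_Ico

lemma volume_cube : volume (cube W) = 1 := by
  have : cube W = Set.univ.pi fun _ => Set.Ico (0 : ℝ) 1 := by ext; simp [cube]
  rw [this, volume_pi_pi]
  simp

lemma tsum_cube (f : (W → ℝ) → ℝ≥0∞) :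
    ∑' k : W → ℤ, ∫⁻ c in cube W, f (c + fun w => (k w : ℝ)) = ∫⁻ c, f c := by
  classical
  set S : (W → ℤ) → Set (W → ℝ) := fun k => {c | ∀ w, ⌊c w⌋ = k w} with hS
  have hSm : ∀ k, MeasurableSet (S k) := by
    intro k
    have : S k = Set.univ.pi fun w => Set.Ico (k w : ℝ) (k w + 1) := by
      ext c; simp [hS, Int.floor_eq_iff]
    rw [this]
    exact MeasurableSet.univ_pi fun _ => measurableSet_Ico
  have hU : (⋃ k, S k) = Set.univ := by
    ext c; simp only [Set.mem_iUnion, Set.mem_univ, iff_true]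
    exact ⟨fun w => ⌊c w⌋, fun w => rfl⟩
  have hd : Pairwise (Function.onFun Disjoint S) := by
    intro k l hkl
    rw [Function.onFun, Set.disjoint_left]
    intro c hc hc'
    exact hkl (funext fun w => (hc w).symm.trans (hc' w))
  rw [← setLIntegral_univ f, ← hU, lintegral_iUnion hSm hd]
  refine tsum_congr fun k => ?_
  rw [← lintegral_indicator measurableSet_cube, ← lintegral_indicator (hSm k),
    ← lintegral_add_right_eq_self ((S k).indicator f) (fun w => (k w : ℝ))]
  refine lintegral_congr fun c => ?_
  have : c ∈ cube W ↔ (c + fun w => (k w : ℝ)) ∈ S k := by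
    simp only [cube, hS, Set.mem_ofPred_eq, Pi.add_apply, Int.floor_add_intCast]
    refine forall_congr' fun w => ?_
    rw [add_eq_right, Int.floor_eq_zero_iff]
  simp only [Set.indicator_apply, this]

lemma unfold_sum {X ι τ : Type*} [Countable X] [Fintype τ] (e : X ≃ ι × τ × (W → ℤ))
    (l0 : X → ℝ) (l1 : X → W → ℝ) (g0 : ι → ℝ) (g1 : ι → W → ℝ)
    (h0 : ∀ x, l0 x = g0 (e x).1) (h1 : ∀ x, l1 x = g1 (e x).1 + fun w => ((e x).2.2 w : ℝ))
    (Ψ : ℝ × (W → ℝ) → ℝ≥0∞) (hΨ : Measurable Ψ) (a : ℝ) :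
    ∫⁻ t : ℝ, ENNReal.ofReal (Real.exp (a * t)) * ∫⁻ c in cube W, ∑' x, Ψ (t + l0 x, c + l1 x)
      = Fintype.card τ * (∑' i, ENNReal.ofReal (Real.exp (-a * g0 i))) *
        ∫⁻ t : ℝ, ENNReal.ofReal (Real.exp (a * t)) * ∫⁻ c, Ψ (t, c) := by
  have m1 : ∀ x, Measurable fun p : ℝ × (W → ℝ) => Ψ (p.1 + l0 x, p.2 + l1 x) := fun x =>
    hΨ.comp (by fun_prop)
  have m2 : ∀ x, Measurable fun t : ℝ => ∫⁻ c in cube W, Ψ (t + l0 x, c + l1 x) := fun x =>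
    Measurable.lintegral_prod_right' (m1 x)
  have m3 : Measurable fun t : ℝ => ENNReal.ofReal (Real.exp (a * t)) := by fun_prop
  calc _ = ∫⁻ t : ℝ, ∑' x, ENNReal.ofReal (Real.exp (a * t)) * ∫⁻ c in cube W, Ψ (t + l0 x, c + l1 x) := by
        refine lintegral_congr fun t => ?_
        have m5 : ∀ x, Measurable fun c : W → ℝ => Ψ (t + l0 x, c + l1 x) := fun x => hΨ.comp (by fun_prop)
        rw [lintegral_tsum fun x => (m5 x).aemeasurable, ENNReal.tsum_mul_left]
    _ = ∑' x, ∫⁻ t : ℝ, ENNReal.ofReal (Real.exp (a * t)) * ∫⁻ c in cube W, Ψ (t + l0 x, c + l1 x) :=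
        lintegral_tsum fun x => (m3.mul (m2 x)).aemeasurable
    _ = ∑' x, ENNReal.ofReal (Real.exp (-a * g0 (e x).1)) *
          ∫⁻ t : ℝ, ENNReal.ofReal (Real.exp (a * t)) * ∫⁻ c in cube W, Ψ (t, c + l1 x) := by
        refine tsum_congr fun x => ?_
        have m4 : Measurable fun t : ℝ => ∫⁻ c in cube W, Ψ (t, c + l1 x) :=
          Measurable.lintegral_prod_right' (hΨ.comp (by fun_prop) : Measurable fun p : ℝ × (W → ℝ) => Ψ (p.1, p.2 + l1 x))
        rw [← lintegral_const_mul _ (by fun_prop), ← lintegral_add_right_eq_self (fun t : ℝ =>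
          ENNReal.ofReal (Real.exp (-a * g0 (e x).1)) * (ENNReal.ofReal (Real.exp (a * t)) *
            ∫⁻ c in cube W, Ψ (t, c + l1 x))) (l0 x)]
        refine lintegral_congr fun t => ?_
        rw [← mul_assoc, ← ENNReal.ofReal_mul (Real.exp_pos _).le, ← Real.exp_add, h0]
        congr 3
        ring
    _ = ∑' p : ι × τ × (W → ℤ), ENNReal.ofReal (Real.exp (-a * g0 p.1)) *
          ∫⁻ t : ℝ, ENNReal.ofReal (Real.exp (a * t)) * ∫⁻ c in cube W, Ψ (t, c + (g1 p.1 + fun w => (p.2.2 w : ℝ))) := by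
        rw [← e.tsum_eq]
        refine tsum_congr fun x => ?_
        rw [h1]
    _ = ∑' i, ∑' _ : τ, ENNReal.ofReal (Real.exp (-a * g0 i)) *
          ∫⁻ t : ℝ, ENNReal.ofReal (Real.exp (a * t)) * ∫⁻ c, Ψ (t, c) := by
        rw [ENNReal.tsum_prod']
        refine tsum_congr fun i => ?_
        rw [ENNReal.tsum_prod']
        refine tsum_congr fun _ => ?_
        dsimp only
        rw [ENNReal.tsum_mul_left]
        congr 1
        rw [← lintegral_tsum]
        · refine lintegral_congr fun t => ?_
          rw [ENNReal.tsum_mul_left]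
          congr 1
          rw [← lintegral_add_right_eq_self (fun c => Ψ (t, c)) (g1 i), ← tsum_cube]
          refine tsum_congr fun k => lintegral_congr fun c => ?_
          rw [add_assoc, add_comm (fun w => _) (g1 i)]
        · intro k
          have m4 : Measurable fun t : ℝ => ∫⁻ c in cube W, Ψ (t, c + (g1 i + fun w => (k w : ℝ))) :=
            Measurable.lintegral_prod_right' (hΨ.comp (by fun_prop) : Measurable fun p : ℝ × (W → ℝ) => Ψ (p.1, p.2 + (g1 i + fun w => (k w : ℝ))))
          exact (m3.mul m4).aemeasurable
    _ = _ := by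
        simp only [tsum_fintype, Finset.sum_const, Finset.card_univ, nsmul_eq_mul]
        rw [ENNReal.tsum_mul_left, ENNReal.tsum_mul_right, mul_assoc]

lemma linear_cov {E F : Type*} [NormedAddCommGroup E] [NormedSpace ℝ E] [FiniteDimensional ℝ E]
    [NormedAddCommGroup F] [NormedSpace ℝ F] [FiniteDimensional ℝ F]
    [MeasurableSpace E] [BorelSpace E] [MeasurableSpace F] [BorelSpace F]
    (μ : Measure E) [μ.IsAddHaarMeasure] (ν : Measure F) [ν.IsAddHaarMeasure] (e : E ≃L[ℝ] F) :
    ∃ C : ℝ, 0 < C ∧ ∀ f : F → ℝ≥0∞, ∫⁻ x, f (e x) ∂μ = ENNReal.ofReal C * ∫⁻ y, f y ∂ν := by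
  have : (μ.map e).IsAddHaarMeasure := e.isAddHaarMeasure_map μ
  have h := Measure.isAddLeftInvariant_eq_smul (μ.map e) ν
  have h0 := Measure.addHaarScalarFactor_pos_of_isAddHaarMeasure (μ.map e) ν
  set c := Measure.addHaarScalarFactor (μ.map e) ν with hc
  refine ⟨c, h0, fun f => ?_⟩
  have h2 : ∫⁻ x, f (e x) ∂μ = ∫⁻ y, f y ∂(μ.map e) :=
    (lintegral_map_equiv f e.toHomeomorph.toMeasurableEquiv).symm
  rw [h2, h, lintegral_smul_measure, ENNReal.ofReal_coe_nnreal]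
  rfl

lemma lintegral_pi_prod {V : Type*} [Fintype V] (f : V → ℝ → ℝ) (hf : ∀ v, Integrable (f v))
    (hf0 : ∀ v t, 0 ≤ f v t) :
    ∫⁻ z : V → ℝ, ENNReal.ofReal (∏ v, f v (z v)) = ENNReal.ofReal (∏ v, ∫ t, f v t) := by
  rw [← integral_fintype_prod_volume_eq_prod, ofReal_integral_eq_lintegral_ofReal]
  · exact Integrable.fintype_prod hf
  · exact Eventually.of_forall fun z => Finset.prod_nonneg fun v _ => hf0 v _

lemma lintegral_gamma_pi {V : Type*} [Fintype V] (a : V → ℝ) (ha : ∀ v, 0 < a v) :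
    ∫⁻ z : V → ℝ, ENNReal.ofReal (Real.exp (∑ v, a v * z v)) * ENNReal.ofReal (Real.exp (-∑ v, Real.exp (z v)))
      = ENNReal.ofReal (∏ v, Real.Gamma (a v)) := by
  have hi : ∀ v, Integrable fun t : ℝ => Real.exp (a v * t) * Real.exp (-Real.exp t) := by
    intro v
    rw [← lintegral_ofReal_ne_top_iff_integrable (by fun_prop)
      (Eventually.of_forall fun t => by positivity)]
    have := lintegral_gamma (ha v)
    simp only [ENNReal.ofReal_mul (Real.exp_pos _).le]
    rw [this]
    exact ENNReal.ofReal_ne_top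
  have hv : ∀ v, ∫ t : ℝ, Real.exp (a v * t) * Real.exp (-Real.exp t) = Real.Gamma (a v) := by
    intro v
    rw [integral_eq_lintegral_of_nonneg_ae (Eventually.of_forall fun t => by positivity) (by fun_prop)]
    simp only [ENNReal.ofReal_mul (Real.exp_pos _).le]
    rw [lintegral_gamma (ha v), ENNReal.toReal_ofReal (Real.Gamma_pos_of_pos (ha v)).le]
  rw [← Finset.prod_congr rfl (fun v _ => hv v), ← lintegral_pi_prod _ hi (fun v t => by positivity)]
  refine lintegral_congr fun z => ?_
  rw [← ENNReal.ofReal_mul (Real.exp_pos _).le, Finset.prod_mul_distrib, ← Real.exp_sum, ← Real.exp_sum,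
    Finset.sum_neg_distrib]

end Unfold

end part5

section part6
open Real MeasureTheory Filter Topology Asymptotics ENNReal NumberField
open NumberField.Units NumberField.Units.dirichletUnitTheorem NumberField.mixedEmbedding
open NumberField.mixedEmbedding.fundamentalCone

set_option linter.unusedSectionVars false

namespace NFU
open scoped Classical
/-- splitting off the distinguished place -/
noncomputable def splitEquiv (K : Type*) [Field K] [NumberField K] :
    (ℝ × ({w : InfinitePlace K // w ≠ w₀} → ℝ)) ≃ₗ[ℝ] (InfinitePlace K → ℝ) where
  toFun p := fun v => if h : v = w₀ then p.1 else p.2 ⟨v, h⟩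
  invFun x := (x w₀, fun w => x w)
  map_add' p q := by ext v; by_cases h : v = w₀ <;> simp [h]
  map_smul' r p := by ext v; by_cases h : v = w₀ <;> simp [h]
  left_inv p := by
    refine Prod.ext ?_ ?_
    · simp
    · ext w; simp [w.2]
  right_inv x := by
    ext v; by_cases h : v = w₀ <;> simp [h]

variable (K : Type*) [Field K] [NumberField K]

/-- logarithmic coordinates -/
noncomputable def Z : (ℝ × ({w : InfinitePlace K // w ≠ w₀} → ℝ)) ≃ₗ[ℝ] (InfinitePlace K → ℝ) :=
  ((splitEquiv K).trans (completeBasis K).equivFun.symm).trans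
    (LinearEquiv.piCongrRight fun v =>
      LinearEquiv.smulOfNeZero ℝ ℝ (2 / (v.mult : ℝ)) (div_ne_zero two_ne_zero InfinitePlace.mult_coe_ne_zero))

lemma Z_apply (p) (v : InfinitePlace K) : Z K p v = 2 * p.1 +
    2 / v.mult * ∑ w : {w : InfinitePlace K // w ≠ w₀}, p.2 w * completeBasis K w v := by
  have hm : (v.mult : ℝ) ≠ 0 := InfinitePlace.mult_coe_ne_zero
  simp only [Z, LinearEquiv.trans_apply, LinearEquiv.piCongrRight_apply, LinearEquiv.smulOfNeZero_apply,
    smul_eq_mul]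
  rw [Module.Basis.equivFun_symm_apply, Fintype.sum_eq_add_sum_subtype_ne _ w₀, completeBasis_apply_of_eq]
  have h1 : splitEquiv K p w₀ = p.1 := by simp [splitEquiv]
  have h2 : ∀ w : {w : InfinitePlace K // w ≠ w₀}, splitEquiv K p w = p.2 w := fun w => by
    simp [splitEquiv, w.2]
  simp only [h1, h2, Pi.add_apply, Pi.smul_apply, smul_eq_mul, Finset.sum_apply]
  field_simp

lemma Z_add_fst (t : ℝ) (c) (v : InfinitePlace K) : Z K (t, c) v = 2 * t + Z K (0, c) v := by
  simp [Z_apply]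

lemma sum_Z (p) : ∑ v : InfinitePlace K, (v.mult : ℝ) / 2 * Z K p v = Module.finrank ℚ K * p.1 := by
  have h0 : ∀ w : {w : InfinitePlace K // w ≠ w₀}, ∑ v, completeBasis K w v = 0 := by
    intro w
    apply sum_eq_zero_of_mem_span_completeFamily
    apply Submodule.subset_span
    exact ⟨w, by simp [completeBasis]⟩
  have h1 : ∀ v : InfinitePlace K, (v.mult : ℝ) / 2 * Z K p v = v.mult * p.1 +
      ∑ w : {w : InfinitePlace K // w ≠ w₀}, p.2 w * completeBasis K w v := by
    intro v
    have hm : (v.mult : ℝ) ≠ 0 := InfinitePlace.mult_coe_ne_zero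
    rw [Z_apply]
    field_simp
  simp only [h1]
  rw [Finset.sum_add_distrib, Finset.sum_comm, ← Finset.sum_mul]
  simp only [← Finset.mul_sum, h0, mul_zero, Finset.sum_const_zero, add_zero]
  rw [← Nat.cast_sum, InfinitePlace.sum_mult_eq]

variable {K}

/-- log vector -/
noncomputable def Lam (x : K) : InfinitePlace K → ℝ := fun v => 2 * Real.log (v x)

lemma Lam_mul {x y : K} (hx : x ≠ 0) (hy : y ≠ 0) : Lam (x * y) = Lam x + Lam y := by
  ext v
  simp only [Lam, Pi.add_apply, map_mul]
  rw [Real.log_mul ((map_ne_zero v).mpr hx) ((map_ne_zero v).mpr hy)]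
  ring

lemma Lam_unit (k : {w : InfinitePlace K // w ≠ w₀} → ℤ) (ζ : torsion K) :
    Lam (((ζ : (𝓞 K)ˣ) * ∏ i, fundSystem K i ^ k (equivFinRank i) : (𝓞 K)ˣ) : K) =
      Z K (0, fun w => (k w : ℝ)) := by
  ext v
  have hm : (v.mult : ℝ) ≠ 0 := InfinitePlace.mult_coe_ne_zero
  rw [Z_apply, Lam]
  have h1 : ∀ w : {w : InfinitePlace K // w ≠ w₀}, completeBasis K w v =
      v.mult * Real.log (v ((fundSystem K (equivFinRank.symm w) : (𝓞 K)ˣ) : K)) := by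
    intro w
    rw [completeBasis_apply_of_ne, expMap_symm_apply, normAtAllPlaces_mixedEmbedding]
  have hv : v ((((ζ : (𝓞 K)ˣ) * ∏ i, fundSystem K i ^ k (equivFinRank i) : (𝓞 K)ˣ) : 𝓞 K) : K) =
      ∏ i, v ((fundSystem K i : (𝓞 K)ˣ) : K) ^ k (equivFinRank i) := by
    have h2 : v (((ζ : (𝓞 K)ˣ) : 𝓞 K) : K) = 1 := by
      have := (mem_torsion K).mp ζ.2 v
      exact this
    simp only [Units.coe_mul, map_mul, h2, one_mul, Units.coe_prod, map_prod, Units.coe_zpow, map_zpow₀]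
  rw [hv, Real.log_prod (fun i _ => zpow_ne_zero _ ((map_ne_zero v).mpr (by simp)))]
  simp only [h1, Real.log_zpow]
  rw [← equivFinRank.sum_comp]
  simp only [Equiv.symm_apply_apply]
  rw [Finset.mul_sum, Finset.mul_sum]
  simp only [mul_zero, zero_add]
  refine Finset.sum_congr rfl fun i _ => ?_
  field_simp

lemma fst_symm_Lam {x : K} (hx : x ≠ 0) :
    ((Z K).symm (Lam x)).1 = Real.log (|Algebra.norm ℚ x| : ℚ) / Module.finrank ℚ K := by
  have hd : (Module.finrank ℚ K : ℝ) ≠ 0 := by exact_mod_cast Module.finrank_pos.ne'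
  rw [eq_div_iff hd, mul_comm, ← sum_Z, LinearEquiv.apply_symm_apply, ← InfinitePlace.prod_eq_abs_norm,
    Real.log_prod (fun _ _ ↦ pow_ne_zero _ ((map_ne_zero _).mpr hx))]
  refine Finset.sum_congr rfl fun v _ => ?_
  rw [Lam, Real.log_pow]
  ring

variable (K)
/-- the ideals in the class inverse to that of `J` -/
abbrev Idx (J : nonZeroDivisors (Ideal (𝓞 K))) :=
  {I : nonZeroDivisors (Ideal (𝓞 K)) // ClassGroup.mk0 I = (ClassGroup.mk0 J)⁻¹}

variable {K}
variable (J : nonZeroDivisors (Ideal (𝓞 K)))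

lemma exists_gamma (I : Idx K J) : ∃ γ : 𝓞 K, Ideal.span {γ} = (I.1 : Ideal (𝓞 K)) * J := by
  have h : ClassGroup.mk0 (I.1 * J) = 1 := by
    rw [map_mul, I.2, inv_mul_cancel]
  have h2 := (ClassGroup.mk0_eq_one_iff (I.1 * J).2).mp h
  obtain ⟨γ, hγ⟩ := h2
  exact ⟨γ, hγ.symm⟩

/-- chosen generator -/
noncomputable def gam (I : Idx K J) : 𝓞 K := (exists_gamma J I).choose

lemma gam_spec (I : Idx K J) : Ideal.span {gam J I} = (I.1 : Ideal (𝓞 K)) * J :=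
  (exists_gamma J I).choose_spec

lemma gam_ne (I : Idx K J) : gam J I ≠ 0 := by
  intro h
  have := gam_spec J I
  rw [h, Ideal.span_singleton_eq_bot.mpr rfl] at this
  exact nonZeroDivisors.coe_ne_zero (I.1 * J) this.symm

lemma gam_mem (I : Idx K J) : gam J I ∈ (J : Ideal (𝓞 K)) := by
  have : gam J I ∈ Ideal.span {gam J I} := Ideal.mem_span_singleton_self _
  rw [gam_spec] at this
  exact (Ideal.mul_le_right : (I.1 : Ideal (𝓞 K)) * (J : Ideal (𝓞 K)) ≤ J) this

/-- nonzero elements of `J` -/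
abbrev Xt := {x : 𝓞 K // x ∈ (J : Ideal (𝓞 K)) ∧ x ≠ 0}

/-- parametrisation of nonzero elements -/
noncomputable def par (p : Idx K J × torsion K × ({w : InfinitePlace K // w ≠ w₀} → ℤ)) : Xt J :=
  ⟨((p.2.1 : (𝓞 K)ˣ) * ∏ i, fundSystem K i ^ p.2.2 (equivFinRank i) : (𝓞 K)ˣ) * gam J p.1,
    Ideal.mul_mem_left _ _ (gam_mem J p.1), mul_ne_zero (Units.ne_zero _) (gam_ne J p.1)⟩

lemma par_bij : Function.Bijective (par J) := by
  constructor
  · rintro ⟨I, ζ, k⟩ ⟨I', ζ', k'⟩ h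
    have h1 : (((ζ : (𝓞 K)ˣ) * ∏ i, fundSystem K i ^ k (equivFinRank i) : (𝓞 K)ˣ) : 𝓞 K) * gam J I =
      (((ζ' : (𝓞 K)ˣ) * ∏ i, fundSystem K i ^ k' (equivFinRank i) : (𝓞 K)ˣ) : 𝓞 K) * gam J I' := congrArg Subtype.val h
    have h2 : (I.1 : Ideal (𝓞 K)) * J = I'.1 * J := by
      rw [← gam_spec, ← gam_spec, Ideal.span_singleton_eq_span_singleton]
      have a1 := associated_unit_mul_left (gam J I) _ (Units.isUnit ((ζ : (𝓞 K)ˣ) * ∏ i, fundSystem K i ^ k (equivFinRank i)))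
      have a2 := associated_unit_mul_left (gam J I') _ (Units.isUnit ((ζ' : (𝓞 K)ˣ) * ∏ i, fundSystem K i ^ k' (equivFinRank i)))
      rw [h1] at a1
      exact a1.symm.trans a2
    have h3 : I = I' := by
      apply Subtype.ext; apply Subtype.ext
      exact mul_right_cancel₀ (nonZeroDivisors.coe_ne_zero J) h2
    subst h3
    have h4 := Units.ext (mul_right_cancel₀ (gam_ne J I) h1)
    obtain ⟨y, hy, hu⟩ := exist_unique_eq_mul_prod K ((ζ : (𝓞 K)ˣ) * ∏ i, fundSystem K i ^ k (equivFinRank i))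
    have e1 := hu (ζ, fun i => k (equivFinRank i)) rfl
    have e2 := hu (ζ', fun i => k' (equivFinRank i)) h4
    have e3 := e1.trans e2.symm
    have e4 : ζ = ζ' := congrArg Prod.fst e3
    have e5 : k = k' := by
      funext w
      have := congrFun (congrArg Prod.snd e3) (equivFinRank.symm w)
      simpa using this
    rw [e4, e5]
  · rintro ⟨x, hx, hx0⟩
    obtain ⟨I, hI⟩ := Ideal.dvd_iff_le.mpr ((Ideal.span_singleton_le_iff_mem _).mpr hx)
    have hI0 : I ∈ nonZeroDivisors (Ideal (𝓞 K)) := by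
      rw [mem_nonZeroDivisors_iff_ne_zero]
      rintro rfl
      rw [mul_zero] at hI
      exact hx0 (Ideal.span_singleton_eq_bot.mp hI)
    have hp : Submodule.IsPrincipal ((J : Ideal (𝓞 K)) * I) := by
      rw [← hI]; exact ⟨x, rfl⟩
    have hcl : ClassGroup.mk0 ⟨I, hI0⟩ = (ClassGroup.mk0 J)⁻¹ := by
      rw [eq_inv_iff_mul_eq_one, mul_comm, ← map_mul]
      have h7 := (ClassGroup.mk0_eq_one_iff (mul_mem J.2 hI0)).mpr hp
      exact h7
    set i : Idx K J := ⟨⟨I, hI0⟩, hcl⟩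
    have h1 : Ideal.span {gam J i} = Ideal.span {x} := by
      rw [gam_spec, hI, mul_comm]
    obtain ⟨u, hu⟩ := Ideal.span_singleton_eq_span_singleton.mp h1
    obtain ⟨y, hy, -⟩ := exist_unique_eq_mul_prod K u
    refine ⟨(i, y.1, fun w => y.2 (equivFinRank.symm w)), Subtype.ext ?_⟩
    simp only [par, Equiv.symm_apply_apply]
    rw [← hy, mul_comm, hu]

/-- the parametrisation as an equivalence -/
noncomputable def parE : Xt J ≃ Idx K J × torsion K × ({w : InfinitePlace K // w ≠ w₀} → ℤ) :=
  (Equiv.ofBijective (par J) (par_bij J)).symm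

lemma Lam_parE (x : Xt J) : (Z K).symm (Lam (x.1 : K)) = (Z K).symm (Lam (gam J (parE J x).1 : K)) +
    (0, fun w => ((parE J x).2.2 w : ℝ)) := by
  obtain ⟨p, rfl⟩ := (parE J).symm.surjective x
  rw [Equiv.apply_symm_apply]
  have h : ((((parE J).symm p : Xt J) : 𝓞 K) : K) =
      ((((p.2.1 : (𝓞 K)ˣ) * ∏ i, fundSystem K i ^ p.2.2 (equivFinRank i) : (𝓞 K)ˣ) : 𝓞 K) : K) * (gam J p.1 : K) := by
    change ((par J p).1 : K) = _
    simp only [par, map_mul]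
  rw [h, Lam_mul (NumberField.Units.coe_ne_zero _) (by simpa using gam_ne J p.1), Lam_unit, map_add, LinearEquiv.symm_apply_apply, add_comm]

lemma fst_gam (I : Idx K J) : ((Z K).symm (Lam (gam J I : K))).1 =
    Real.log ((Ideal.absNorm (I.1 : Ideal (𝓞 K)) : ℝ) * Ideal.absNorm (J : Ideal (𝓞 K))) / Module.finrank ℚ K := by
  rw [fst_symm_Lam (by simpa using gam_ne J I)]
  congr 2
  rw [← Nat.cast_mul, ← map_mul, ← gam_spec, Ideal.absNorm_span_singleton]
  have : Algebra.norm ℚ (gam J I : K) = (Algebra.norm ℤ (gam J I) : ℤ) := by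
    rw [← Algebra.coe_norm_int]
  rw [this]
  push_cast
  rw [Nat.cast_natAbs]; push_cast; rfl

end NFU

end part6

section part7
open Real MeasureTheory Filter Topology Asymptotics ENNReal NumberField
open NumberField.Units NumberField.Units.dirichletUnitTheorem NumberField.mixedEmbedding
open NumberField.mixedEmbedding.fundamentalCone

set_option linter.unusedSectionVars false

namespace NFU
open scoped Classical
variable {K : Type*} [Field K] [NumberField K]
variable (J : nonZeroDivisors (Ideal (𝓞 K)))

lemma exists_beta : ∃ β : Fin (Module.finrank ℚ K) → 𝓞 K,
    (∀ x : 𝓞 K, x ∈ (J : Ideal (𝓞 K)) ↔ ∃ k : Fin (Module.finrank ℚ K) → ℤ, ∑ i, k i • β i = x) ∧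
    LinearIndependent ℝ fun i => mixedEmbedding K (β i : K) := by
  set I := FractionalIdeal.mk0 K J with hI
  have hcard : Fintype.card (Module.Free.ChooseBasisIndex ℤ ↥((I : FractionalIdeal (nonZeroDivisors (𝓞 K)) K) : Submodule (𝓞 K) K)) = Module.finrank ℚ K := by
    rw [← Module.finrank_eq_card_basis (basisOfFractionalIdeal K I)]
  set e := Fintype.equivFinOfCardEq hcard
  have hmem : ∀ x : K, x ∈ Submodule.span ℤ (Set.range (basisOfFractionalIdeal K I)) ↔
      ∃ y : 𝓞 K, y ∈ (J : Ideal (𝓞 K)) ∧ (y : K) = x := by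
    intro x
    rw [mem_span_basisOfFractionalIdeal, hI, FractionalIdeal.coe_mk0]
    change x ∈ ((J : Ideal (𝓞 K)) : FractionalIdeal (nonZeroDivisors (𝓞 K)) K) ↔ _
    rw [FractionalIdeal.mem_coeIdeal]
  have hb : ∀ i, ∃ y : 𝓞 K, y ∈ (J : Ideal (𝓞 K)) ∧ (y : K) = basisOfFractionalIdeal K I (e.symm i) := fun i =>
    (hmem _).mp (Submodule.subset_span ⟨_, rfl⟩)
  choose β hβ1 hβ2 using hb
  refine ⟨β, fun x => ⟨fun hx => ?_, ?_⟩, ?_⟩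
  · have h1 := (hmem (x : K)).mpr ⟨x, hx, rfl⟩
    rw [Submodule.mem_span_range_iff_exists_fun] at h1
    obtain ⟨c, hc⟩ := h1
    refine ⟨fun i => c (e.symm i), ?_⟩
    apply NumberField.RingOfIntegers.ext
    rw [← hc, ← e.symm.sum_comp]
    simp only [map_sum]
    refine Finset.sum_congr rfl fun i _ => ?_
    rw [map_zsmul]; exact congrArg _ (hβ2 i)
  · rintro ⟨k, rfl⟩
    exact sum_mem fun i _ => zsmul_mem (hβ1 i) _
  · have := (fractionalIdealLatticeBasis K I).linearIndependent.comp e.symm e.symm.injective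
    convert this using 1
    funext i
    rw [Function.comp_apply, fractionalIdealLatticeBasis_apply, hβ2]

/-- a lattice basis -/
noncomputable def beta : Fin (Module.finrank ℚ K) → 𝓞 K := (exists_beta J).choose

lemma beta_mem (x : 𝓞 K) : x ∈ (J : Ideal (𝓞 K)) ↔ ∃ k : Fin (Module.finrank ℚ K) → ℤ, ∑ i, k i • beta J i = x :=
  (exists_beta J).choose_spec.1 x

lemma beta_li : LinearIndependent ℝ fun i => mixedEmbedding K (beta J i : K) :=
  (exists_beta J).choose_spec.2

lemma beta_inj {k : Fin (Module.finrank ℚ K) → ℤ} (h : ∑ i, k i • beta J i = 0) : k = 0 := by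
  have h1 : ∑ i, (k i : ℝ) • mixedEmbedding K (beta J i : K) = 0 := by
    have h2 : mixedEmbedding K ((∑ i, k i • beta J i : 𝓞 K) : K) = 0 := by rw [h]; simp
    rw [← h2]
    simp only [map_sum]
    refine Finset.sum_congr rfl fun i _ => ?_
    rw [map_zsmul, map_zsmul, Int.cast_smul_eq_zsmul]
  have h3 := Fintype.linearIndependent_iff.mp (beta_li J) (fun i => (k i : ℝ)) h1
  funext i
  exact_mod_cast h3 i

/-- the elements of `J` in coordinates -/
noncomputable def kEquiv : {k : Fin (Module.finrank ℚ K) → ℤ // k ≠ 0} ≃ Xt J :=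
  Equiv.ofBijective (fun k => ⟨∑ i, k.1 i • beta J i, (beta_mem J _).mpr ⟨_, rfl⟩, fun h => k.2 (beta_inj J h)⟩) (by
    constructor
    · intro k l h
      have h1 : ∑ i, k.1 i • beta J i = ∑ i, l.1 i • beta J i := congrArg Subtype.val h
      apply Subtype.ext
      rw [← sub_eq_zero]
      apply beta_inj J
      simp only [Pi.sub_apply, sub_smul, Finset.sum_sub_distrib, h1, sub_self]
    · rintro ⟨x, hx, hx0⟩
      obtain ⟨k, hk⟩ := (beta_mem J x).mp hx
      refine ⟨⟨k, ?_⟩, Subtype.ext hk⟩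
      rintro rfl
      simp at hk
      exact hx0 hk.symm)

lemma kEquiv_apply (k) : (kEquiv J k : 𝓞 K) = ∑ i, k.1 i • beta J i := rfl

/-- scaled basis vectors -/
noncomputable def bb (s : InfinitePlace K → ℝ) (i : Fin (Module.finrank ℚ K)) :
    PiLp 2 (fun _ : InfinitePlace K => ℂ) :=
  WithLp.toLp 2 fun v => (s v : ℂ) * v.embedding (beta J i : K)

lemma bb_norm (s : InfinitePlace K → ℝ) (k : Fin (Module.finrank ℚ K) → ℤ) :
    ‖∑ i, (k i : ℝ) • bb J s i‖ ^ 2 = ∑ v : InfinitePlace K, s v ^ 2 * (v ((∑ i, k i • beta J i : 𝓞 K) : K)) ^ 2 := by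
  rw [PiLp.norm_sq_eq_of_L2]
  refine Finset.sum_congr rfl fun v _ => ?_
  have : (∑ i, (k i : ℝ) • bb J s i).ofLp v = s v * v.embedding ((∑ i, k i • beta J i : 𝓞 K) : K) := by
    simp only [bb, WithLp.ofLp_sum, WithLp.ofLp_smul, Finset.sum_apply, Pi.smul_apply, map_sum, Finset.mul_sum]
    refine Finset.sum_congr rfl fun i _ => ?_
    rw [map_zsmul, map_zsmul, Complex.real_smul, zsmul_eq_mul]
    push_cast; ring
  rw [this, norm_mul, InfinitePlace.norm_embedding_eq, mul_pow, Complex.norm_real, Real.norm_eq_abs, sq_abs]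

/-- the unscaling map -/
noncomputable def unscale (s : InfinitePlace K → ℝ) :
    PiLp 2 (fun _ : InfinitePlace K => ℂ) →ₗ[ℝ] mixedSpace K where
  toFun f := (fun w => ((((s w.1)⁻¹ : ℝ) : ℂ) * f w.1).re, fun w => (((s w.1)⁻¹ : ℝ) : ℂ) * f w.1)
  map_add' f g := by
    refine Prod.ext ?_ ?_ <;> funext w <;> simp [mul_add]
  map_smul' r f := by
    refine Prod.ext ?_ ?_ <;> funext w <;> simp <;> ring

lemma bb_li (s : InfinitePlace K → ℝ) (hs : ∀ v, s v ≠ 0) : LinearIndependent ℝ (bb J s) := by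
  refine LinearIndependent.of_comp (unscale s) ?_
  convert beta_li J using 1
  funext i
  have h : ∀ v, (((s v)⁻¹ : ℝ) : ℂ) * (bb J s i).ofLp v = v.embedding (beta J i : K) := by
    intro v
    simp only [bb]
    rw [← mul_assoc, ← Complex.ofReal_mul, inv_mul_cancel₀ (hs v)]
    simp
  refine Prod.ext ?_ ?_
  · funext w
    simp only [Function.comp_apply, unscale, LinearMap.coe_mk, AddHom.coe_mk, h]
    rw [mixedEmbedding_apply_isReal, ← InfinitePlace.embedding_of_isReal_apply w.2, Complex.ofReal_re]
  · funext w
    simp only [Function.comp_apply, unscale, LinearMap.coe_mk, AddHom.coe_mk, h]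
    rw [mixedEmbedding_apply_isComplex]

lemma exists_bound (K : Type*) [Field K] [NumberField K] : ∃ M : ℝ, ∀ c ∈ Unfold.cube {w : InfinitePlace K // w ≠ w₀}, ∀ v : InfinitePlace K, |Z K (0, c) v| ≤ M := by
  refine ⟨∑ v : InfinitePlace K, 2 / v.mult * ∑ w : {w : InfinitePlace K // w ≠ w₀}, |completeBasis K w v|, fun c hc v => ?_⟩
  refine le_trans ?_ (Finset.single_le_sum (f := fun v : InfinitePlace K => 2 / (v.mult : ℝ) * ∑ w : {w : InfinitePlace K // w ≠ w₀}, |completeBasis K w v|) (fun v _ => by positivity) (Finset.mem_univ v))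
  rw [Z_apply]
  simp only [mul_zero, zero_add]
  rw [abs_mul, abs_of_nonneg (by positivity : 0 ≤ 2 / (v.mult : ℝ))]
  gcongr
  refine (Finset.abs_sum_le_sum_abs _ _).trans (Finset.sum_le_sum fun w _ => ?_)
  rw [abs_mul]
  have h1 : |c w| ≤ 1 := abs_le.mpr ⟨by linarith [(hc w).1], (hc w).2.le⟩
  nlinarith [abs_nonneg (completeBasis K w v)]

/-- a chosen bound -/
noncomputable def bnd (K : Type*) [Field K] [NumberField K] : ℝ := (exists_bound K).choose

lemma bnd_spec : ∀ c ∈ Unfold.cube {w : InfinitePlace K // w ≠ w₀}, ∀ v : InfinitePlace K, |Z K (0, c) v| ≤ bnd K :=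
  (exists_bound K).choose_spec

/-- scaling factor -/
noncomputable def sc (c : {w : InfinitePlace K // w ≠ w₀} → ℝ) (v : InfinitePlace K) : ℝ := Real.exp (Z K (0, c) v / 2)

lemma sc_sq (c) (v : InfinitePlace K) : sc c v ^ 2 = Real.exp (Z K (0, c) v) := by
  rw [sc, ← Real.exp_nat_mul]; congr 1; push_cast; ring

lemma bb_norm_single (s : InfinitePlace K → ℝ) (i) : ‖bb J s i‖ ^ 2 = ∑ v : InfinitePlace K, s v ^ 2 * (v (beta J i : K)) ^ 2 := by
  rw [PiLp.norm_sq_eq_of_L2]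
  refine Finset.sum_congr rfl fun v _ => ?_
  simp only [bb]
  rw [norm_mul, InfinitePlace.norm_embedding_eq, mul_pow, Complex.norm_real, Real.norm_eq_abs, sq_abs]

lemma measurable_Z (v : InfinitePlace K) : Measurable fun p => Z K p v := by
  simp only [Z_apply]; fun_prop

/-- the theta data attached to `J` -/
noncomputable def nfTheta : ThetaData (Module.finrank ℚ K) ({w : InfinitePlace K // w ≠ w₀} → ℝ)
    (volume.restrict (Unfold.cube {w : InfinitePlace K // w ≠ w₀})) where
  E := PiLp 2 (fun _ : InfinitePlace K => ℂ)
  b := fun c => bb J (sc c)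
  b0 := bb J 1
  B := 1 + ∑ i, ∑ v : InfinitePlace K, Real.exp (bnd K) * (v (beta J i : K)) ^ 2
  δ := Real.exp (-bnd K)
  hB := by positivity
  hδ := Real.exp_pos _
  li := fun c => bb_li J _ fun v => (Real.exp_pos _).ne'
  li0 := bb_li J _ fun v => one_ne_zero
  bd := by
    refine (ae_restrict_iff' Unfold.measurableSet_cube).mpr (Eventually.of_forall fun c hc i => ?_)
    rw [bb_norm_single]
    have h1 : ∑ v : InfinitePlace K, sc c v ^ 2 * (v (beta J i : K)) ^ 2 ≤ ∑ v : InfinitePlace K, Real.exp (bnd K) * (v (beta J i : K)) ^ 2 := by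
      refine Finset.sum_le_sum fun v _ => ?_
      rw [sc_sq]
      gcongr
      exact (le_abs_self _).trans (bnd_spec c hc v)
    have h2 := Finset.single_le_sum (f := fun i => ∑ v : InfinitePlace K, Real.exp (bnd K) * (v (beta J i : K)) ^ 2) (fun i _ => by positivity) (Finset.mem_univ i)
    linarith
  lower := by
    refine (ae_restrict_iff' Unfold.measurableSet_cube).mpr (Eventually.of_forall fun c hc k => ?_)
    rw [bb_norm, bb_norm, Finset.mul_sum]
    refine Finset.sum_le_sum fun v _ => ?_
    rw [sc_sq, Pi.one_apply, one_pow, one_mul]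
    gcongr
    exact (abs_le.mp (bnd_spec c hc v)).1
  one_le := by
    intro k hk
    rw [bb_norm]
    set x := ∑ i, k i • beta J i
    have hx : x ≠ 0 := fun h => hk (beta_inj J h)
    simp only [Pi.one_apply, one_pow, one_mul]
    have : ∃ v : InfinitePlace K, 1 ≤ v (x : K) := by
      by_contra! h
      exact absurd (InfinitePlace.one_le_of_lt_one (w := w₀) hx (fun z _ => h z)) (not_le.mpr (h _))
    obtain ⟨v, hv⟩ := this
    calc (1 : ℝ) ≤ v (x : K) ^ 2 := one_le_pow₀ hv
      _ ≤ _ := Finset.single_le_sum (f := fun v : InfinitePlace K => v (x : K) ^ 2) (fun v _ => sq_nonneg _) (Finset.mem_univ v)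
  meas := by
    intro k
    simp only [bb_norm, sc_sq]
    refine Finset.measurable_sum _ fun v _ => ?_
    have := (measurable_Z v).comp (measurable_prodMk_left (x := (0 : ℝ)) (β := {w : InfinitePlace K // w ≠ w₀} → ℝ))
    exact (Real.measurable_exp.comp this).mul_const _

/-- the weight function -/
noncomputable def Psi (p : ℝ × ({w : InfinitePlace K // w ≠ w₀} → ℝ)) : ℝ≥0∞ :=
  ENNReal.ofReal (Real.exp (-∑ v, Real.exp (Z K p v)))

lemma measurable_Psi : Measurable (Psi (K := K)) := by
  unfold Psi
  have := fun v => measurable_Z (K := K) v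
  fun_prop

lemma Se_eq (t : ℝ) (c) : (nfTheta J).Se c (Real.exp t) = ∑' x : Xt J,
    Psi (t + ((Z K).symm (Lam (x.1 : K))).1, c + ((Z K).symm (Lam (x.1 : K))).2) := by
  rw [← (kEquiv J).tsum_eq, ThetaData.Se]
  refine tsum_congr fun k => ?_
  set x := kEquiv J k with hx
  have hx0 : (x.1 : K) ≠ 0 := by simpa using x.2.2
  rw [Psi]
  congr 2
  have h1 : (nfTheta J).q c k.1 = ∑ v : InfinitePlace K, sc c v ^ 2 * (v (x.1 : K)) ^ 2 := bb_norm J (sc c) k.1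
  have h2 : ∀ v, Z K (t + ((Z K).symm (Lam (x.1 : K))).1, c + ((Z K).symm (Lam (x.1 : K))).2) v =
      2 * t + Z K (0, c) v + Lam (x.1 : K) v := by
    intro v
    have : (t + ((Z K).symm (Lam (x.1 : K))).1, c + ((Z K).symm (Lam (x.1 : K))).2) =
      (t, c) + (Z K).symm (Lam (x.1 : K)) := rfl
    rw [this, map_add, LinearEquiv.apply_symm_apply, Pi.add_apply, Z_add_fst]
  rw [h1, neg_mul, Finset.mul_sum]
  congr 1
  refine Finset.sum_congr rfl fun v _ => ?_
  have hv : 0 < v (x.1 : K) := InfinitePlace.pos_iff.mpr hx0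
  have h3 : Real.exp (2 * Real.log (v (x.1 : K))) = v (x.1 : K) ^ 2 := by
    rw [mul_comm, Real.exp_mul, Real.exp_log hv]; norm_num
  rw [h2, sc_sq, Real.exp_add, Real.exp_add, Lam, h3, ← Real.exp_nat_mul]
  push_cast; ring

end NFU

end part7

section part8
open Real MeasureTheory Filter Topology Asymptotics ENNReal NumberField
open NumberField.Units NumberField.Units.dirichletUnitTheorem NumberField.mixedEmbedding
open NumberField.mixedEmbedding.fundamentalCone

set_option linter.unusedSectionVars false

namespace NFU
open scoped Classical
variable {K : Type*} [Field K] [NumberField K]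

lemma lintegral_Psi (K : Type*) [Field K] [NumberField K] : ∃ C : ℝ, 0 < C ∧ ∀ s : ℝ, 0 < s →
    ∫⁻ t : ℝ, ENNReal.ofReal (Real.exp (Module.finrank ℚ K * s * t)) * ∫⁻ c, Psi (K := K) (t, c) =
      ENNReal.ofReal (C * ∏ v : InfinitePlace K, Real.Gamma (v.mult * s / 2)) := by
  obtain ⟨C, hC, H⟩ := Unfold.linear_cov ((volume : Measure ℝ).prod (volume : Measure ({w : InfinitePlace K // w ≠ w₀} → ℝ)))
    (volume : Measure (InfinitePlace K → ℝ)) (Z K).toContinuousLinearEquiv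
  refine ⟨C, hC, fun s hs => ?_⟩
  have hpos : ∀ v : InfinitePlace K, 0 < (v.mult : ℝ) * s / 2 := fun v => by
    have : (0 : ℝ) < v.mult := by exact_mod_cast v.mult_pos
    positivity
  rw [ENNReal.ofReal_mul hC.le, ← Unfold.lintegral_gamma_pi _ hpos, ← H]
  rw [lintegral_prod]
  · refine lintegral_congr fun t => ?_
    have hm : Measurable fun c => Psi (K := K) (t, c) := measurable_Psi.comp measurable_prodMk_left
    rw [← lintegral_const_mul _ hm]
    refine lintegral_congr fun c => ?_
    rw [Psi]
    congr 3
    have := sum_Z K (t, c)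
    simp only at this
    rw [mul_right_comm, ← this, Finset.sum_mul]
    refine Finset.sum_congr rfl fun v _ => ?_
    simp only [LinearEquiv.coe_toContinuousLinearEquiv']
    ring
  · apply Measurable.aemeasurable
    have hc : Continuous (Z K).toContinuousLinearEquiv := ContinuousLinearEquiv.continuous _
    have := hc.measurable
    fun_prop

instance : Finite (torsion K) := inferInstance

/-- Dedekind zeta function identity over a class, for real `s`. -/
theorem real_identity (J : nonZeroDivisors (Ideal (𝓞 K))) :
    ∃ (G : ℂ → ℂ) (A B C : ℝ), 0 < C ∧ Differentiable ℂ G ∧ ∀ s : ℝ, 1 < s →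
      ∃ m : ℝ, 0 ≤ m ∧ (m : ℂ) = G s + A / ((s : ℂ) - 1) - B / s ∧
      ENNReal.ofReal m = (∑' I : Idx K J, ENNReal.ofReal ((Ideal.absNorm (I.1 : Ideal (𝓞 K)) : ℝ) ^ (-s))) *
        ENNReal.ofReal (C * (Ideal.absNorm (J : Ideal (𝓞 K)) : ℝ) ^ (-s) *
          ∏ v : InfinitePlace K, Real.Gamma (v.mult * s / 2)) := by
  have : Fintype (torsion K) := Fintype.ofFinite _
  set d := Module.finrank ℚ K with hd
  have hd0 : (0 : ℝ) < d := by exact_mod_cast Module.finrank_pos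
  have hfin : IsFiniteMeasure (volume.restrict (Unfold.cube {w : InfinitePlace K // w ≠ w₀})) := by
    refine ⟨?_⟩
    rw [Measure.restrict_apply_univ, Unfold.volume_cube]
    exact ENNReal.one_lt_top
  obtain ⟨G, A, B, hG, H⟩ := (nfTheta J).mellin_cont
  obtain ⟨C, hC, HC⟩ := lintegral_Psi K
  refine ⟨fun s => G (d * s), A / d, B / d, Fintype.card (torsion K) * C, ?_, ?_, fun s hs => ?_⟩
  · have : 0 < Fintype.card (torsion K) := Fintype.card_pos
    positivity
  · exact hG.comp (by fun_prop)
  · have hds : (d : ℝ) < d * s := by nlinarith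
    obtain ⟨m, hm0, hm1, hm2⟩ := H (d * s) hds
    refine ⟨m, hm0, ?_, ?_⟩
    · rw [hm2]
      have h1 : (d : ℂ) ≠ 0 := by exact_mod_cast hd0.ne'
      have h2 : (s : ℂ) ≠ 0 := by
        norm_cast; linarith
      have h3 : (s : ℂ) - 1 ≠ 0 := by
        rw [sub_ne_zero]; norm_cast; linarith
      have h4 : (d : ℂ) * s - d ≠ 0 := by
        have : (d : ℂ) * s - d = d * (s - 1) := by ring
        rw [this]; exact mul_ne_zero h1 h3
      push_cast
      rw [← hd]
      have e1 : (A : ℂ) / (d * s - d) = A / d / (s - 1) := by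
        have : (d : ℂ) * s - d = d * (s - 1) := by ring
        rw [this, div_div]
      have e2 : (B : ℂ) / (d * s) = B / d / s := by rw [div_div]
      rw [e1, e2]
    · rw [← hm1, Unfold.lintegral_exp_sub]
      simp only [Se_eq]
      have hcX : Countable (Xt J) := (kEquiv J).symm.countable_iff.mpr inferInstance
      rw [Unfold.unfold_sum (parE J) (fun x : Xt J => ((Z K).symm (Lam (x.1 : K))).1) (fun x : Xt J => ((Z K).symm (Lam (x.1 : K))).2)
        (fun I => ((Z K).symm (Lam (gam J I : K))).1) (fun I => ((Z K).symm (Lam (gam J I : K))).2)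
        (fun x => by rw [Lam_parE]; simp) (fun x => by rw [Lam_parE]; rfl) Psi measurable_Psi, HC s (by linarith)]
      have hJ : (0 : ℝ) < Ideal.absNorm (J : Ideal (𝓞 K)) := by
        exact_mod_cast Nat.pos_of_ne_zero (Ideal.absNorm_ne_zero_of_nonZeroDivisors J)
      have hI : ∀ I : Idx K J, ENNReal.ofReal (Real.exp (-(d * s) * ((Z K).symm (Lam (gam J I : K))).1)) =
          ENNReal.ofReal ((Ideal.absNorm (I.1 : Ideal (𝓞 K)) : ℝ) ^ (-s)) * ENNReal.ofReal ((Ideal.absNorm (J : Ideal (𝓞 K)) : ℝ) ^ (-s)) := by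
        intro I
        have hI : (0 : ℝ) < Ideal.absNorm (I.1 : Ideal (𝓞 K)) := by
          exact_mod_cast Nat.pos_of_ne_zero (Ideal.absNorm_ne_zero_of_nonZeroDivisors I.1)
        rw [← ENNReal.ofReal_mul (by positivity), fst_gam, ← Real.mul_rpow hI.le hJ.le, Real.rpow_def_of_pos (by positivity)]
        congr 2
        rw [← hd]
        field_simp
      simp only [hI]
      have hΓ : 0 ≤ ∏ v : InfinitePlace K, Real.Gamma (v.mult * s / 2) :=
        Finset.prod_nonneg fun v _ => Real.Gamma_nonneg_of_nonneg (by positivity)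
      rw [ENNReal.tsum_mul_right, ENNReal.ofReal_mul (by positivity), ENNReal.ofReal_mul (by positivity),
        ENNReal.ofReal_mul (by positivity), ENNReal.ofReal_mul (by positivity), ENNReal.ofReal_natCast]
      ring

end NFU

end part8

section part9
open Real MeasureTheory Filter Topology Asymptotics ENNReal NumberField
open NumberField.InfinitePlace

set_option linter.unusedSectionVars false

namespace NFU
open scoped Classical

/-- pushforward of a function along a norm map -/
noncomputable def push {X : Type*} (N : X → ℕ) (f : X → ℂ) : ℕ → ℂ :=
  fun n => ∑' x, if N x = n then f x else 0

lemma push_eq {X : Type*} {N : X → ℕ} (f : X → ℂ) {n : ℕ} (S : Finset X) (hS : ∀ x, x ∈ S ↔ N x = n) :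
    push N f n = ∑ x ∈ S, f x := by
  rw [push, tsum_eq_sum (s := S)]
  · exact Finset.sum_congr rfl fun x hx => if_pos ((hS x).1 hx)
  · intro x hx
    exact if_neg fun h => hx ((hS x).2 h)

lemma push_hasSum {X : Type*} {N : X → ℕ} (hN : ∀ x, N x ≠ 0) (hfin : ∀ n, {x | N x = n}.Finite)
    (f : X → ℂ) (s a : ℂ) (h : HasSum (fun x => f x * (N x : ℂ) ^ (-s)) a) :
    LSeriesHasSum (push N f) s a := by
  have h1 := (Equiv.sigmaFiberEquiv N).hasSum_iff.mpr h
  refine h1.sigma fun n => ?_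
  have hf : Finite {x // N x = n} := (hfin n).to_subtype
  have : Fintype {x // N x = n} := Fintype.ofFinite _
  have h2 := hasSum_fintype (fun c : {x // N x = n} => f c * (N c : ℂ) ^ (-s))
  change HasSum (fun c : {x // N x = n} => f c * (N c : ℂ) ^ (-s)) _
  convert h2 using 1
  rcases eq_or_ne n 0 with rfl | hn
  · have : IsEmpty {x // N x = 0} := ⟨fun x => hN x.1 x.2⟩
    simp
  · rw [LSeries.term_of_ne_zero hn, push_eq f (hfin n).toFinset (by simp), div_eq_mul_inv, ← Complex.cpow_neg,
      Finset.sum_mul]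
    rw [← Finset.sum_subtype (p := fun x => N x = n) (hfin n).toFinset (by simp) (fun x => f x * (N x : ℂ) ^ (-s))]
    refine Finset.sum_congr rfl fun x hx => ?_
    simp only [Set.Finite.mem_toFinset, Set.mem_ofPred_eq] at hx
    rw [hx]

variable (K : Type*) [Field K] [NumberField K]

/-- nonzero ideals -/
abbrev Id := nonZeroDivisors (Ideal (𝓞 K))

variable {K}
/-- absolute norm -/
noncomputable def nm (I : Id K) : ℕ := Ideal.absNorm (I : Ideal (𝓞 K))

lemma nm_ne (I : Id K) : nm I ≠ 0 := Ideal.absNorm_ne_zero_of_nonZeroDivisors I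

lemma nm_fin (n : ℕ) : {I : Id K | nm I = n}.Finite := by
  refine Set.Finite.of_finite_image (f := Subtype.val) ?_ Subtype.val_injective.injOn
  refine (Ideal.finite_setOfPred_absNorm_eq (S := 𝓞 K) n).subset ?_
  rintro _ ⟨I, hI, rfl⟩
  exact hI

lemma nm_mul (I J : Id K) : nm (I * J) = nm I * nm J := by simp [nm]

/-- indicator of a class -/
noncomputable def ind (C : ClassGroup (𝓞 K)) (I : Id K) : ℂ := if ClassGroup.mk0 I = C then 1 else 0

lemma classZeta_real (C : ClassGroup (𝓞 K)) :
    ∃ (G : ℂ → ℂ) (A B c : ℝ) (M : ℕ), 0 < c ∧ M ≠ 0 ∧ Differentiable ℂ G ∧ ∀ s : ℝ, 1 < s →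
      Summable (fun I => ind C I * (nm I : ℂ) ^ (-(s : ℂ))) ∧ LSeriesSummable (push nm (ind C)) s ∧
      LSeries (push nm (ind C)) s * (c * (M : ℂ) ^ (-(s : ℂ)) * ∏ v : InfinitePlace K, Complex.Gamma (v.mult * s / 2))
        = G s + A / ((s : ℂ) - 1) - B / s := by
  obtain ⟨J, hJ⟩ := ClassGroup.mk0_surjective C⁻¹
  obtain ⟨G, A, B, c, hc, hG, H⟩ := real_identity J
  refine ⟨G, A, B, c, nm J, hc, nm_ne J, hG, fun s hs => ?_⟩
  obtain ⟨m, hm0, hm1, hm2⟩ := H s hs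
  have hΓ : 0 < ∏ v : InfinitePlace K, Real.Gamma (v.mult * s / 2) := by
    refine Finset.prod_pos fun v _ => Real.Gamma_pos_of_pos ?_
    have : (0 : ℝ) < v.mult := by exact_mod_cast v.mult_pos
    positivity
  have hJ0 : (0 : ℝ) < nm J := by exact_mod_cast Nat.pos_of_ne_zero (nm_ne J)
  have hD : 0 < c * (nm J : ℝ) ^ (-s) * ∏ v : InfinitePlace K, Real.Gamma (v.mult * s / 2) := by positivity
  set D := c * (nm J : ℝ) ^ (-s) * ∏ v : InfinitePlace K, Real.Gamma (v.mult * s / 2) with hDdef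
  change ENNReal.ofReal m = (∑' I : Idx K J, ENNReal.ofReal ((nm I.1 : ℝ) ^ (-s))) * ENNReal.ofReal D at hm2
  have hne : (∑' I : Idx K J, ENNReal.ofReal ((nm I.1 : ℝ) ^ (-s))) ≠ ⊤ := by
    intro h
    rw [h, ENNReal.top_mul (by simpa using hD)] at hm2
    exact ENNReal.ofReal_ne_top hm2
  have hsum : Summable fun I : Idx K J => (nm I.1 : ℝ) ^ (-s) := by
    have := ENNReal.summable_toReal hne
    simpa [ENNReal.toReal_ofReal, Real.rpow_nonneg] using this
  have hval : (∑' I : Idx K J, (nm I.1 : ℝ) ^ (-s)) * D = m := by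
    have h1 := ENNReal.ofReal_tsum_of_nonneg (f := fun I : Idx K J => (nm I.1 : ℝ) ^ (-s)) (fun _ => by positivity) hsum
    rw [← h1, ← ENNReal.ofReal_mul (tsum_nonneg fun _ => by positivity)] at hm2
    have h2 := congrArg ENNReal.toReal hm2
    rw [ENNReal.toReal_ofReal hm0, ENNReal.toReal_ofReal (mul_nonneg (tsum_nonneg fun _ => by positivity) hD.le)] at h2
    exact h2.symm
  set T := (∑' I : Idx K J, (nm I.1 : ℝ) ^ (-s)) with hT
  have hs1 : HasSum (fun I : Idx K J => (((nm I.1 : ℝ) ^ (-s) : ℝ) : ℂ)) (T : ℂ) := by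
    exact_mod_cast hsum.hasSum
  have hs2 : HasSum (fun I => ind C I * (nm I : ℂ) ^ (-(s : ℂ))) (T : ℂ) := by
    have e : (fun I : Id K => ind C I * (nm I : ℂ) ^ (-(s : ℂ))) =
        Set.indicator {I | ClassGroup.mk0 I = (ClassGroup.mk0 J)⁻¹} (fun I => (((nm I : ℝ) ^ (-s) : ℝ) : ℂ)) := by
      ext I
      rw [Set.indicator_apply, hJ, inv_inv, ind]
      simp only [Set.mem_ofPred_eq]
      split_ifs
      · rw [one_mul, Complex.ofReal_cpow (by positivity)]; simp
      · simp
    rw [e]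
    exact (hasSum_subtype_iff_indicator (s := {I : Id K | ClassGroup.mk0 I = (ClassGroup.mk0 J)⁻¹})).1 hs1
  have hL := push_hasSum nm_ne nm_fin _ _ _ hs2
  refine ⟨hs2.summable, hL.LSeriesSummable, ?_⟩
  rw [hL.LSeries_eq, ← hm1, ← hval, hDdef]
  push_cast
  rw [Complex.ofReal_cpow hJ0.le]
  simp only [← Complex.Gamma_ofReal]
  push_cast
  rfl

end NFU

end part9

section part10
open Real MeasureTheory Filter Topology Asymptotics ENNReal NumberField
open NumberField.InfinitePlace

set_option linter.unusedSectionVars false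

namespace NFU
open scoped Classical

variable (K : Type*) [Field K] [NumberField K]

/-- The residue of a partial zeta function. -/
noncomputable def kap : ℝ := (2 ^ nrRealPlaces K * (2 * π) ^ nrComplexPlaces K * Units.regulator K) /
    (Units.torsionOrder K * Real.sqrt |discr K|)

lemma kap_pos : 0 < kap K := by
  refine div_pos ?_ ?_
  · exact mul_pos (by positivity) (Units.regulator_pos K)
  · exact mul_pos (Nat.cast_pos.mpr (Units.torsionOrder_pos K)) <|
      Real.sqrt_pos_of_pos <| abs_pos.mpr (Int.cast_ne_zero.mpr (discr_ne_zero K))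

variable {K}

lemma card_sub {X : Type*} (p : X → Prop) (hf : {x | p x}.Finite) : Nat.card {x // p x} = hf.toFinset.card := by
  rw [← Set.ncard_eq_toFinset_card _ hf, ← Nat.card_coe_set_eq]
  rfl

lemma push_ind (C : ClassGroup (𝓞 K)) (n : ℕ) :
    push nm (ind C) n = ((Nat.card {I : Id K // nm I = n ∧ ClassGroup.mk0 I = C} : ℝ) : ℂ) := by
  rw [push_eq (ind C) (nm_fin n).toFinset (by simp)]
  simp only [ind, Finset.sum_boole, Complex.ofReal_natCast]
  congr 1
  have hf : {I : Id K | nm I = n ∧ ClassGroup.mk0 I = C}.Finite := (nm_fin n).subset fun I h => h.1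
  rw [card_sub _ hf]
  congr 1
  ext I
  simp

lemma tendsto_classZeta (C : ClassGroup (𝓞 K)) :
    Tendsto (fun s : ℝ => ((s : ℂ) - 1) * LSeries (push nm (ind C)) s) (𝓝[>] 1) (𝓝 (kap K : ℂ)) := by
  have e : push nm (ind C) = fun n => ((Nat.card {I : Id K // nm I = n ∧ ClassGroup.mk0 I = C} : ℝ) : ℂ) :=
    funext (push_ind C)
  rw [e]
  refine LSeries_tendsto_sub_mul_nhds_one_of_tendsto_sum_div_and_nonneg _ ?_
    (fun _ ↦ Nat.cast_nonneg _)
  refine ((NumberField.Ideal.tendsto_norm_le_and_mk_eq_div_atTop (K := K) (C := C)).comp tendsto_natCast_atTop_atTop).congr fun n ↦ ?_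
  simp only [Function.comp_apply, Nat.cast_le, ← Nat.cast_sum]
  congr 2
  have hf : {I : Id K | nm I ≤ n ∧ ClassGroup.mk0 I = C}.Finite := by
    refine ((Finset.range (n+1)).finite_toSet.biUnion (fun k _ => nm_fin (K := K) k)).subset ?_
    intro I hI
    simp only [Finset.coe_range, Set.mem_iUnion]
    exact ⟨nm I, Set.mem_Iio.2 (Nat.lt_succ_of_le hI.1), rfl⟩
  have h1 : ∀ k ≤ n, Nat.card {I : Id K // nm I = k ∧ ClassGroup.mk0 I = C} =
      ((hf.toFinset).filter (fun I => nm I = k)).card := by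
    intro k h
    have hf : {I : Id K | nm I = k ∧ ClassGroup.mk0 I = C}.Finite := (nm_fin k).subset fun I h => h.1
    rw [card_sub _ hf]
    congr 1
    ext I
    simp
    constructor
    · rintro ⟨h1, h2⟩; exact ⟨⟨h1.trans_le h, h2⟩, h1⟩
    · rintro ⟨⟨h1, h2⟩, h3⟩; exact ⟨h3, h2⟩
  have h2 : Nat.card {I : Id K // Ideal.absNorm (I : Ideal (𝓞 K)) ≤ n ∧ ClassGroup.mk0 I = C} = hf.toFinset.card := by
    rw [← Set.ncard_eq_toFinset_card _ hf, ← Nat.card_coe_set_eq]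
    rfl
  rw [h2, Finset.card_eq_sum_card_fiberwise (f := nm) (t := Finset.Icc 1 n)]
  · refine Finset.sum_congr rfl fun k hk => ?_
    rw [h1 k (Finset.mem_Icc.1 hk).2]
  · intro I hI
    simp only [Set.Finite.coe_toFinset] at hI
    exact Finset.mem_coe.2 (Finset.mem_Icc.2 ⟨Nat.one_le_iff_ne_zero.2 (nm_ne I), hI.1⟩)

lemma abscissa_le_one {a : ℕ → ℂ} (h : ∀ s : ℝ, 1 < s → LSeriesSummable a s) :
    LSeries.abscissaOfAbsConv a ≤ 1 :=
  LSeries.abscissaOfAbsConv_le_of_forall_lt_LSeriesSummable (x := 1) h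

lemma lt_re {a : ℕ → ℂ} (h : LSeries.abscissaOfAbsConv a ≤ 1) {s : ℂ} (hs : 1 < s.re) :
    LSeries.abscissaOfAbsConv a < s.re := h.trans_lt (by exact_mod_cast hs)

/-- identity theorem on the half plane -/
lemma eq_of_real {f g : ℂ → ℂ} (hf : DifferentiableOn ℂ f {s | 1 < s.re}) (hg : DifferentiableOn ℂ g {s | 1 < s.re})
    (h : ∀ s : ℝ, 1 < s → f s = g s) : ∀ s : ℂ, 1 < s.re → f s = g s := by
  have ho : IsOpen {s : ℂ | 1 < s.re} := isOpen_lt continuous_const Complex.continuous_re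
  have hc : IsPreconnected {s : ℂ | 1 < s.re} := (convex_halfSpace_re_gt 1).isPreconnected
  have h2 : (2 : ℂ) ∈ {s : ℂ | 1 < s.re} := by simp
  have := (hf.analyticOnNhd ho).eqOn_of_preconnected_of_frequently_eq (hg.analyticOnNhd ho) hc h2 ?_
  · exact fun s hs => this hs
  have ht : Tendsto (fun x : ℝ => (x : ℂ)) (𝓝[>] 2) (𝓝[≠] 2) := by
    refine tendsto_nhdsWithin_iff.2 ⟨?_, ?_⟩
    · exact (Complex.continuous_ofReal.tendsto' 2 2 (by simp)).mono_left nhdsWithin_le_nhds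
    · filter_upwards [self_mem_nhdsWithin] with x hx
      simp only [Set.mem_Ioi] at hx
      simp only [Set.mem_compl_iff, Set.mem_singleton_iff]
      norm_cast
      exact hx.ne'
  refine ht.frequently (Eventually.frequently ?_)
  filter_upwards [self_mem_nhdsWithin] with x hx
  simp only [Set.mem_Ioi] at hx
  exact h x (by linarith)

theorem classZeta_entire (C : ClassGroup (𝓞 K)) : LSeries.abscissaOfAbsConv (push nm (ind C)) ≤ 1 ∧
    ∃ H : ℂ → ℂ, Differentiable ℂ H ∧ H (-2) = 0 ∧ H 1 = kap K ∧
      ∀ s : ℂ, 1 < s.re → (s - 1) * LSeries (push nm (ind C)) s = H s := by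
  obtain ⟨G, A, B, c, M, hc, hM, hG, hs⟩ := classZeta_real C
  have habs := abscissa_le_one fun s h => (hs s h).2.1
  refine ⟨habs, ?_⟩
  obtain ⟨v₀⟩ : Nonempty (InfinitePlace K) := inferInstance
  have hM' : (M : ℂ) ≠ 0 := by exact_mod_cast hM
  let H : ℂ → ℂ := fun s => (s * (s - 1) * G s + A * s - B * (s - 1)) * (c : ℂ)⁻¹ * (M : ℂ) ^ s *
    ((v₀.mult : ℂ) / 2 * (Complex.Gamma (v₀.mult * s / 2 + 1))⁻¹) *
    ∏ v ∈ Finset.univ.erase v₀, (Complex.Gamma (v.mult * s / 2))⁻¹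
  have hH : Differentiable ℂ H := by
    have h1 : Differentiable ℂ fun s => (Complex.Gamma (v₀.mult * s / 2 + 1))⁻¹ :=
      Complex.differentiable_one_div_Gamma.comp (f := fun s : ℂ => (v₀.mult * s / 2 + 1 : ℂ)) (by fun_prop)
    have h2 : ∀ v : InfinitePlace K, Differentiable ℂ fun s => (Complex.Gamma (v.mult * s / 2))⁻¹ := fun v =>
      Complex.differentiable_one_div_Gamma.comp (f := fun s : ℂ => (v.mult * s / 2 : ℂ)) (by fun_prop)
    have h3 : Differentiable ℂ fun s => ∏ v ∈ Finset.univ.erase v₀, (Complex.Gamma (v.mult * s / 2))⁻¹ :=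
      Differentiable.fun_finsetProd fun v _ => h2 v
    have h4 : Differentiable ℂ fun s : ℂ => (M : ℂ) ^ s := fun s =>
      (DifferentiableAt.const_cpow (differentiableAt_id) (Or.inl hM'))
    have h5 : Differentiable ℂ fun s : ℂ => (s * (s - 1) * G s + A * s - B * (s - 1)) := by fun_prop
    exact (((h5.mul_const _).mul h4).mul (h1.const_mul _)).mul h3
  have hreal : ∀ s : ℝ, 1 < s → ((s : ℂ) - 1) * LSeries (push nm (ind C)) s = H s := by
    intro s h1
    have key := (hs s h1).2.2
    have hs0 : (s : ℂ) ≠ 0 := by norm_cast; linarith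
    have hs1 : (s : ℂ) - 1 ≠ 0 := by rw [sub_ne_zero]; norm_cast; linarith
    have hm : ∀ v : InfinitePlace K, (0 : ℝ) < v.mult * s / 2 := fun v => by
      have : (0 : ℝ) < v.mult := by exact_mod_cast v.mult_pos
      positivity
    have hΓ : ∀ v : InfinitePlace K, Complex.Gamma (v.mult * s / 2) ≠ 0 := fun v => by
      have := Real.Gamma_pos_of_pos (hm v)
      have h : ((Real.Gamma (v.mult * s / 2) : ℝ) : ℂ) ≠ 0 := by exact_mod_cast this.ne'
      rw [← Complex.Gamma_ofReal] at h
      push_cast at h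
      exact h
    have hv0 : (v₀.mult : ℂ) ≠ 0 := by exact_mod_cast v₀.mult_pos.ne'
    have hz : (v₀.mult * s / 2 : ℂ) ≠ 0 := div_ne_zero (mul_ne_zero hv0 hs0) two_ne_zero
    have hc' : (c : ℂ) ≠ 0 := by exact_mod_cast hc.ne'
    have hMs : (M : ℂ) ^ (s : ℂ) ≠ 0 := by simp [Complex.cpow_eq_zero_iff, hM']
    rw [← Finset.mul_prod_erase Finset.univ (fun v : InfinitePlace K => Complex.Gamma (v.mult * s / 2)) (Finset.mem_univ v₀)] at key
    have hP : ∏ v ∈ Finset.univ.erase v₀, Complex.Gamma (v.mult * s / 2) ≠ 0 :=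
      Finset.prod_ne_zero_iff.2 fun v _ => hΓ v
    simp only [H, Finset.prod_inv_distrib, Complex.Gamma_add_one _ hz]
    rw [Complex.cpow_neg] at key
    have hΓ0 := hΓ v₀
    generalize (∏ v ∈ Finset.univ.erase v₀, Complex.Gamma (v.mult * s / 2)) = P at *
    generalize Complex.Gamma (v₀.mult * s / 2) = Q at *
    generalize (M : ℂ) ^ (s : ℂ) = R at *
    generalize LSeries (push nm (ind C)) s = L at *
    have e : s * (s - 1) * G s + A * s - B * (s - 1) = s * (s - 1) * (L * (c * R⁻¹ * (Q * P))) := by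
      rw [key]; field_simp
    rw [e]
    field_simp
  refine ⟨H, hH, ?_, ?_, ?_⟩
  · have : Complex.Gamma (v₀.mult * (-2) / 2 + 1) = 0 := by
      rcases v₀.isReal_or_isComplex with h | h
      · rw [InfinitePlace.mult, if_pos h]; norm_num
      · rw [InfinitePlace.mult, if_neg (not_isReal_iff_isComplex.2 h)]
        have := Complex.Gamma_neg_nat_eq_zero 1
        norm_num at this ⊢
        exact this
    simp only [H, this, _root_.inv_zero, mul_zero, zero_mul]
  · have h1 := tendsto_classZeta C
    have h2 : Tendsto (fun s : ℝ => H s) (𝓝[>] 1) (𝓝 (H 1)) := by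
      refine (hH.continuous.comp Complex.continuous_ofReal).tendsto' 1 _ (by simp) |>.mono_left nhdsWithin_le_nhds
    refine tendsto_nhds_unique h2 (h1.congr' ?_)
    filter_upwards [self_mem_nhdsWithin] with s h
    exact hreal s h
  · refine eq_of_real ?_ hH.differentiableOn hreal
    refine DifferentiableOn.mul (by fun_prop) ?_
    refine (LSeries_differentiableOn _).mono fun s h => ?_
    exact lt_re habs h

end NFU

end part10

section part11
open Real Filter Topology NumberField

set_option linter.unusedSectionVars false

namespace NFU
open scoped Classical

variable (K : Type*) [Field K] [NumberField K]

/-- nonzero primes -/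
abbrev Pr := {P : Ideal (𝓞 K) // Prime P}

variable {K}

/-- a prime as a nonzero ideal -/
def pid (P : Pr K) : Id K := ⟨P.1, mem_nonZeroDivisors_of_ne_zero P.2.ne_zero⟩

/-- prime powers -/
def toId (x : Pr K × ℕ) : Id K := pid x.1 ^ (x.2 + 1)

lemma coe_toId (x : Pr K × ℕ) : (toId x : Ideal (𝓞 K)) = x.1.1 ^ (x.2 + 1) := rfl

lemma two_le_nm (P : Pr K) : 2 ≤ nm (pid P) := by
  have h0 := nm_ne (pid P)
  have h1 : nm (pid P) ≠ 1 := by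
    intro h
    have : (pid P : Ideal (𝓞 K)) = ⊤ := Ideal.absNorm_eq_one_iff.1 h
    exact P.2.not_isUnit (Ideal.isUnit_iff.2 this)
  omega

lemma nm_pow (I : Id K) (k : ℕ) : nm (I ^ k) = nm I ^ k := by
  induction k with
  | zero => simp [nm]
  | succ k ih => rw [pow_succ, nm_mul, ih, pow_succ]

/-- norm of prime powers -/
noncomputable def nmX (x : Pr K × ℕ) : ℕ := nm (toId x)

lemma nmX_eq (x : Pr K × ℕ) : nmX x = nm (pid x.1) ^ (x.2 + 1) := nm_pow _ _

lemma nmX_ne (x : Pr K × ℕ) : nmX x ≠ 0 := nm_ne _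

lemma nm_le_fin (n : ℕ) : {I : Id K | nm I ≤ n}.Finite := by
  refine ((Finset.range (n+1)).finite_toSet.biUnion (fun k _ => nm_fin (K := K) k)).subset ?_
  intro I hI
  simp only [Finset.coe_range, Set.mem_iUnion]
  exact ⟨nm I, Set.mem_Iio.2 (Nat.lt_succ_of_le hI), rfl⟩

lemma pid_inj : Function.Injective (pid (K := K)) := by
  intro P Q h
  have := congrArg Subtype.val h
  exact Subtype.ext this

lemma nmX_fin (n : ℕ) : {x : Pr K × ℕ | nmX x = n}.Finite := by
  have h1 : {P : Pr K | nm (pid P) ≤ n}.Finite := (nm_le_fin n).preimage pid_inj.injOn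
  refine (h1.prod (Set.finite_Iio n)).subset ?_
  rintro ⟨P, k⟩ h
  simp only [Set.mem_ofPred_eq, nmX_eq] at h
  have h2 := two_le_nm P
  refine Set.mem_prod.2 ⟨?_, ?_⟩
  · change nm (pid P) ≤ n
    rw [← h]
    exact Nat.le_self_pow (by omega) _
  · change k < n
    rw [← h]
    calc k < k + 1 := by omega
      _ < 2 ^ (k+1) := Nat.lt_two_pow_self
      _ ≤ _ := Nat.pow_le_pow_left h2 _

lemma log_sum_aux (I : Ideal (𝓞 K)) : I ≠ 0 → ∃ S : Finset (Pr K × ℕ), (∀ x, x ∈ S ↔ x.1.1 ^ (x.2 + 1) ∣ I) ∧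
    ∑ x ∈ S, Real.log (nm (pid x.1)) = Real.log (Ideal.absNorm I) := by
  refine UniqueFactorizationMonoid.induction_on_prime I ?_ ?_ ?_
  · intro h; exact (h rfl).elim
  · intro I hI _
    refine ⟨∅, fun x => ?_, ?_⟩
    · simp only [Finset.notMem_empty, false_iff]
      intro h
      have h1 := isUnit_of_dvd_unit h hI
      exact x.1.2.not_isUnit ((isUnit_pow_iff (by omega)).1 h1)
    · rw [Ideal.isUnit_iff.1 hI]; simp
  · intro I P hI hP ih hPI
    obtain ⟨S, hS, hsum⟩ := ih hI
    let p : Pr K := ⟨P, hP⟩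
    have hfm : FiniteMultiplicity P I := FiniteMultiplicity.of_prime_left hP hI
    have hnot : (p, multiplicity P I) ∉ S := by
      rw [hS]
      exact hfm.not_pow_dvd_of_multiplicity_lt (Nat.lt_succ_self _)
    refine ⟨insert (p, multiplicity P I) S, ?_, ?_⟩
    · rintro ⟨Q, k⟩
      rw [Finset.mem_insert, hS]
      by_cases hQ : Q = p
      · subst hQ
        simp only [Prod.mk.injEq, true_and]
        change k = multiplicity P I ∨ P ^ (k + 1) ∣ I ↔ P ^ (k + 1) ∣ P * I
        rw [pow_succ' P k, mul_dvd_mul_iff_left hP.ne_zero, ← pow_succ', hfm.pow_dvd_iff_le_multiplicity,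
          hfm.pow_dvd_iff_le_multiplicity]
        omega
      · simp only [Prod.mk.injEq, hQ, false_and, false_or]
        constructor
        · exact fun h => h.mul_left _
        · intro h
          refine Q.2.pow_dvd_of_dvd_mul_left _ ?_ h
          intro h2
          have h3 := associated_iff_eq.1 ((Prime.dvd_prime_iff_associated Q.2 hP).1 h2)
          exact hQ (Subtype.ext h3)
    · rw [Finset.sum_insert hnot, hsum, map_mul]
      push_cast
      rw [Real.log_mul]
      · rfl
      · exact_mod_cast nm_ne (pid p)
      · exact_mod_cast Ideal.absNorm_ne_zero_of_nonZeroDivisors ⟨I, mem_nonZeroDivisors_of_ne_zero hI⟩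

lemma log_sum (I : Id K) : ∃ S : Finset (Pr K × ℕ), (∀ x, x ∈ S ↔ toId x ∣ I) ∧
    ∑ x ∈ S, Real.log (nm (pid x.1)) = Real.log (nm I) := by
  obtain ⟨S, h1, h2⟩ := log_sum_aux (I : Ideal (𝓞 K)) (nonZeroDivisors.coe_ne_zero I)
  refine ⟨S, fun x => ?_, h2⟩
  rw [h1, nonZeroDivisors_dvd_iff_dvd_coe, coe_toId]

/-- coefficients of the L-function -/
noncomputable def ac (φ : ClassGroup (𝓞 K) →* ℂ) : ArithmeticFunction ℂ :=
  ⟨push nm (fun I => φ (ClassGroup.mk0 I)), by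
    rw [push_eq _ ∅]
    · simp
    · intro x; simp [nm_ne]⟩

/-- coefficients of minus the log derivative -/
noncomputable def lc (φ : ClassGroup (𝓞 K) → ℂ) : ArithmeticFunction ℂ :=
  ⟨push nmX (fun x => φ (ClassGroup.mk0 (toId x)) * Real.log (nm (pid x.1))), by
    rw [push_eq _ ∅]
    · simp
    · intro x; simp [nmX_ne]⟩

lemma ac_apply (φ : ClassGroup (𝓞 K) →* ℂ) (n : ℕ) :
  ac φ n = ∑ I ∈ (nm_fin n).toFinset, φ (ClassGroup.mk0 I) := push_eq _ _ (by simp)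

lemma lc_apply (φ : ClassGroup (𝓞 K) → ℂ) (n : ℕ) :
  lc φ n = ∑ x ∈ (nmX_fin n).toFinset, φ (ClassGroup.mk0 (toId x)) * Real.log (nm (pid x.1)) :=
  push_eq _ _ (by simp)

/-- multiplication by log is a derivation -/
noncomputable def dlog (f : ArithmeticFunction ℂ) : ArithmeticFunction ℂ := ⟨fun n => (Real.log n : ℂ) * f n, by simp⟩

lemma dlog_apply (f : ArithmeticFunction ℂ) (n : ℕ) : dlog f n = (Real.log n : ℂ) * f n := rfl

lemma dlog_mul (f g : ArithmeticFunction ℂ) : dlog (f * g) = dlog f * g + f * dlog g := by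
  ext n
  rw [dlog_apply, ArithmeticFunction.add_apply, ArithmeticFunction.mul_apply, ArithmeticFunction.mul_apply,
    ArithmeticFunction.mul_apply, Finset.mul_sum, ← Finset.sum_add_distrib]
  refine Finset.sum_congr rfl fun p hp => ?_
  obtain ⟨h1, h2⟩ := Nat.mem_divisorsAntidiagonal.1 hp
  rw [dlog_apply, dlog_apply, ← h1]
  have h3 : (p.1 : ℝ) ≠ 0 := by rintro h; apply h2; rw [← h1]; simp_all
  have h4 : (p.2 : ℝ) ≠ 0 := by rintro h; apply h2; rw [← h1]; simp_all
  push_cast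
  rw [← Complex.ofReal_natCast, ← Complex.ofReal_natCast]
  have := Real.log_mul h3 h4
  push_cast
  rw [this]
  push_cast
  ring

theorem dlog_ac (φ : ClassGroup (𝓞 K) →* ℂ) : dlog (ac φ) = lc φ * ac φ := by
  ext n
  choose S hS hsum using log_sum (K := K)
  have h1 : ∀ x : Pr K × ℕ, ∀ I : Id K, x ∈ S I → ∃ J, I = toId x * J := fun x I h => (hS I x).1 h
  choose! q hq using h1
  rw [dlog_apply, ac_apply, ArithmeticFunction.mul_apply, Finset.mul_sum]
  have hL : ∀ I ∈ (nm_fin (K := K) n).toFinset, (Real.log n : ℂ) * φ (ClassGroup.mk0 I) =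
      ∑ x ∈ S I, φ (ClassGroup.mk0 I) * Real.log (nm (pid x.1)) := by
    intro I hI
    simp only [Set.Finite.mem_toFinset, Set.mem_ofPred_eq] at hI
    rw [← Finset.mul_sum, ← Complex.ofReal_sum, hsum, hI, mul_comm]
  rw [Finset.sum_congr rfl hL, Finset.sum_sigma']
  have hR : ∀ p ∈ n.divisorsAntidiagonal, lc φ p.1 * ac φ p.2 =
      ∑ y ∈ (nmX_fin (K := K) p.1).toFinset ×ˢ (nm_fin (K := K) p.2).toFinset,
        (φ (ClassGroup.mk0 (toId y.1)) * Real.log (nm (pid y.1.1))) * φ (ClassGroup.mk0 y.2) := by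
    intro p _
    rw [lc_apply, ac_apply, Finset.sum_product, Finset.sum_mul_sum]
  rw [Finset.sum_congr rfl hR, Finset.sum_sigma']
  refine Finset.sum_bij' (fun y _ => ⟨(nmX y.2, nm (q y.2 y.1)), (y.2, q y.2 y.1)⟩)
    (fun y _ => ⟨toId y.2.1 * y.2.2, y.2.1⟩) ?_ ?_ ?_ ?_ ?_
  · rintro ⟨I, x⟩ h
    simp only [Finset.mem_sigma, Set.Finite.mem_toFinset, Set.mem_ofPred_eq] at h
    simp only [Finset.mem_sigma, Finset.mem_product, Set.Finite.mem_toFinset, Set.mem_ofPred_eq, and_self, and_true,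
      Nat.mem_divisorsAntidiagonal]
    refine ⟨?_, ?_⟩
    · rw [← h.1, hq x I h.2, nm_mul, ← hq x I h.2]; rfl
    · rw [← h.1]; exact nm_ne _
  · rintro ⟨⟨a, b⟩, x, J⟩ h
    simp only [Finset.mem_sigma, Finset.mem_product, Set.Finite.mem_toFinset, Set.mem_ofPred_eq,
      Nat.mem_divisorsAntidiagonal] at h
    simp only [Finset.mem_sigma, Set.Finite.mem_toFinset, Set.mem_ofPred_eq]
    refine ⟨?_, (hS _ _).2 (dvd_mul_right _ _)⟩
    rw [nm_mul, h.2.2, ← h.1.1, ← h.2.1]; rfl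
  · rintro ⟨I, x⟩ h
    simp only [Finset.mem_sigma] at h
    simp only
    rw [← hq x I h.2]
  · rintro ⟨⟨a, b⟩, x, J⟩ h
    simp only [Finset.mem_sigma, Finset.mem_product, Set.Finite.mem_toFinset, Set.mem_ofPred_eq,
      Nat.mem_divisorsAntidiagonal] at h
    have h1 := hq x (toId x * J) ((hS _ _).2 (dvd_mul_right _ _))
    have h2 : q x (toId x * J) = J := (mul_left_cancel h1).symm
    simp only [h2, h.2.1, h.2.2]
  · rintro ⟨I, x⟩ h
    simp only [Finset.mem_sigma] at h
    simp only
    conv_lhs => rw [hq x I h.2, map_mul, map_mul]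
    ring

end NFU

end part11

section part12
open Real Filter Topology NumberField
open scoped ComplexOrder

set_option linter.unusedSectionVars false

namespace NFU
open scoped Classical

variable {K : Type*} [Field K] [NumberField K]

lemma ac_eq (φ : ClassGroup (𝓞 K) →* ℂ) : (ac φ : ℕ → ℂ) = ∑ C : ClassGroup (𝓞 K), φ C • push nm (ind C) := by
  ext n
  rw [Finset.sum_apply, ac_apply]
  have : ∀ C, (φ C • push nm (ind C)) n = ∑ I ∈ (nm_fin (K := K) n).toFinset, φ C * ind C I := by
    intro C
    rw [Pi.smul_apply, push_eq (ind C) (nm_fin n).toFinset (by simp), Finset.smul_sum]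
    rfl
  simp only [this]
  rw [Finset.sum_comm]
  refine Finset.sum_congr rfl fun I _ => ?_
  simp [ind]

lemma ac_summable (φ : ClassGroup (𝓞 K) →* ℂ) {s : ℂ} (hs : 1 < s.re) : LSeriesSummable (ac φ) s := by
  rw [ac_eq]
  refine LSeriesSummable.sum fun C _ => LSeriesSummable.smul _ ?_
  exact LSeriesSummable_of_abscissaOfAbsConv_lt_re (lt_re (classZeta_entire C).1 hs)

lemma ac_abs (φ : ClassGroup (𝓞 K) →* ℂ) : LSeries.abscissaOfAbsConv (ac φ) ≤ 1 :=
  abscissa_le_one fun s hs => ac_summable φ (by simpa using hs)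

lemma ac_entire (φ : ClassGroup (𝓞 K) →* ℂ) : ∃ H : ℂ → ℂ, Differentiable ℂ H ∧ H (-2) = 0 ∧
    H 1 = kap K * ∑ C : ClassGroup (𝓞 K), φ C ∧ ∀ s : ℂ, 1 < s.re → (s - 1) * LSeries (ac φ) s = H s := by
  choose H h1 h2 h3 h4 using fun C : ClassGroup (𝓞 K) => (classZeta_entire C).2
  refine ⟨fun s => ∑ C, φ C * H C s, ?_, ?_, ?_, ?_⟩
  · exact Differentiable.fun_sum fun C _ => (h1 C).const_mul _
  · simp [h2]
  · simp only [h3]; rw [← Finset.sum_mul, mul_comm]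
  · intro s hs
    rw [ac_eq, LSeries_sum fun C _ => LSeriesSummable.smul _
      (LSeriesSummable_of_abscissaOfAbsConv_lt_re (lt_re (classZeta_entire C).1 hs)), Finset.mul_sum]
    refine Finset.sum_congr rfl fun C _ => ?_
    rw [LSeries_smul, ← h4 C s hs]
    ring

lemma div_entire {H : ℂ → ℂ} (hH : Differentiable ℂ H) (h1 : H 1 = 0) : ∃ E : ℂ → ℂ, Differentiable ℂ E ∧
    ∀ s, (s - 1) * E s = H s := by
  refine ⟨dslope H 1, ?_, fun s => ?_⟩
  · have := (Complex.differentiableOn_dslope (s := Set.univ) (c := (1 : ℂ)) (f := H) univ_mem).2 hH.differentiableOn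
    exact differentiableOn_univ.1 this
  · have := sub_smul_dslope H 1 s
    rw [h1, sub_zero] at this
    exact this

lemma ac_one (φ : ClassGroup (𝓞 K) →* ℂ) : ac φ 1 = 1 := by
  have : (nm_fin (K := K) 1).toFinset = {1} := by
    ext I
    simp only [Set.Finite.mem_toFinset, Set.mem_ofPred_eq, Finset.mem_singleton]
    constructor
    · intro h
      have : (I : Ideal (𝓞 K)) = ⊤ := Ideal.absNorm_eq_one_iff.1 h
      exact Subtype.ext (this.trans Ideal.one_eq_top.symm)
    · rintro rfl
      simp [nm]
  rw [ac_apply, this]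
  simp

lemma lc_one (f : ClassGroup (𝓞 K) → ℂ) : lc f 1 = 0 := by
  rw [lc_apply]
  refine Finset.sum_eq_zero fun x hx => ?_
  simp only [Set.Finite.mem_toFinset, Set.mem_ofPred_eq] at hx
  rw [nmX_eq] at hx
  have := two_le_nm x.1
  have h2 := (Nat.pow_eq_one.1 hx)
  omega

/-- the character of the class group -/
noncomputable def chi (ψ : AddChar (Additive (ClassGroup (𝓞 K))) ℂ) : ClassGroup (𝓞 K) →* ℂ where
  toFun C := ψ (Additive.ofMul C)
  map_one' := by simp
  map_mul' a b := by rw [ofMul_mul, AddChar.map_add_eq_mul]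

lemma sum_chi (C : ClassGroup (𝓞 K)) : ∑ ψ : AddChar (Additive (ClassGroup (𝓞 K))) ℂ, chi ψ C =
    if C = 1 then (Fintype.card (ClassGroup (𝓞 K)) : ℂ) else 0 := by
  have := AddChar.sum_apply_eq_ite (Additive.ofMul C)
  simpa [chi] using this

lemma sum_chi' (ψ : AddChar (Additive (ClassGroup (𝓞 K))) ℂ) (h : ψ ≠ 0) : ∑ C, chi ψ C = 0 := by
  have := AddChar.sum_eq_ite ψ
  rw [if_neg h] at this
  rw [← this]
  exact Fintype.sum_equiv Additive.ofMul _ _ fun _ => rfl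

lemma chi_zero (C : ClassGroup (𝓞 K)) : chi 0 C = 1 := by simp [chi]

lemma lc_sum {ι : Type*} (S : Finset ι) (c : ι → ℂ) (f : ι → ClassGroup (𝓞 K) → ℂ) (n : ℕ) :
    lc (fun C => ∑ i ∈ S, c i * f i C) n = ∑ i ∈ S, c i * lc (f i) n := by
  simp only [lc_apply, Finset.mul_sum, Finset.sum_mul]
  rw [Finset.sum_comm]
  simp only [mul_assoc]

lemma af_sum {ι : Type*} (S : Finset ι) (a : ι → ArithmeticFunction ℂ) (n : ℕ) :
    (∑ i ∈ S, a i) n = ∑ i ∈ S, a i n := by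
  induction S using Finset.induction_on with
  | empty => simp
  | insert i S hi ih => rw [Finset.sum_insert hi, Finset.sum_insert hi, ArithmeticFunction.add_apply, ih]

lemma dlog_prod {ι : Type*} (S : Finset ι) (a l : ι → ArithmeticFunction ℂ) (h : ∀ i, dlog (a i) = l i * a i) :
    dlog (∏ i ∈ S, a i) = (∑ i ∈ S, l i) * ∏ i ∈ S, a i := by
  induction S using Finset.induction_on with
  | empty =>
    ext n
    simp only [Finset.prod_empty, Finset.sum_empty, zero_mul, dlog_apply, ArithmeticFunction.one_apply,
      ArithmeticFunction.zero_apply]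
    split_ifs with hn
    · simp [hn]
    · simp
  | insert i S hi ih =>
    rw [Finset.prod_insert hi, Finset.sum_insert hi, dlog_mul, ih, h]
    ring

lemma prod_one {ι : Type*} (S : Finset ι) (a : ι → ArithmeticFunction ℂ) (h : ∀ i, a i 1 = 1) :
    (∏ i ∈ S, a i) 1 = 1 := by
  induction S using Finset.induction_on with
  | empty => simp
  | insert i S hi ih => rw [Finset.prod_insert hi]; simp [ih, h]

lemma prod_LSeries {ι : Type*} (S : Finset ι) (a : ι → ArithmeticFunction ℂ) {s : ℂ}
    (h : ∀ i, LSeriesSummable (a i) s) : LSeriesSummable (∏ i ∈ S, a i : ArithmeticFunction ℂ) s ∧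
      LSeries (∏ i ∈ S, a i : ArithmeticFunction ℂ) s = ∏ i ∈ S, LSeries (a i) s := by
  induction S using Finset.induction_on with
  | empty =>
    simp only [Finset.prod_empty]
    refine ⟨?_, ?_⟩
    · exact (hasSum_single 1 (f := LSeries.term (⇑(1 : ArithmeticFunction ℂ)) s) (fun n hn => by
        rw [LSeries.term_def]; split_ifs <;> simp [hn])).summable
    · have h1 := congrFun LSeries_delta s
      rw [← ArithmeticFunction.one_eq_delta] at h1
      exact h1
  | insert i S hi ih =>
    rw [Finset.prod_insert hi, Finset.prod_insert hi]
    exact ⟨ArithmeticFunction.LSeriesSummable_mul (h i) ih.1, by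
      rw [ArithmeticFunction.LSeries_mul' (h i) ih.1, ih.2]⟩

lemma nonneg_of_dlog (F L : ArithmeticFunction ℂ) (h : dlog F = L * F) (hL : ∀ n, 0 ≤ L n) (hL1 : L 1 = 0)
    (hF : F 1 = 1) : ∀ n, 0 ≤ F n := by
  intro n
  induction n using Nat.strong_induction_on with
  | _ n ih =>
    rcases Nat.lt_or_ge n 2 with hn | hn
    · interval_cases n
      · simp
      · rw [hF]; exact zero_le_one
    · have h1 := congrArg (fun f : ArithmeticFunction ℂ => f n) h
      simp only [dlog_apply, ArithmeticFunction.mul_apply] at h1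
      have h2 : 0 ≤ (Real.log n : ℂ) * F n := by
        rw [h1]
        refine Finset.sum_nonneg fun p hp => ?_
        obtain ⟨e, hn0⟩ := Nat.mem_divisorsAntidiagonal.1 hp
        rcases eq_or_ne p.1 1 with h3 | h3
        · rw [h3, hL1, zero_mul]
        · refine mul_nonneg (hL _) (ih _ ?_)
          have : p.1 ≠ 0 := by rintro h; rw [h] at e; simp at e; omega
          have : p.2 ≠ 0 := by rintro h; rw [h] at e; simp at e; omega
          nlinarith [Nat.two_le_iff p.1 |>.2 ⟨by assumption, h3⟩, Nat.pos_of_ne_zero this]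
      have hlog : 0 < (Real.log n : ℂ) := by
        exact_mod_cast Real.log_pos (by exact_mod_cast hn)
      have := mul_nonneg (inv_nonneg.2 hlog.le) h2
      rwa [inv_mul_cancel_left₀ hlog.ne'] at this

/-- Nonvanishing at `1`. -/
theorem nonvanish (ψ : AddChar (Additive (ClassGroup (𝓞 K))) ℂ) (hψ : ψ ≠ 0) :
    ∃ E : ℂ → ℂ, Differentiable ℂ E ∧ E 1 ≠ 0 ∧ ∀ s : ℂ, 1 < s.re → LSeries (ac (chi ψ)) s = E s := by
  have hex : ∀ ψ : AddChar (Additive (ClassGroup (𝓞 K))) ℂ, ∃ E : ℂ → ℂ, Differentiable ℂ E ∧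
      (ψ ≠ 0 → ∀ s : ℂ, 1 < s.re → LSeries (ac (chi ψ)) s = E s) ∧
      (ψ = 0 → E (-2) = 0 ∧ ∀ s : ℂ, 1 < s.re → (s - 1) * LSeries (ac (chi ψ)) s = E s) := by
    intro ψ
    obtain ⟨H, h1, h2, h3, h4⟩ := ac_entire (chi ψ)
    by_cases h : ψ = 0
    · exact ⟨H, h1, fun h' => (h' h).elim, fun _ => ⟨h2, h4⟩⟩
    · rw [sum_chi' ψ h, mul_zero] at h3
      obtain ⟨E, hE, hE'⟩ := div_entire h1 h3
      refine ⟨E, hE, fun _ s hs => ?_, fun h' => (h h').elim⟩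
      have : s - 1 ≠ 0 := by
        intro h0
        rw [sub_eq_zero.1 h0] at hs
        simp at hs
      exact mul_left_cancel₀ this ((h4 s hs).trans (hE' s).symm)
  choose E hE hE1 hE0 using hex
  refine ⟨E ψ, hE ψ, fun hzero => ?_, hE1 ψ hψ⟩
  obtain ⟨D, hD, hD'⟩ := div_entire (hE ψ) hzero
  let F : ArithmeticFunction ℂ := ∏ χ : AddChar (Additive (ClassGroup (𝓞 K))) ℂ, ac (chi χ)
  have hF1 : F 1 = 1 := prod_one _ _ fun χ => ac_one _
  have hFd : dlog F = (∑ χ : AddChar (Additive (ClassGroup (𝓞 K))) ℂ, lc (chi χ)) * F :=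
    dlog_prod _ _ _ fun χ => dlog_ac _
  have hsum : ∀ n, (∑ χ : AddChar (Additive (ClassGroup (𝓞 K))) ℂ, lc (chi χ)) n =
      lc (fun C : ClassGroup (𝓞 K) => if C = 1 then (Fintype.card (ClassGroup (𝓞 K)) : ℂ) else 0) n := by
    intro n
    have h1 := lc_sum Finset.univ (fun _ => 1) (fun χ : AddChar (Additive (ClassGroup (𝓞 K))) ℂ => chi χ) n
    simp only [one_mul, sum_chi] at h1
    rw [h1, af_sum]
  have hFn : ∀ n, 0 ≤ F n := by
    refine nonneg_of_dlog F _ hFd ?_ ?_ hF1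
    · intro n
      rw [hsum, lc_apply]
      refine Finset.sum_nonneg fun x _ => mul_nonneg ?_ ?_
      · split_ifs
        · exact Nat.cast_nonneg _
        · exact le_rfl
      · exact_mod_cast Real.log_natCast_nonneg _
    · rw [hsum, lc_one]
  have hFs : ∀ s : ℂ, 1 < s.re → LSeriesSummable F s ∧ LSeries F s = ∏ χ : AddChar (Additive (ClassGroup (𝓞 K))) ℂ, LSeries (ac (chi χ)) s :=
    fun s hs => prod_LSeries _ _ fun χ => ac_summable _ hs
  have hFa : LSeries.abscissaOfAbsConv F ≤ 1 := abscissa_le_one fun s hs => (hFs s (by simpa using hs)).1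
  let f : ℂ → ℂ := fun s => E 0 s * (D s * ∏ χ ∈ (Finset.univ.erase 0).erase ψ, E χ s)
  have hf : Differentiable ℂ f :=
    (hE 0).mul (hD.mul (Differentiable.fun_finsetProd fun χ _ => hE χ))
  have hmem : ψ ∈ Finset.univ.erase (0 : AddChar (Additive (ClassGroup (𝓞 K))) ℂ) := by simp [hψ]
  have hfe : {s : ℂ | (1 : ℝ) < s.re}.EqOn f (LSeries F) := by
    intro s hs
    rw [(hFs s hs).2, ← Finset.mul_prod_erase _ _ (Finset.mem_univ 0), ← Finset.mul_prod_erase _ _ hmem]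
    simp only [f]
    rw [← (hE0 0 rfl).2 s hs, hE1 ψ hψ s hs, ← hD' s]
    rw [Finset.prod_congr rfl (fun χ hχ => hE1 χ (by simp at hχ; exact hχ.2) s hs)]
    ring
  have := LSeries.positive_of_differentiable_of_eqOn (a := F) hFn (by rw [hF1]; exact zero_lt_one) hf (x := 1)
    (by exact_mod_cast hFa) hfe (-2)
  simp [f, (hE0 0 rfl).1] at this

end NFU

end part12

section part13
open Real Filter Topology NumberField

set_option linter.unusedSectionVars false

namespace NFU
open scoped Classical

variable {K : Type*} [Field K] [NumberField K]

lemma summ_nm {σ : ℝ} (hσ : 1 < σ) : Summable fun I : Id K => (nm I : ℝ) ^ (-σ) := by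
  have h : ∀ C : ClassGroup (𝓞 K), Summable (fun I => ind C I * (nm I : ℂ) ^ (-(σ : ℂ))) := fun C => by
    obtain ⟨G, A, B, c, M, hc, hM, hG, hs⟩ := classZeta_real C
    exact (hs σ hσ).1
  have h2 := summable_sum (s := Finset.univ) fun C (_ : C ∈ Finset.univ) => h C
  have h3 := h2.norm
  refine h3.congr fun I => ?_
  rw [← Finset.sum_mul]
  have : ∑ C, ind C I = 1 := by simp [ind]
  rw [this, one_mul, Complex.norm_natCast_cpow_of_pos (Nat.pos_of_ne_zero (nm_ne I))]
  simp

lemma summ_log {σ : ℝ} (hσ : 1 < σ) : Summable fun P : Pr K => Real.log (nm (pid P)) * (nm (pid P) : ℝ) ^ (-σ) := by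
  have hε : 0 < (σ - 1) / 2 := by linarith
  have h1 := ((summ_nm (K := K) (σ := σ - (σ - 1) / 2) (by linarith)).comp_injective pid_inj).mul_left (1 / ((σ - 1) / 2))
  refine Summable.of_nonneg_of_le (fun P => ?_) (fun P => ?_) h1
  · exact mul_nonneg (Real.log_natCast_nonneg _) (by positivity)
  · have hp : (0 : ℝ) < nm (pid P) := by exact_mod_cast Nat.pos_of_ne_zero (nm_ne _)
    have := Real.log_le_rpow_div hp.le hε
    calc _ ≤ (nm (pid P) : ℝ) ^ ((σ - 1) / 2) / ((σ - 1) / 2) * (nm (pid P) : ℝ) ^ (-σ) := by gcongr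
      _ = 1 / ((σ - 1) / 2) * ((nm (pid P) : ℝ) ^ ((σ - 1) / 2) * (nm (pid P) : ℝ) ^ (-σ)) := by ring
      _ = _ := by
        rw [← Real.rpow_add hp]
        simp only [Function.comp]
        congr 2
        ring

lemma summ_X {σ : ℝ} (hσ : 1 < σ) : Summable fun x : Pr K × ℕ =>
    (Real.log (nm (pid x.1)) * (nm (pid x.1) : ℝ) ^ (-σ)) * (1 / 2 : ℝ) ^ x.2 := by
  refine Summable.mul_of_nonneg (f := fun P : Pr K => Real.log (nm (pid P)) * (nm (pid P) : ℝ) ^ (-σ))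
    (g := fun k : ℕ => (1 / 2 : ℝ) ^ k) (summ_log hσ) summable_geometric_two ?_ ?_
  · exact fun P => mul_nonneg (Real.log_natCast_nonneg _) (by positivity)
  · exact fun k => by positivity

lemma lc_summable_aux (f : ClassGroup (𝓞 K) → ℂ) (s : ℝ)
    (h : Summable fun x : Pr K × ℕ => ‖f (ClassGroup.mk0 (toId x))‖ * (Real.log (nm (pid x.1)) * (nmX x : ℝ) ^ (-s))) :
    LSeriesSummable (lc f) s := by
  have h2 : Summable fun x : Pr K × ℕ => (f (ClassGroup.mk0 (toId x)) * Real.log (nm (pid x.1))) * (nmX x : ℂ) ^ (-(s : ℂ)) := by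
    refine Summable.of_norm (h.congr fun x => ?_)
    rw [norm_mul, norm_mul, Complex.norm_natCast_cpow_of_pos (Nat.pos_of_ne_zero (nmX_ne x)), Complex.norm_real,
      Real.norm_of_nonneg (Real.log_natCast_nonneg _), mul_assoc]
    simp
  exact (push_hasSum nmX_ne nmX_fin _ _ _ h2.hasSum).LSeriesSummable

lemma nmX_rpow (x : Pr K × ℕ) (s : ℝ) : (nmX x : ℝ) ^ (-s) = (nm (pid x.1) : ℝ) ^ (-s) * ((nm (pid x.1) : ℝ) ^ (-s)) ^ x.2 := by
  rw [nmX_eq]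
  push_cast
  rw [← Real.rpow_natCast, ← Real.rpow_mul (by positivity), ← Real.rpow_natCast, ← Real.rpow_mul (by positivity),
    ← Real.rpow_add (by exact_mod_cast Nat.pos_of_ne_zero (nm_ne _))]
  congr 1
  push_cast
  ring

lemma half_le (P : Pr K) {s : ℝ} (hs : 1 ≤ s) : (nm (pid P) : ℝ) ^ (-s) ≤ 1 / 2 := by
  have h2 : (2 : ℝ) ≤ nm (pid P) := by exact_mod_cast two_le_nm P
  calc (nm (pid P) : ℝ) ^ (-s) ≤ (nm (pid P) : ℝ) ^ (-1 : ℝ) := Real.rpow_le_rpow_of_exponent_le (by linarith) (by linarith)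
    _ = (nm (pid P) : ℝ)⁻¹ := Real.rpow_neg_one _
    _ ≤ _ := by rw [one_div]; gcongr

lemma lc_summable (f : ClassGroup (𝓞 K) → ℂ) {s : ℝ} (hs : 1 < s) : LSeriesSummable (lc f) s := by
  refine lc_summable_aux f s ?_
  obtain ⟨M, hM⟩ : ∃ M, ∀ C, ‖f C‖ ≤ M := ⟨∑ C, ‖f C‖, fun C => Finset.single_le_sum (f := fun C => ‖f C‖)
    (fun _ _ => norm_nonneg _) (Finset.mem_univ C)⟩
  refine Summable.of_nonneg_of_le (fun x => ?_) (fun x => ?_) ((summ_X (K := K) hs).mul_left M)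
  · exact mul_nonneg (norm_nonneg _) (mul_nonneg (Real.log_natCast_nonneg _) (by positivity))
  · have h0 := Real.log_natCast_nonneg (nm (pid x.1))
    have h1 := half_le x.1 hs.le
    have hM0 : 0 ≤ M := (norm_nonneg _).trans (hM 1)
    refine mul_le_mul (hM _) ?_ (mul_nonneg h0 (by positivity)) hM0
    rw [nmX_rpow, mul_assoc]
    gcongr

/-- If a class contains no primes, the prime power series converges at `1`. -/
lemma lc_summable_one (C : ClassGroup (𝓞 K)) (hC : ∀ P : Pr K, ClassGroup.mk0 (pid P) ≠ C) :
    LSeriesSummable (lc fun D => if D = C then 1 else 0) (1 : ℝ) := by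
  refine lc_summable_aux _ 1 ?_
  refine Summable.of_nonneg_of_le (fun x => ?_) (fun x => ?_) ((summ_X (K := K) one_lt_two).mul_left 2)
  · exact mul_nonneg (norm_nonneg _) (mul_nonneg (Real.log_natCast_nonneg _) (by positivity))
  · have h0 := Real.log_natCast_nonneg (nm (pid x.1))
    obtain ⟨P, k⟩ := x
    rcases k with _ | k
    · have : ClassGroup.mk0 (toId (P, 0)) ≠ C := by
        have e : toId (P, 0) = pid P := by simp [toId]
        rw [e]; exact hC P
      rw [if_neg this, norm_zero, zero_mul]
      positivity
    · have h1 := half_le P (le_refl (1 : ℝ))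
      have h3 : ‖(if ClassGroup.mk0 (toId (P, k + 1)) = C then (1 : ℂ) else 0)‖ ≤ 1 := by
        split_ifs <;> simp
      refine (mul_le_of_le_one_left (mul_nonneg h0 (by positivity)) h3).trans ?_
      have hp : (0 : ℝ) < nm (pid P) := by exact_mod_cast Nat.pos_of_ne_zero (nm_ne _)
      have e : (nm (pid P) : ℝ) ^ (-2 : ℝ) = (nm (pid P) : ℝ) ^ (-1 : ℝ) * (nm (pid P) : ℝ) ^ (-1 : ℝ) := by
        rw [← Real.rpow_add hp]; norm_num
      rw [nmX_rpow]
      simp only [e, pow_succ]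
      have h4 : ((nm (pid P) : ℝ) ^ (-1 : ℝ)) ^ k ≤ (1 / 2) ^ k := by gcongr
      simp only at h0
      calc _ = (Real.log (nm (pid P)) * ((nm (pid P) : ℝ) ^ (-1 : ℝ) * (nm (pid P) : ℝ) ^ (-1 : ℝ))) * ((nm (pid P) : ℝ) ^ (-1 : ℝ)) ^ k := by ring
        _ ≤ (Real.log (nm (pid P)) * ((nm (pid P) : ℝ) ^ (-1 : ℝ) * (nm (pid P) : ℝ) ^ (-1 : ℝ))) * (1 / 2) ^ k := by gcongr
        _ = _ := by ring

lemma tendsto_zero_of_summable {a : ℕ → ℂ} (h : LSeriesSummable a (1 : ℝ)) :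
    Tendsto (fun s : ℝ => ((s : ℂ) - 1) * LSeries a s) (𝓝[>] 1) (𝓝 0) := by
  set B := ∑' n, ‖LSeries.term a (1 : ℝ) n‖ with hB
  have hb : ∀ s : ℝ, 1 < s → ‖((s : ℂ) - 1) * LSeries a s‖ ≤ (s - 1) * B := by
    intro s hs
    rw [norm_mul]
    have e : ‖(s : ℂ) - 1‖ = s - 1 := by
      rw [← Complex.ofReal_one, ← Complex.ofReal_sub, Complex.norm_real, Real.norm_of_nonneg (by linarith)]
    rw [e]
    refine mul_le_mul_of_nonneg_left ?_ (by linarith)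
    refine tsum_of_norm_bounded h.norm.hasSum fun n => ?_
    exact LSeries.norm_term_le_of_re_le_re a (by simpa using hs.le) n
  have h0 : Tendsto (fun s : ℝ => (s - 1) * B) (𝓝[>] 1) (𝓝 0) :=
    (Continuous.tendsto' (by fun_prop) 1 0 (by simp)).mono_left nhdsWithin_le_nhds
  refine squeeze_zero_norm' ?_ h0
  filter_upwards [self_mem_nhdsWithin] with s hs using hb s hs

lemma lc_mul_ac (φ : ClassGroup (𝓞 K) →* ℂ) {s : ℝ} (hs : 1 < s) :
    LSeries (lc φ) s * LSeries (ac φ) s = - deriv (LSeries (ac φ)) s := by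
  have hs' : 1 < (s : ℂ).re := by simpa using hs
  rw [LSeries_deriv (lt_re (ac_abs φ) hs'), neg_neg, ← ArithmeticFunction.LSeries_mul' (lc_summable φ hs) (ac_summable φ hs'),
    ← dlog_ac]
  refine LSeries_congr (fun {n} hn => ?_) _
  rw [dlog_apply, LSeries.logMul]
  congr 1
  rw [Complex.ofReal_log (by positivity)]
  simp

lemma deriv_eq_of_eq {f g : ℂ → ℂ} (h : ∀ s : ℂ, 1 < s.re → f s = g s) {s : ℂ} (hs : 1 < s.re) : deriv f s = deriv g s := by
  refine Filter.EventuallyEq.deriv_eq ?_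
  have ho : IsOpen {s : ℂ | 1 < s.re} := isOpen_lt continuous_const Complex.continuous_re
  filter_upwards [ho.mem_nhds hs] with z hz using h z hz

lemma tendsto_real {g : ℂ → ℂ} (hg : ContinuousAt g 1) : Tendsto (fun s : ℝ => g s) (𝓝[>] 1) (𝓝 (g 1)) := by
  have : Tendsto (fun s : ℝ => (s : ℂ)) (𝓝[>] 1) (𝓝 1) :=
    (Complex.continuous_ofReal.tendsto' 1 1 (by simp)).mono_left nhdsWithin_le_nhds
  exact hg.tendsto.comp this

lemma tendsto_nontriv (ψ : AddChar (Additive (ClassGroup (𝓞 K))) ℂ) (hψ : ψ ≠ 0) :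
    Tendsto (fun s : ℝ => ((s : ℂ) - 1) * LSeries (lc (chi ψ)) s) (𝓝[>] 1) (𝓝 0) := by
  obtain ⟨E, hE, hE1, hEs⟩ := nonvanish ψ hψ
  have hdE : Continuous (deriv E) := (hE.contDiff (n := 1)).continuous_deriv le_rfl
  have hcont : ContinuousAt (fun s : ℂ => (s - 1) * (-deriv E s / E s)) 1 := by
    refine ContinuousAt.mul (by fun_prop) (ContinuousAt.div hdE.continuousAt.neg hE.continuous.continuousAt hE1)
  have h1 := tendsto_real hcont
  simp only [sub_self, zero_mul] at h1
  refine h1.congr' ?_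
  have hne := (tendsto_real (g := E) hE.continuous.continuousAt).eventually_ne hE1
  filter_upwards [self_mem_nhdsWithin, hne] with s hs hs2
  have hs' : 1 < (s : ℂ).re := by simpa using hs
  have h2 := lc_mul_ac (chi ψ) hs
  rw [deriv_eq_of_eq hEs hs', hEs s hs'] at h2
  rw [← h2, mul_div_cancel_right₀ _ hs2]

lemma tendsto_triv : Tendsto (fun s : ℝ => ((s : ℂ) - 1) * LSeries (lc (K := K) (chi 0)) s) (𝓝[>] 1) (𝓝 1) := by
  obtain ⟨H, hH, -, hH1, hHs⟩ := ac_entire (K := K) (chi 0)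
  have hH1' : H 1 ≠ 0 := by
    rw [hH1]
    simp only [chi_zero, Finset.sum_const, Finset.card_univ, nsmul_eq_mul, mul_one]
    refine mul_ne_zero ?_ ?_
    · exact_mod_cast (kap_pos K).ne'
    · exact_mod_cast Fintype.card_ne_zero
  have hdH : Continuous (deriv H) := (hH.contDiff (n := 1)).continuous_deriv le_rfl
  have hcont : ContinuousAt (fun s : ℂ => 1 - (s - 1) * (deriv H s / H s)) 1 := by
    refine ContinuousAt.sub (by fun_prop) (ContinuousAt.mul (by fun_prop) (ContinuousAt.div hdH.continuousAt hH.continuous.continuousAt hH1'))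
  have h1 := tendsto_real hcont
  simp only [sub_self, zero_mul, sub_zero] at h1
  refine h1.congr' ?_
  have hne := (tendsto_real (g := H) hH.continuous.continuousAt).eventually_ne hH1'
  filter_upwards [self_mem_nhdsWithin, hne] with s hs hs2
  have hs' : 1 < (s : ℂ).re := by simpa using hs
  have h2 := lc_mul_ac (K := K) (chi 0) hs
  have h3 : deriv H s = LSeries (ac (K := K) (chi 0)) s + (s - 1) * deriv (LSeries (ac (K := K) (chi 0))) s := by
    rw [← deriv_eq_of_eq hHs hs', deriv_fun_mul (by fun_prop)]
    · simp
    · exact (LSeries_hasDerivAt (lt_re (ac_abs _) hs')).differentiableAt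
  have h4 := hHs s hs'
  rw [← h4] at hs2 ⊢
  rw [h3]
  have h5 : deriv (LSeries (ac (K := K) (chi 0))) s = - (LSeries (lc (K := K) (chi 0)) s * LSeries (ac (K := K) (chi 0)) s) := by
    rw [h2, neg_neg]
  rw [h5]
  have h6 := left_ne_zero_of_mul hs2
  have h7 := right_ne_zero_of_mul hs2
  field_simp
  ring

/-- Every ideal class contains a prime ideal. -/
theorem exists_prime_in_class (C : ClassGroup (𝓞 K)) : ∃ P : Pr K, ClassGroup.mk0 (pid P) = C := by
  by_contra! hC
  have h0 := tendsto_zero_of_summable (lc_summable_one C hC)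
  have hh : (Fintype.card (ClassGroup (𝓞 K)) : ℂ) ≠ 0 := by exact_mod_cast Fintype.card_ne_zero
  have hind : (fun D : ClassGroup (𝓞 K) => if D = C then (1 : ℂ) else 0) = fun D =>
      ∑ ψ : AddChar (Additive (ClassGroup (𝓞 K))) ℂ, ((Fintype.card (ClassGroup (𝓞 K)) : ℂ)⁻¹ * chi ψ C⁻¹) * chi ψ D := by
    ext D
    have h1 := sum_chi (C⁻¹ * D)
    simp only [map_mul] at h1
    simp only [mul_assoc]
    rw [← Finset.mul_sum, h1, inv_mul_eq_one]
    by_cases h : D = C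
    · rw [if_pos h, if_pos h.symm, inv_mul_cancel₀ hh]
    · rw [if_neg h, if_neg (Ne.symm h), mul_zero]
  have hlc : (lc (fun D : ClassGroup (𝓞 K) => if D = C then (1 : ℂ) else 0) : ℕ → ℂ) =
      ∑ ψ : AddChar (Additive (ClassGroup (𝓞 K))) ℂ, ((Fintype.card (ClassGroup (𝓞 K)) : ℂ)⁻¹ * chi ψ C⁻¹) • (lc (chi ψ) : ℕ → ℂ) := by
    ext n
    rw [hind, lc_sum, Finset.sum_apply]
    rfl
  have h1 : Tendsto (fun s : ℝ => ∑ ψ : AddChar (Additive (ClassGroup (𝓞 K))) ℂ,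
      ((Fintype.card (ClassGroup (𝓞 K)) : ℂ)⁻¹ * chi ψ C⁻¹) * (((s : ℂ) - 1) * LSeries (lc (chi ψ)) s)) (𝓝[>] 1)
      (𝓝 (∑ ψ : AddChar (Additive (ClassGroup (𝓞 K))) ℂ,
      ((Fintype.card (ClassGroup (𝓞 K)) : ℂ)⁻¹ * chi ψ C⁻¹) * (if ψ = 0 then 1 else 0))) := by
    refine tendsto_finset_sum _ fun ψ _ => Tendsto.const_mul _ ?_
    split_ifs with h
    · subst h; exact tendsto_triv
    · exact tendsto_nontriv ψ h
  have h2 := tendsto_nhds_unique h1 (h0.congr' ?_)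
  · simp only [mul_ite, mul_one, mul_zero, Finset.sum_ite_eq', Finset.mem_univ, if_true, chi_zero] at h2
    exact inv_ne_zero hh h2
  · filter_upwards [self_mem_nhdsWithin] with s hs
    rw [hlc, LSeries_sum fun ψ _ => LSeriesSummable.smul _ (lc_summable _ hs), Finset.mul_sum]
    refine Finset.sum_congr rfl fun ψ _ => ?_
    rw [LSeries_smul]
    ring

end NFU

end part13

namespace NFA

section gen
variable {D : Type*} [CommRing D]

/-- `z` is up to a unit a product of `m` irreducibles. -/
def Len (z : D) (m : ℕ) : Prop :=
  ∃ s : Multiset D, (∀ p ∈ s, Irreducible p) ∧ Multiset.card s = m ∧ Associated s.prod z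

lemma Len.mul {z w : D} {m n : ℕ} (h : Len z m) (h' : Len w n) : Len (z * w) (m + n) := by
  obtain ⟨s, hs, rfl, hz⟩ := h
  obtain ⟨t, ht, rfl, hw⟩ := h'
  refine ⟨s + t, ?_, by simp, ?_⟩
  · intro p hp
    rcases Multiset.mem_add.1 hp with h | h
    · exact hs p h
    · exact ht p h
  · rw [Multiset.prod_add]; exact hz.mul_mul hw

lemma Len.assoc {z w : D} {m : ℕ} (h : Len z m) (h' : Associated z w) : Len w m := by
  obtain ⟨s, hs, hm, hz⟩ := h
  exact ⟨s, hs, hm, hz.trans h'⟩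

lemma Len.irr {z : D} (h : Irreducible z) : Len z 1 :=
  ⟨{z}, by simpa using h, by simp, by simp⟩

lemma Len.one : Len (1 : D) 0 :=
  ⟨0, by simp, by simp, by simp⟩

lemma Len.pow {z : D} {m : ℕ} (h : Len z m) (n : ℕ) : Len (z ^ n) (n * m) := by
  induction n with
  | zero => simpa using Len.one
  | succ k ih => rw [pow_succ, Nat.succ_mul]; exact ih.mul h

lemma Len.zero_isUnit {z : D} (h : Len z 0) : IsUnit z := by
  obtain ⟨s, hs, hm, hz⟩ := h
  rw [Multiset.card_eq_zero] at hm
  subst hm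
  simpa using hz.isUnit (by simp)

lemma Len.eq_zero {z : D} {m : ℕ} (h : Len z m) (hz : IsUnit z) : m = 0 := by
  obtain ⟨s, hs, hm, hsz⟩ := h
  by_contra hne
  obtain ⟨p, hp⟩ := Multiset.card_pos_iff_exists_mem.1 (by omega : 0 < Multiset.card s)
  exact (hs p hp).not_isUnit (isUnit_of_dvd_unit (Multiset.dvd_prod hp) (hsz.symm.isUnit hz))

lemma Len.succ {z : D} {m : ℕ} (h : Len z (m + 1)) :
    ∃ p w : D, Irreducible p ∧ Len w m ∧ Associated (p * w) z := by
  obtain ⟨s, hs, hm, hsz⟩ := h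
  obtain ⟨p, hp⟩ := Multiset.card_pos_iff_exists_mem.1 (by omega : 0 < Multiset.card s)
  obtain ⟨t, rfl⟩ := Multiset.exists_cons_of_mem hp
  refine ⟨p, t.prod, hs p (by simp), ⟨t, fun q hq => hs q (by simp [hq]), by simpa using hm, .refl _⟩, ?_⟩
  simpa using hsz

lemma exists_len (h : IsAtomicDomain D) {z : D} (hz : z ≠ 0) : ∃ m, Len z m := by
  by_cases hu : IsUnit z
  · exact ⟨0, 0, by simp, by simp, by simpa using (associated_one_iff_isUnit.2 hu).symm⟩
  · obtain ⟨l, hl, hp⟩ := h z hz hu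
    exact ⟨_, l, hl, rfl, by rw [hp]⟩

lemma len_unique (h : IsIDPD D) : ∀ (m : ℕ) (z : D), z ≠ 0 → Len z m → ∀ n, Len z n → n = m := by
  obtain ⟨hdom, hat, hid⟩ := h
  intro m
  induction m with
  | zero => exact fun z hz h0 n hn => hn.eq_zero h0.zero_isUnit
  | succ m ih =>
    intro z hz hm n hn
    cases n with
    | zero => exact (hm.eq_zero hn.zero_isUnit).symm
    | succ n =>
      obtain ⟨p, a, hp, ha, hpa⟩ := hm.succ
      obtain ⟨q, b, hq, hb, hqb⟩ := hn.succ
      have hpa0 : p * a ≠ 0 := hpa.symm.ne_zero_iff.1 hz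
      have hqb0 : q * b ≠ 0 := hqb.symm.ne_zero_iff.1 hz
      have ha0 := right_ne_zero_of_mul hpa0
      have hb0 := right_ne_zero_of_mul hqb0
      have hpq := hpa.trans hqb.symm
      by_cases has : Associated p q
      · have : Associated a b := Associated.of_mul_left hpq has hp.ne_zero
        rw [ih a ha0 ha n (hb.assoc this.symm)]
      · have hzu : ¬ IsUnit z := fun hu => by simpa using hm.eq_zero hu
        obtain ⟨p', q', hp', hq', h1, w, hw⟩ := hid z p q hz hzu hp hq
          ((Dvd.intro a rfl).trans hpa.dvd) ((Dvd.intro b rfl).trans hqb.dvd) has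
        have hw0 : w ≠ 0 := by rintro rfl; simp at hw; exact hz hw
        obtain ⟨k, hk⟩ := exists_len hat hw0
        have e1 : Associated (p' * w) a := by
          refine Associated.of_mul_left (a := p) (c := p) ?_ (.refl _) hp.ne_zero
          rw [← mul_assoc]
          exact (h1.mul_right w).trans (hw ▸ hpa.symm)
        have e2 : Associated (q' * w) b := by
          refine Associated.of_mul_left (a := q) (c := q) ?_ (.refl _) hq.ne_zero
          rw [← mul_assoc]
          exact (hw ▸ hqb.symm)
        have h3 := ih a ha0 ha _ (((Len.irr hp').mul hk).assoc e1)
        have h4 := ((Len.irr hq').mul hk).assoc e2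
        rw [h3] at h4
        rw [ih b hb0 h4 n hb]

theorem idpd_hfd (h : IsIDPD D) : IsHFD D := by
  have := h.1
  refine ⟨h.1, h.2.1, fun s t hs ht hst => ?_⟩
  have h0 : s.prod ≠ 0 := by
    rw [Ne, Multiset.prod_eq_zero_iff]
    exact fun h => (hs 0 h).ne_zero rfl
  exact len_unique h _ s.prod h0 ⟨t, ht, rfl, by rw [hst]⟩ _ ⟨s, hs, rfl, .refl _⟩

lemma hfd_unique (h : IsHFD D) {z : D} {m n : ℕ} (hz : Len z m) (hn : Len z n) : m = n := by
  obtain ⟨s, hs, rfl, hsz⟩ := hz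
  obtain ⟨t, ht, rfl, htz⟩ := hn
  obtain ⟨u, hu⟩ := hsz.trans htz.symm
  rcases Multiset.empty_or_exists_mem s with h0 | ⟨p, hp⟩
  · subst h0
    have : Len t.prod (Multiset.card t) := ⟨t, ht, rfl, .refl _⟩
    have := this.eq_zero (by rw [← hu]; simp)
    simp [this]
  · obtain ⟨r, rfl⟩ := Multiset.exists_cons_of_mem hp
    have := h.2.2 ((p * u) ::ₘ r) t ?_ ht ?_
    · simpa using this
    · intro x hx
      rcases Multiset.mem_cons.1 hx with rfl | hx
      · exact (irreducible_mul_units u).2 (hs p (by simp))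
      · exact hs x (by simp [hx])
    · rw [← hu]; simp; ring

end gen

section ded
variable {R : Type*} [CommRing R] [IsDedekindDomain R]

lemma atomic : IsAtomicDomain R := by
  intro z hz hu
  obtain ⟨f, hf, hfz⟩ := WfDvdMonoid.exists_factors z hz
  obtain ⟨u, hu'⟩ := hfz
  rcases Multiset.empty_or_exists_mem f with h0 | ⟨p, hp⟩
  · subst h0; exact (hu (by rw [← hu']; simp)).elim
  · obtain ⟨r, rfl⟩ := Multiset.exists_cons_of_mem hp
    refine ⟨(p * u) ::ₘ r, ?_, ?_⟩
    · intro x hx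
      rcases Multiset.mem_cons.1 hx with rfl | hx
      · exact (irreducible_mul_units u).2 (hf p (by simp))
      · exact hf x (by simp [hx])
    · rw [← hu']; simp; ring

/-- class of a nonzero ideal -/
noncomputable def cl (I : Ideal R) (h : I ≠ 0) : ClassGroup R :=
  ClassGroup.mk0 ⟨I, mem_nonZeroDivisors_of_ne_zero h⟩

lemma cl_one {I : Ideal R} (h : I ≠ 0) : cl I h = 1 ↔ I.IsPrincipal := ClassGroup.mk0_eq_one_iff _

lemma cl_mul {I J : Ideal R} (h : I ≠ 0) (h' : J ≠ 0) :
    cl (I * J) (mul_ne_zero h h') = cl I h * cl J h' := by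
  rw [cl, cl, cl, ← map_mul]; rfl

lemma cl_pow {I : Ideal R} (h : I ≠ 0) (n : ℕ) :
    cl (I ^ n) (pow_ne_zero n h) = cl I h ^ n := by
  rw [cl, cl, ← map_pow]; rfl

lemma prin_mul {I J : Ideal R} (h : I ≠ 0) (h' : J ≠ 0) (hI : I.IsPrincipal) (hJ : J.IsPrincipal) :
    (I * J).IsPrincipal := by
  rw [← cl_one (mul_ne_zero h h'), cl_mul h h', (cl_one h).2 hI, (cl_one h').2 hJ, one_mul]

lemma prin_right {I J : Ideal R} (h : I ≠ 0) (h' : J ≠ 0) (hI : I.IsPrincipal)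
    (hJ : (I * J).IsPrincipal) : J.IsPrincipal := by
  rw [← cl_one (mul_ne_zero h h'), cl_mul h h', (cl_one h).2 hI, one_mul, cl_one] at hJ
  exact hJ

lemma prin_iff {I : Ideal R} : I.IsPrincipal ↔ ∃ x, I = Ideal.span {x} :=
  ⟨fun h => ⟨h.1.choose, h.1.choose_spec⟩, fun ⟨x, hx⟩ => ⟨x, hx⟩⟩

lemma prin_span (x : R) : (Ideal.span {x}).IsPrincipal := ⟨x, rfl⟩

lemma span_mul' (x y : R) : Ideal.span {x * y} = Ideal.span {x} * Ideal.span {y} :=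
  (Ideal.span_singleton_mul_span_singleton x y).symm

lemma span_dvd {x y : R} : Ideal.span {x} ∣ Ideal.span {y} ↔ x ∣ y := by
  rw [Ideal.dvd_iff_le, Ideal.span_singleton_le_span_singleton]

lemma span_assoc {x y : R} : Ideal.span {x} = Ideal.span {y} ↔ Associated x y :=
  Ideal.span_singleton_eq_span_singleton

lemma span_ne {x : R} : Ideal.span {x} ≠ 0 ↔ x ≠ 0 := by
  rw [Ne, Ideal.zero_eq_bot, Ideal.span_singleton_eq_bot]

/-- A generator of a product of two nonprincipal primes is irreducible. -/
lemma irr_two {A B : Ideal R} (hA : Prime A) (hB : Prime B) (hA' : ¬ A.IsPrincipal)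
    (hB' : ¬ B.IsPrincipal) {g : R} (hg : Ideal.span {g} = A * B) : Irreducible g := by
  have key : ∀ x y : R, Ideal.span {x} * Ideal.span {y} = A * B → A ∣ Ideal.span {x} → IsUnit y := by
    rintro x y hxy ⟨X, hX⟩
    have h1 : X * Ideal.span {y} = B := by
      apply mul_left_cancel₀ hA.ne_zero
      rw [← hxy, hX, mul_assoc]
    rcases hB.irreducible.isUnit_or_isUnit h1.symm with h | h
    · rw [Ideal.isUnit_iff] at h
      rw [h, Ideal.mul_top] at hX
      exact (hA' (hX ▸ prin_span x)).elim
    · rwa [Ideal.isUnit_iff, Ideal.span_singleton_eq_top] at h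
  constructor
  · intro hu
    rw [Ideal.span_singleton_eq_top.2 hu] at hg
    exact hA.not_isUnit (isUnit_of_dvd_one (Dvd.intro B (by rw [← hg, Ideal.one_eq_top])))
  · intro x y hxy
    rw [hxy, span_mul'] at hg
    rcases hA.dvd_or_dvd (Dvd.intro B hg.symm) with h | h
    · exact Or.inr (key x y hg h)
    · exact Or.inl (key y x (by rw [mul_comm, hg]) h)

lemma exists_prime_dvd {I : Ideal R} (h0 : I ≠ 0) (h1 : ¬ IsUnit I) : ∃ P, Prime P ∧ P ∣ I := by
  obtain ⟨P, hP, h⟩ := WfDvdMonoid.exists_irreducible_factor h1 h0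
  exact ⟨P, hP.prime, h⟩

lemma exists_nonprin {I : Ideal R} : I ≠ 0 → ¬ I.IsPrincipal → ∃ P, Prime P ∧ P ∣ I ∧ ¬ P.IsPrincipal := by
  refine UniqueFactorizationMonoid.induction_on_prime I ?_ ?_ ?_
  · intro h; exact (h rfl).elim
  · intro J hJ _ h
    rw [Ideal.isUnit_iff] at hJ
    exact (h (hJ ▸ top_isPrincipal)).elim
  · intro J P hJ hP ih _ h
    by_cases hPp : P.IsPrincipal
    · obtain ⟨Q, hQ, hd, hn⟩ := ih hJ fun hJp => h (prin_mul hP.ne_zero hJ hPp hJp)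
      exact ⟨Q, hQ, hd.mul_left P, hn⟩
    · exact ⟨P, hP, Dvd.intro _ rfl, hPp⟩

lemma irr_dvd {p : R} (hp : Irreducible p) {I : Ideal R} (hI : I.IsPrincipal) (hu : ¬ IsUnit I)
    (h : I ∣ Ideal.span {p}) : Ideal.span {p} = I := by
  obtain ⟨a, rfl⟩ := prin_iff.1 hI
  rw [span_dvd] at h
  rw [Ideal.isUnit_iff, Ideal.span_singleton_eq_top] at hu
  rw [span_assoc]
  rcases hp.dvd_iff.1 h with h | h
  · exact (hu h).elim
  · exact h

/-- structure of irreducibles for class number at most two -/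
lemma irr_struct (H : ∀ I J : Ideal R, I ≠ 0 → J ≠ 0 → ¬ I.IsPrincipal → ¬ J.IsPrincipal → (I * J).IsPrincipal)
    {p : R} (hp : Irreducible p) : Prime p ∨ ∃ A B : Ideal R, Prime A ∧ Prime B ∧ ¬ A.IsPrincipal ∧
      ¬ B.IsPrincipal ∧ Ideal.span {p} = A * B := by
  have hp0 := span_ne.2 hp.ne_zero
  have hfin : Prime (Ideal.span {p}) → Prime p := fun h =>
    (Ideal.span_singleton_prime hp.ne_zero).1 (Ideal.isPrime_of_prime h)
  obtain ⟨A, hA, J, hJ⟩ := exists_prime_dvd hp0 (by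
    rw [Ideal.isUnit_iff, Ideal.span_singleton_eq_top]; exact hp.not_isUnit)
  by_cases hAp : A.IsPrincipal
  · left; apply hfin
    rw [irr_dvd hp hAp hA.not_isUnit ⟨J, hJ⟩]; exact hA
  have hJ0 : J ≠ 0 := by rintro rfl; simp at hJ; exact hp.ne_zero hJ
  have hJp : ¬ J.IsPrincipal := fun h => hAp (prin_right hJ0 hA.ne_zero h (by
    rw [mul_comm, ← hJ]; exact prin_span p))
  obtain ⟨B, hB, hBJ, hBp⟩ := exists_nonprin hJ0 hJp
  refine Or.inr ⟨A, B, hA, hB, hAp, hBp, ?_⟩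
  refine irr_dvd hp (H A B hA.ne_zero hB.ne_zero hAp hBp) ?_ (hJ ▸ mul_dvd_mul_left A hBJ)
  exact fun h => hA.not_isUnit (isUnit_of_mul_isUnit_left h)

lemma prime_dvd_eq {A B : Ideal R} (hA : Prime A) (hB : Prime B) (h : A ∣ B) : A = B :=
  associated_iff_eq.1 (hA.associated_of_dvd hB h)

theorem idpd_of (H : ∀ I J : Ideal R, I ≠ 0 → J ≠ 0 → ¬ I.IsPrincipal → ¬ J.IsPrincipal → (I * J).IsPrincipal) :
    IsIDPD R := by
  refine ⟨inferInstance, atomic, ?_⟩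
  intro z p q hz hzu hp hq hpz hqz hpq
  have easy : p * q ∣ z → ∃ p' q' : R, Irreducible p' ∧ Irreducible q' ∧
        Associated (p * p') (q * q') ∧ q * q' ∣ z := fun h =>
    ⟨q, p, hq, hp, by rw [mul_comm], by rwa [mul_comm]⟩
  rcases irr_struct H hp with hpp | ⟨A, B, hA, hB, hAp, hBp, hAB⟩
  · apply easy
    obtain ⟨w, rfl⟩ := hqz
    rcases hpp.dvd_or_dvd hpz with h | h
    · exact (hpq (hp.associated_of_dvd hq h)).elim
    · rw [mul_comm p]; exact mul_dvd_mul_left q h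
  rcases irr_struct H hq with hqp | ⟨C, E, hC, hE, hCp, hEp, hCE⟩
  · apply easy
    obtain ⟨w, rfl⟩ := hpz
    rcases hqp.dvd_or_dvd hqz with h | h
    · exact (hpq (hq.associated_of_dvd hp h).symm).elim
    · exact mul_dvd_mul_left p h
  have hz0 := span_ne.2 hz
  have hpz' := span_dvd.2 hpz
  have hqz' := span_dvd.2 hqz
  have key : ∀ A B C : Ideal R, Prime A → Prime B → Prime C → ¬ A.IsPrincipal → ¬ B.IsPrincipal →
      ¬ C.IsPrincipal → Ideal.span {p} = A * B → Ideal.span {q} = A * C →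
      ∃ p' q' : R, Irreducible p' ∧ Irreducible q' ∧
        Associated (p * p') (q * q') ∧ q * q' ∣ z := by
    intro A B C hA hB hC hAp hBp hCp hAB hAC
    have hBC : C ≠ B := fun h => hpq (span_assoc.1 (by rw [hAB, hAC, h]))
    obtain ⟨W, hW⟩ := hpz'
    rw [hAC, hW, hAB, mul_assoc, mul_dvd_mul_iff_left hA.ne_zero] at hqz'
    rcases hC.dvd_or_dvd hqz' with h | ⟨V, rfl⟩
    · exact (hBC (prime_dvd_eq hC hB h)).elim
    have hV0 : V ≠ 0 := by rintro rfl; simp at hW; exact hz hW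
    have hVp : ¬ V.IsPrincipal := by
      intro hV
      have h1 := prin_right (span_ne.2 hp.ne_zero) (mul_ne_zero hC.ne_zero hV0) (prin_span p)
        (by rw [← hW]; exact prin_span z)
      rw [mul_comm] at h1
      exact hCp (prin_right hV0 hC.ne_zero hV h1)
    obtain ⟨F, hF, ⟨U, rfl⟩, hFp⟩ := exists_nonprin hV0 hVp
    obtain ⟨p', hp'⟩ := prin_iff.1 (H C F hC.ne_zero hF.ne_zero hCp hFp)
    obtain ⟨q', hq'⟩ := prin_iff.1 (H B F hB.ne_zero hF.ne_zero hBp hFp)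
    refine ⟨p', q', irr_two hC hF hCp hFp hp'.symm, irr_two hB hF hBp hFp hq'.symm, ?_, ?_⟩
    · rw [← span_assoc, span_mul', span_mul', hAB, hAC, ← hp', ← hq']
      ring
    · rw [← span_dvd, span_mul', hAC, ← hq', hW, hAB]
      exact ⟨U, by ring⟩
  by_cases h1 : A = C
  · subst h1; exact key A B E hA hB hE hAp hBp hEp hAB hCE
  by_cases h2 : A = E
  · subst h2; exact key A B C hA hB hC hAp hBp hCp hAB (by rw [hCE, mul_comm])
  by_cases h3 : B = C
  · subst h3; exact key B A E hB hA hE hBp hAp hEp (by rw [hAB, mul_comm]) hCE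
  by_cases h4 : B = E
  · subst h4; exact key B A C hB hA hC hBp hAp hCp (by rw [hAB, mul_comm]) (by rw [hCE, mul_comm])
  apply easy
  rw [← span_dvd, span_mul']
  obtain ⟨W, hW⟩ := hpz'
  rw [hW]
  refine mul_dvd_mul_left _ ?_
  rw [hW, hAB, hCE] at hqz'
  have strip : ∀ P V : Ideal R, Prime P → P ≠ A → P ≠ B → P ∣ A * B * V → P ∣ V := by
    intro P V hP h1 h2 h
    rcases hP.dvd_or_dvd h with h | h
    · rcases hP.dvd_or_dvd h with h | h
      · exact (h1 (prime_dvd_eq hP hA h)).elim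
      · exact (h2 (prime_dvd_eq hP hB h)).elim
    · exact h
  obtain ⟨V, rfl⟩ := strip C W hC (Ne.symm h1) (Ne.symm h3) ((Dvd.intro E rfl).trans hqz')
  rw [mul_left_comm, mul_dvd_mul_iff_left hC.ne_zero] at hqz'
  rw [hCE]
  exact mul_dvd_mul_left C (strip E V hE (Ne.symm h2) (Ne.symm h4) hqz')

/-- generator of a minimal principal power of a prime is irreducible -/
lemma irr_pow {P : Ideal R} (hP : Prime P) {n : ℕ} (hn : orderOf (cl P hP.ne_zero) = n) (hn0 : 0 < n)
    {g : R} (hg : Ideal.span {g} = P ^ n) : Irreducible g := by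
  have key : ∀ x : R, Ideal.span {x} ∣ P ^ n → IsUnit x ∨ Ideal.span {x} = P ^ n := by
    intro x hx
    obtain ⟨i, hi, hx⟩ := (dvd_prime_pow hP n).1 hx
    rw [associated_iff_eq] at hx
    have h1 : cl P hP.ne_zero ^ i = 1 := by
      rw [← cl_pow, cl_one, ← hx]; exact prin_span x
    have h2 := orderOf_dvd_of_pow_eq_one h1
    rw [hn] at h2
    rcases Nat.eq_zero_or_pos i with h | h
    · subst h; left
      rwa [pow_zero, Ideal.one_eq_top, Ideal.span_singleton_eq_top] at hx
    · right
      rw [hx, le_antisymm hi (Nat.le_of_dvd h h2)]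
  have hg0 : g ≠ 0 := by rw [← span_ne, hg]; exact pow_ne_zero _ hP.ne_zero
  constructor
  · intro hu
    rw [Ideal.span_singleton_eq_top.2 hu] at hg
    refine hP.not_isUnit (isUnit_of_dvd_one ?_)
    rw [Ideal.one_eq_top, hg]
    exact dvd_pow_self P hn0.ne'
  · rintro x y rfl
    rcases key x (by rw [← hg, span_mul']; exact Dvd.intro _ rfl) with h | h
    · exact Or.inl h
    · right
      rw [← h, span_assoc] at hg
      have : Associated (x * y) (x * 1) := by simpa using hg
      rw [← associated_one_iff_isUnit]
      exact Associated.of_mul_left this (.refl _) (left_ne_zero_of_mul hg0)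

lemma exists_irr_pow [Finite (ClassGroup R)] {P : Ideal R} (hP : Prime P) :
    ∃ g : R, Ideal.span {g} = P ^ orderOf (cl P hP.ne_zero) ∧ Irreducible g := by
  obtain ⟨g, hg⟩ := prin_iff.1 ((cl_one (pow_ne_zero (orderOf (cl P hP.ne_zero)) hP.ne_zero)).1
    (by rw [cl_pow hP.ne_zero, pow_orderOf_eq_one]))
  exact ⟨g, hg.symm, irr_pow hP rfl (orderOf_pos _) hg.symm⟩

theorem card_le_of_hfd [Finite (ClassGroup R)] (h : IsHFD R)
    (hex : ∀ C : ClassGroup R, ∃ (P : Ideal R) (hP : Prime P), cl P hP.ne_zero = C) (a b : ClassGroup R)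
    (ha : a ≠ 1) (hb : b ≠ 1) : a * b = 1 := by
  have hsq : ∀ g : ClassGroup R, g ≠ 1 → orderOf g = 2 := by
    intro g hg
    obtain ⟨P, hP, hPg⟩ := hex g
    obtain ⟨Q, hQ, hQg⟩ := hex g⁻¹
    obtain ⟨x, hx, hxi⟩ := exists_irr_pow hP
    obtain ⟨y, hy, hyi⟩ := exists_irr_pow hQ
    rw [hPg] at hx
    rw [hQg, orderOf_inv] at hy
    obtain ⟨w, hw⟩ := prin_iff.1 ((cl_one (mul_ne_zero hP.ne_zero hQ.ne_zero)).1
      (by rw [cl_mul hP.ne_zero hQ.ne_zero, hPg, hQg, mul_inv_cancel]))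
    have hw0 : w ≠ 0 := by rw [← span_ne, ← hw]; exact mul_ne_zero hP.ne_zero hQ.ne_zero
    obtain ⟨k, hk⟩ := exists_len atomic hw0
    have e : Associated (w ^ orderOf g) (x * y) := by
      rw [← span_assoc, span_mul', hx, hy, ← Ideal.span_singleton_pow, ← hw, mul_pow]
    have := hfd_unique h ((hk.pow (orderOf g)).assoc e) ((Len.irr hxi).mul (Len.irr hyi))
    have h2 : orderOf g ∣ 2 := Dvd.intro _ this
    rcases (Nat.dvd_prime Nat.prime_two).1 h2 with h3 | h3
    · exact (hg (orderOf_eq_one_iff.1 h3)).elim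
    · exact h3
  by_contra hab
  obtain ⟨P, hP, hPg⟩ := hex a
  obtain ⟨Q, hQ, hQg⟩ := hex b
  obtain ⟨S, hS, hSg⟩ := hex (a * b)
  obtain ⟨x, hx, hxi⟩ := exists_irr_pow hP
  obtain ⟨y, hy, hyi⟩ := exists_irr_pow hQ
  obtain ⟨s, hs, hsi⟩ := exists_irr_pow hS
  rw [hPg, hsq a ha] at hx
  rw [hQg, hsq b hb] at hy
  rw [hSg, hsq _ hab] at hs
  have h0 := mul_ne_zero hP.ne_zero hQ.ne_zero
  obtain ⟨w, hw⟩ := prin_iff.1 ((cl_one (mul_ne_zero h0 hS.ne_zero)).1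
      (by rw [cl_mul h0 hS.ne_zero, cl_mul hP.ne_zero hQ.ne_zero, hPg, hQg, hSg, ← sq, ← hsq _ hab,
        pow_orderOf_eq_one]))
  have hw0 : w ≠ 0 := by rw [← span_ne, ← hw]; exact mul_ne_zero h0 hS.ne_zero
  obtain ⟨k, hk⟩ := exists_len atomic hw0
  have e : Associated (w ^ 2) (x * y * s) := by
    rw [← span_assoc, span_mul', span_mul', hx, hy, hs, ← Ideal.span_singleton_pow, ← hw, mul_pow, mul_pow]
  have := hfd_unique h ((hk.pow 2).assoc e) (((Len.irr hxi).mul (Len.irr hyi)).mul (Len.irr hsi))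
  omega

end ded

lemma grp_two {G : Type*} [Group G] [Fintype G] : (∀ a b : G, a ≠ 1 → b ≠ 1 → a * b = 1) ↔
    Fintype.card G = 1 ∨ Fintype.card G = 2 := by
  classical
  have hpos : 0 < Fintype.card G := Fintype.card_pos
  constructor
  · intro h
    by_contra hc
    obtain ⟨a, b, c, hab, hac, hbc⟩ := Fintype.two_lt_card_iff.1 (by omega : 2 < Fintype.card G)
    have key : ∀ x y : G, x ≠ 1 → y ≠ 1 → x = y := fun x y hx hy =>
      mul_right_cancel ((h x x hx hx).trans (h y x hy hx).symm)
    by_cases ha : a = 1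
    · exact hbc (key b c (fun h => hab (ha.trans h.symm)) (fun h => hac (ha.trans h.symm)))
    · by_cases hb : b = 1
      · exact hac (key a c ha (fun h => hbc (hb.trans h.symm)))
      · exact hab (key a b ha hb)
  · intro hc a b ha hb
    by_contra hab
    have := Fintype.two_lt_card_iff.2 ⟨1, a, a * b, ha.symm, fun h => hab h.symm, fun h => hb (by simpa using h)⟩
    omega

end NFA

/-- Corollary 3.11: the ring of integers of a number field `K` is an IDPD iff it is
an HFD, iff the class number of `K` is `1` or `2`. -/
theorem ringOfIntegers_isIDPD_iff (K : Type*) [Field K] [NumberField K] :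
    (IsIDPD (NumberField.RingOfIntegers K) ↔ IsHFD (NumberField.RingOfIntegers K)) ∧
    (IsIDPD (NumberField.RingOfIntegers K) ↔
      NumberField.classNumber K = 1 ∨ NumberField.classNumber K = 2) := by
  have h1 : IsIDPD (NumberField.RingOfIntegers K) → IsHFD (NumberField.RingOfIntegers K) := NFA.idpd_hfd
  have h2 : IsHFD (NumberField.RingOfIntegers K) →
      NumberField.classNumber K = 1 ∨ NumberField.classNumber K = 2 := fun h =>
    NFA.grp_two.1 (NFA.card_le_of_hfd h fun C => by
      obtain ⟨P, hP⟩ := NFU.exists_prime_in_class C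
      exact ⟨P.1, P.2, hP⟩)
  have h3 : NumberField.classNumber K = 1 ∨ NumberField.classNumber K = 2 →
      IsIDPD (NumberField.RingOfIntegers K) := fun h => by
    have h' := NFA.grp_two.2 h
    refine NFA.idpd_of fun I J hI hJ hI' hJ' => ?_
    rw [← NFA.cl_one (mul_ne_zero hI hJ), NFA.cl_mul hI hJ]
    exact h' _ _ (fun h => hI' ((NFA.cl_one hI).1 h)) (fun h => hJ' ((NFA.cl_one hJ).1 h))
  exact ⟨⟨h1, fun h => h3 (h2 h)⟩, ⟨fun h => h2 (h1 h), h3⟩⟩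
end

section
/- Let r, n be natural numbers, let S be a nonempty set of positive divisors of n that is totally ordered by divisibility (for all s, t ∈ S, s divides t or t divides s), and let Y be a nonempty finite set partitioned into pairwise disjoint subsets Y_s indexed by s ∈ S. Let M, a : Y → ℕ satisfy M(y) ≤ a(y) for all y ∈ Y, and assume Σ_{s∈S} s · Σ_{y∈Y_s} M(y) ≤ 2n ≤ r·n = Σ_{s∈S} s · Σ_{y∈Y_s} a(y). Then there exists a function f : Y → ℕ such that M(y) + f(y) ≤ a(y) for all y ∈ Y and Σ_{s∈S} s · Σ_{y∈Y_s} (M(y) + f(y)) = 2n. -/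
/-- Greedy coin selection along a divisibility chain. -/
theorem greedy_aux {Y : Type*} (σ b : Y → ℕ) (hpos : ∀ y, 0 < σ y)
    (hch : ∀ x y, σ x ∣ σ y ∨ σ y ∣ σ x) (s : Finset Y) :
    ∀ T : ℕ, T ≤ ∑ y ∈ s, σ y * b y →
      (∀ y ∈ s, T ≡ ∑ y ∈ s, σ y * b y [MOD σ y]) →
      ∃ f : Y → ℕ, (∀ y, f y ≤ b y) ∧ ∑ y ∈ s, σ y * f y = T := by
  classical
  induction s using Finset.induction_on_max_value σ with
  | empty =>
    intro T hT _
    refine ⟨fun _ => 0, fun _ => Nat.zero_le _, ?_⟩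
    simp at hT
    simp [hT]
  | insert y s hy hmax ih =>
    intro T hT hmod
    rw [Finset.sum_insert hy] at hT hmod
    set W := ∑ x ∈ s, σ x * b x with hW
    have hdiv : ∀ x ∈ s, σ x ∣ σ y := by
      intro x hx
      rcases hch x y with h | h
      · exact h
      · have h1 := Nat.le_of_dvd (hpos x) h
        have h2 := hmax x hx
        rw [le_antisymm h2 h1]
    have hmy : T ≡ σ y * b y + W [MOD σ y] := hmod y (Finset.mem_insert_self _ _)
    have key : ∃ k T', k ≤ b y ∧ σ y * k + T' = T ∧ T' ≤ W := by
      by_cases hc : σ y * b y ≤ T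
      · exact ⟨b y, T - σ y * b y, le_rfl, by omega, by omega⟩
      · refine ⟨T / σ y, T % σ y, ?_, Nat.div_add_mod _ _, ?_⟩
        · by_contra hlt
          exact hc ((Nat.mul_le_mul_left _ (by omega)).trans (Nat.mul_div_le T (σ y)))
        · have : T % σ y = W % σ y := by
            have h := hmy
            unfold Nat.ModEq at h
            rw [h, Nat.mul_add_mod]
          rw [this]
          exact Nat.mod_le _ _
    obtain ⟨k, T', hk, hkT, hTW⟩ := key
    obtain ⟨f, hf, hfs⟩ := ih T' hTW (by
      intro x hx
      have h := hmod x (Finset.mem_insert_of_mem hx)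
      obtain ⟨d, hd⟩ := hdiv x hx
      rw [← hkT, hd] at h
      unfold Nat.ModEq at h ⊢
      rwa [mul_assoc, mul_assoc, Nat.mul_add_mod, Nat.mul_add_mod] at h)
    refine ⟨Function.update f y k, ?_, ?_⟩
    · intro x
      by_cases hx : x = y
      · subst hx
        simpa using hk
      · simpa [hx] using hf x
    · rw [Finset.sum_insert hy, Function.update_self, ← hkT, ← hfs]
      congr 1
      refine Finset.sum_congr rfl fun x hx => ?_
      rw [Function.update_of_ne (by rintro rfl; exact hy hx)]

/-- Lemma A.2: the weighted correction lemma. `Y` is a finite nonempty set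
partitioned into the (possibly empty) fibers `Y_s = σ⁻¹(s)` over a nonempty set `S`
of positive divisors of `n` that is totally ordered by divisibility; the sum
`∑_{s ∈ S} s · ∑_{y ∈ Y_s} g y` is expressed as `∑ y, σ y * g y`. -/
theorem exists_weighted_correction (r n : ℕ) (S : Finset ℕ) (hS : S.Nonempty)
    (hdvd : ∀ s ∈ S, 0 < s ∧ s ∣ n)
    (hchain : ∀ s ∈ S, ∀ t ∈ S, s ∣ t ∨ t ∣ s)
    (Y : Type*) [Fintype Y] [Nonempty Y]
    (σ : Y → ℕ) (hσ : ∀ y, σ y ∈ S)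
    (M a : Y → ℕ) (hMa : ∀ y, M y ≤ a y)
    (hM : ∑ y, σ y * M y ≤ 2 * n) (hrn : 2 * n ≤ r * n)
    (ha : r * n = ∑ y, σ y * a y) :
    ∃ f : Y → ℕ, (∀ y, M y + f y ≤ a y) ∧ ∑ y, σ y * (M y + f y) = 2 * n := by
  have hsum : ∑ y, σ y * a y = ∑ y, σ y * M y + ∑ y, σ y * (a y - M y) := by
    rw [← Finset.sum_add_distrib]
    refine Finset.sum_congr rfl fun y _ => ?_
    rw [← mul_add, Nat.add_sub_cancel' (hMa y)]
  obtain ⟨f, hf, hfs⟩ := greedy_aux σ (fun y => a y - M y)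
    (fun y => (hdvd _ (hσ y)).1) (fun x y => hchain _ (hσ x) _ (hσ y)) Finset.univ
    (2 * n - ∑ y, σ y * M y) (by omega) (by
      intro y _
      have hd := (hdvd _ (hσ y)).2
      apply Nat.ModEq.add_left_cancel' (∑ y, σ y * M y)
      rw [← hsum, ← ha, Nat.add_sub_cancel' hM]
      exact ((Nat.modEq_zero_iff_dvd).2 (hd.mul_left 2)).trans
        ((Nat.modEq_zero_iff_dvd).2 (hd.mul_left r)).symm)
  refine ⟨f, fun y => ?_, ?_⟩
  · have h1 := hf y
    have h2 := hMa y
    omega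
  · simp only [mul_add, Finset.sum_add_distrib]
    omega
end

section
/- The ring ℚ + Xℝ[X], the subring of the polynomial ring ℝ[X] consisting of all real polynomials whose constant coefficient is rational, is an IDPD but is neither a unique factorization domain nor a finite factorization domain. -/
/-- A *finite factorization domain (FFD)* is an atomic integral domain in which every
nonzero nonunit has only finitely many irreducible factorizations up to order and
associates. -/
def IsFFD (D : Type*) [CommRing D] : Prop :=
  IsDomain D ∧ IsAtomicDomain D ∧
    ∀ z : D, z ≠ 0 → ¬IsUnit z →
      ∃ F : Finset (Multiset D), ∀ l : Multiset D, (∀ p ∈ l, Irreducible p) →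
        l.prod = z → ∃ l' ∈ F, Multiset.Rel Associated l l'

/-- The ring `ℚ + X·ℝ[X]`: real polynomials with rational constant coefficient. -/
noncomputable def ratConstSubring : Subring (Polynomial ℝ) where
  carrier := {f | ∃ q : ℚ, f.coeff 0 = (q : ℝ)}
  mul_mem' := by
    rintro a b ⟨qa, ha⟩ ⟨qb, hb⟩
    exact ⟨qa * qb, by simp [Polynomial.mul_coeff_zero, ha, hb]⟩
  one_mem' := ⟨1, by simp⟩
  add_mem' := by
    rintro a b ⟨qa, ha⟩ ⟨qb, hb⟩
    exact ⟨qa + qb, by simp [ha, hb]⟩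
  zero_mem' := ⟨0, by simp⟩
  neg_mem' := by
    rintro a ⟨qa, ha⟩
    exact ⟨-qa, by simp [ha]⟩

open Polynomial in
theorem RCS.mem_iff (f : ℝ[X]) : f ∈ ratConstSubring ↔ ∃ q : ℚ, f.coeff 0 = (q : ℝ) := Iff.rfl

open Polynomial in
theorem RCS.C_mem (q : ℚ) : C (q : ℝ) ∈ ratConstSubring := ⟨q, by simp⟩

open Polynomial in
theorem RCS.isUnit_C {q : ℚ} (hq : q ≠ 0) :
    IsUnit (⟨C (q : ℝ), RCS.C_mem q⟩ : ratConstSubring) := by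
  refine IsUnit.of_mul_eq_one ⟨C ((q⁻¹ : ℚ) : ℝ), RCS.C_mem _⟩ ?_
  apply Subtype.ext
  change C (q : ℝ) * C ((q⁻¹ : ℚ) : ℝ) = 1
  rw [← C_mul]
  have : (q : ℝ) ≠ 0 := by exact_mod_cast hq
  push_cast
  rw [mul_inv_cancel₀ this, C_1]

open Polynomial in
theorem RCS.isUnit_iff (a : ratConstSubring) : IsUnit a ↔ IsUnit (a : ℝ[X]) := by
  constructor
  · intro h
    exact h.map ratConstSubring.subtype
  · intro h
    obtain ⟨r, hr, hra⟩ := Polynomial.isUnit_iff.1 h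
    obtain ⟨q, hq⟩ := a.2
    rw [← hra, coeff_C_zero] at hq
    have hq0 : q ≠ 0 := by
      rintro rfl
      apply hr.ne_zero
      simpa using hq
    have : a = ⟨C (q : ℝ), RCS.C_mem q⟩ := by
      apply Subtype.ext
      rw [← hra, hq]
    rw [this]
    exact RCS.isUnit_C hq0

open Polynomial in
theorem RCS.associated {p q : ratConstSubring} {c : ℚ} (hc : c ≠ 0)
    (h : (q : ℝ[X]) = C (c : ℝ) * p) : Associated p q := by
  obtain ⟨u, hu⟩ := RCS.isUnit_C hc
  refine ⟨u, ?_⟩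
  apply Subtype.ext
  rw [hu, h, mul_comm]
  rfl

open Polynomial in
theorem RCS.exists_of_associated {p q : ratConstSubring} (h : Associated p q) :
    ∃ c : ℚ, (q : ℝ[X]) = C (c : ℝ) * p := by
  obtain ⟨u, hu⟩ := h
  obtain ⟨r, hr, hra⟩ := Polynomial.isUnit_iff.1 ((RCS.isUnit_iff (u : ratConstSubring)).1 u.isUnit)
  obtain ⟨c, hc⟩ := (u : ratConstSubring).2
  rw [← hra, coeff_C_zero] at hc
  refine ⟨c, ?_⟩
  rw [← hc, hra, ← hu, mul_comm]
  rfl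

open Polynomial in
theorem RCS.dvd {z q : ratConstSubring} {w : ℝ[X]} (hw : w ∈ ratConstSubring)
    (h : (z : ℝ[X]) = q * w) : q ∣ z := ⟨⟨w, hw⟩, Subtype.ext h⟩

open Polynomial in
theorem RCS.irreducible_of {a : ratConstSubring} (h : Irreducible (a : ℝ[X])) :
    Irreducible a := by
  refine ⟨fun hu => h.not_isUnit ((RCS.isUnit_iff a).1 hu), ?_⟩
  intro b c hbc
  rw [RCS.isUnit_iff, RCS.isUnit_iff]
  apply h.isUnit_or_isUnit
  rw [hbc]; rfl

open Polynomial in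
theorem RCS.irreducible_aux {a : ratConstSubring} (h : Irreducible a) (b c : ℝ[X])
    (hbc : (a : ℝ[X]) = b * c) (hb : b.coeff 0 ≠ 0) : IsUnit b ∨ IsUnit c := by
  set t := b.coeff 0 with ht
  have h1 : C t⁻¹ * b ∈ ratConstSubring := ⟨1, by simp [← ht, hb]⟩
  have h2 : C t * c ∈ ratConstSubring := by
    obtain ⟨q, hq⟩ := a.2
    refine ⟨q, ?_⟩
    rw [← hq, hbc, mul_coeff_zero, mul_coeff_zero, coeff_C_zero]
  have h3 : C t⁻¹ * C t = (1 : ℝ[X]) := by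
    rw [← C_mul, inv_mul_cancel₀ hb, C_1]
  have := h.isUnit_or_isUnit (a := ⟨_, h1⟩) (b := ⟨_, h2⟩) (by
    apply Subtype.ext
    change (a : ℝ[X]) = C t⁻¹ * b * (C t * c)
    rw [hbc]
    linear_combination (-(b * c)) * h3)
  rw [RCS.isUnit_iff, RCS.isUnit_iff] at this
  exact this.imp (fun h => isUnit_of_mul_isUnit_right h) (fun h => isUnit_of_mul_isUnit_right h)

open Polynomial in
theorem RCS.irreducible_iff (a : ratConstSubring) : Irreducible a ↔ Irreducible (a : ℝ[X]) := by
  refine ⟨fun h => ⟨fun hu => h.not_isUnit ((RCS.isUnit_iff a).2 hu), ?_⟩, RCS.irreducible_of⟩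
  intro b c hbc
  by_cases hb : b.coeff 0 = 0
  · by_cases hc : c.coeff 0 = 0
    · have h1 : b ∈ ratConstSubring := ⟨0, by simpa using hb⟩
      have h2 : c ∈ ratConstSubring := ⟨0, by simpa using hc⟩
      have := h.isUnit_or_isUnit (a := ⟨_, h1⟩) (b := ⟨_, h2⟩) (Subtype.ext hbc)
      rwa [RCS.isUnit_iff, RCS.isUnit_iff] at this
    · exact (RCS.irreducible_aux h c b (by rw [hbc, mul_comm]) hc).symm
  · exact RCS.irreducible_aux h b c hbc hb

open Polynomial in
theorem RCS.monomial_mem (r : ℝ) : C r * X ∈ ratConstSubring := ⟨0, by simp⟩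

open Polynomial in
noncomputable def RCS.mono (r : ℝ) : ratConstSubring := ⟨C r * X, RCS.monomial_mem r⟩

open Polynomial in
theorem RCS.coe_mono (r : ℝ) : (RCS.mono r : ℝ[X]) = C r * X := rfl

open Polynomial in
theorem RCS.irreducible_monomial {r : ℝ} (hr : r ≠ 0) :
    Irreducible (RCS.mono r) := by
  apply RCS.irreducible_of
  change Irreducible (C r * X)
  rw [irreducible_isUnit_mul (Polynomial.isUnit_C.2 hr.isUnit)]
  exact irreducible_X

theorem RCS.wf : WfDvdMonoid ratConstSubring := by
  refine ⟨?_⟩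
  refine Subrelation.wf (r := InvImage DvdNotUnit
    (fun a : ratConstSubring => (a : Polynomial ℝ))) ?_ (InvImage.wf _ wellFounded_dvdNotUnit)
  rintro a b ⟨ha, c, hc, rfl⟩
  refine ⟨fun h => ha (Subtype.ext h), c, fun h => hc ((RCS.isUnit_iff c).2 h), rfl⟩

theorem RCS.atomic : IsAtomicDomain ratConstSubring := by
  intro z hz hu
  have := RCS.wf
  obtain ⟨l, h1, h2, -⟩ := (WfDvdMonoid.not_isUnit_iff_exists_factors_eq z hz).1 hu
  exact ⟨l, h1, h2⟩

open Polynomial in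
theorem RCS.eq_monomial {p : ratConstSubring} (hp : Irreducible p)
    (h0 : (p : ℝ[X]).coeff 0 = 0) : ∃ r : ℝ, r ≠ 0 ∧ (p : ℝ[X]) = C r * X := by
  have hp' := (RCS.irreducible_iff p).1 hp
  obtain ⟨w, hw⟩ := X_dvd_iff.2 h0
  rw [hw] at hp'
  rcases hp'.isUnit_or_isUnit rfl with h | h
  · exact absurd h not_isUnit_X
  · obtain ⟨r, hr, rfl⟩ := Polynomial.isUnit_iff.1 h
    exact ⟨r, hr.ne_zero, by rw [hw, mul_comm]⟩

open Polynomial in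
/-- The case where `p` has nonzero constant coefficient. -/
theorem RCS.pair_aux {z p q : ratConstSubring} (hp : Irreducible p) (hq : Irreducible q)
    (hpz : p ∣ z) (hqz : q ∣ z) (hpq : ¬ Associated p q) (h0 : (p : ℝ[X]).coeff 0 ≠ 0) :
    q * p ∣ z := by
  have hp' := (RCS.irreducible_iff p).1 hp
  have hq' := (RCS.irreducible_iff q).1 hq
  obtain ⟨u, hu⟩ := hpz
  obtain ⟨v, hv⟩ := hqz
  obtain ⟨a, ha⟩ := p.2
  obtain ⟨b, hb⟩ := q.2
  obtain ⟨d, hd⟩ := v.2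
  have ha0 : (a : ℝ) ≠ 0 := ha ▸ h0
  have e : (p : ℝ[X]) * u = q * v := congrArg Subtype.val (hu.symm.trans hv)
  have hdvd : (p : ℝ[X]) ∣ q * v := ⟨u, e.symm⟩
  rcases hp'.prime.dvd_or_dvd hdvd with h | h
  · exfalso
    apply hpq
    obtain ⟨w, hw⟩ := h
    have hwu := (hq'.isUnit_or_isUnit hw).resolve_left hp'.not_isUnit
    obtain ⟨r, hr, rfl⟩ := Polynomial.isUnit_iff.1 hwu
    have h1 : (b : ℝ) = a * r := by
      rw [← hb, hw, mul_coeff_zero, ha, coeff_C_zero]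
    have hr' : r = ((b / a : ℚ) : ℝ) := by
      push_cast
      field_simp
      linarith
    refine RCS.associated (c := b / a) ?_ (by rw [hw, hr', mul_comm])
    intro h
    rw [h] at hr'
    exact hr.ne_zero (by simpa using hr')
  · obtain ⟨w, hw⟩ := h
    have h1 : (d : ℝ) = a * w.coeff 0 := by
      rw [← hd, hw, mul_coeff_zero, ha]
    refine RCS.dvd (w := w) ⟨d / a, ?_⟩ ?_
    · push_cast
      field_simp
      linarith
    · rw [hv]
      change (q : ℝ[X]) * v = q * p * w
      rw [hw, mul_assoc]

open Polynomial in
theorem RCS.pair {z p q : ratConstSubring} (hp : Irreducible p) (hq : Irreducible q)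
    (hpz : p ∣ z) (hqz : q ∣ z) (hpq : ¬ Associated p q) :
    ∃ p' q' : ratConstSubring, Irreducible p' ∧ Irreducible q' ∧
        Associated (p * p') (q * q') ∧ q * q' ∣ z := by
  by_cases hp0 : (p : ℝ[X]).coeff 0 = 0
  swap
  · exact ⟨q, p, hq, hp, by rw [mul_comm], RCS.pair_aux hp hq hpz hqz hpq hp0⟩
  by_cases hq0 : (q : ℝ[X]).coeff 0 = 0
  swap
  · refine ⟨q, p, hq, hp, by rw [mul_comm], ?_⟩
    rw [mul_comm]
    exact RCS.pair_aux hq hp hqz hpz (fun h => hpq h.symm) hq0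
  obtain ⟨a, ha, hpa⟩ := RCS.eq_monomial hp hp0
  obtain ⟨b, hb, hqb⟩ := RCS.eq_monomial hq hq0
  obtain ⟨u, hu⟩ := hpz
  obtain ⟨v, hv⟩ := hqz
  obtain ⟨c, hc⟩ := u.2
  obtain ⟨d, hd⟩ := v.2
  have e : (p : ℝ[X]) * u = q * v := congrArg Subtype.val (hu.symm.trans hv)
  have e' : C a * (u : ℝ[X]) = C b * v := by
    rw [hpa, hqb] at e
    apply mul_right_cancel₀ (X_ne_zero (R := ℝ))
    linear_combination e
  have e0 : a * c = b * d := by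
    have := congrArg (fun f => coeff f 0) e'
    simpa [mul_coeff_zero, hc, hd] using this
  have hd0 : d = 0 := by
    by_contra hd0
    have hd0' : (d : ℝ) ≠ 0 := by exact_mod_cast hd0
    have hc0 : c ≠ 0 := by
      rintro rfl
      simp [hb, hd0] at e0
    apply hpq
    refine RCS.associated (c := c / d) (div_ne_zero hc0 hd0) ?_
    rw [hpa, hqb, ← mul_assoc, ← C_mul]
    congr 2
    push_cast
    field_simp
    linarith
  obtain ⟨w, hw⟩ := X_dvd_iff.2 (show (v : ℝ[X]).coeff 0 = 0 by rw [hd, hd0]; simp)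
  have hz : (z : ℝ[X]) = C b * X * (X * w) := by
    rw [← hw, ← hqb, hv]; rfl
  obtain ⟨k, hk, m, hm⟩ : ∃ k : ℝ, k ≠ 0 ∧ ∃ m : ℚ, k⁻¹ * (b * w.coeff 0) = m := by
    by_cases h : b * w.coeff 0 = 0
    · exact ⟨1, one_ne_zero, 0, by simp [h]⟩
    · exact ⟨_, h, 1, by rw [inv_mul_cancel₀ h, Rat.cast_one]⟩
  refine ⟨(RCS.mono (k / a)), (RCS.mono (k / b)),
    RCS.irreducible_monomial (div_ne_zero hk ha), RCS.irreducible_monomial (div_ne_zero hk hb),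
    ?_, ?_⟩
  · have : p * (RCS.mono (k / a)) = q * (RCS.mono (k / b)) := by
      apply Subtype.ext
      change (p : ℝ[X]) * (C (k / a) * X) = (q : ℝ[X]) * (C (k / b) * X)
      have h1 : C a * C (k / a) = (C k : ℝ[X]) := by rw [← C_mul, mul_div_cancel₀ _ ha]
      have h2 : C b * C (k / b) = (C k : ℝ[X]) := by rw [← C_mul, mul_div_cancel₀ _ hb]
      rw [hpa, hqb]
      linear_combination X ^ 2 * (h1 - h2)
    rw [this]
  · refine RCS.dvd (w := C (k⁻¹ * b) * w) ⟨m, ?_⟩ ?_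
    · rw [← hm, mul_coeff_zero, coeff_C_zero, mul_assoc]
    · change (z : ℝ[X]) = (q : ℝ[X]) * (C (k / b) * X) * (C (k⁻¹ * b) * w)
      have h1 : C (k / b) * C (k⁻¹ * b) = (1 : ℝ[X]) := by
        rw [← C_mul, ← C_1]; congr 1; field_simp
      rw [hz, hqb]
      linear_combination (-(C b * X * X * w)) * h1

open Polynomial in
theorem RCS.not_ufd : ¬ UniqueFactorizationMonoid ratConstSubring := by
  intro h
  have hp := (RCS.irreducible_monomial (one_ne_zero (α := ℝ))).prime
  have hdvd : RCS.mono 1 ∣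
      (RCS.mono √2) * (RCS.mono √2) := by
    refine RCS.dvd (RCS.monomial_mem 2) ?_
    change (C √2 * X) * (C √2 * X) = (C 1 * X) * (C 2 * X)
    have h1 : C √2 * C √2 = (C 2 : ℝ[X]) := by
      rw [← C_mul, Real.mul_self_sqrt (by norm_num)]
    rw [C_1]
    linear_combination X ^ 2 * h1
  have h2 : RCS.mono 1 ∣ (RCS.mono √2) :=
    (hp.dvd_or_dvd hdvd).elim id id
  obtain ⟨w, hw⟩ := h2
  obtain ⟨c, hc⟩ := w.2
  have h3 : C √2 * X = C 1 * X * (w : ℝ[X]) := congrArg Subtype.val hw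
  rw [C_1, one_mul, mul_comm] at h3
  have h4 := mul_left_cancel₀ X_ne_zero h3
  rw [← h4, coeff_C_zero] at hc
  exact irrational_sqrt_two ⟨c, hc.symm⟩

open Polynomial in
theorem RCS.not_ffd : ¬ IsFFD ratConstSubring := by
  rintro ⟨-, -, h⟩
  have hirr := RCS.irreducible_monomial (one_ne_zero (α := ℝ))
  obtain ⟨F, hF⟩ := h ((RCS.mono 1) * (RCS.mono 1))
    (mul_ne_zero hirr.ne_zero hirr.ne_zero)
    (fun hu => hirr.not_isUnit (isUnit_of_mul_isUnit_left hu))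
  set S : Set ratConstSubring := ⋃ l ∈ F, {s | s ∈ l} with hS
  have hSc : S.Countable := by
    refine Set.Countable.biUnion F.countable_toSet fun l _ => ?_
    exact (Multiset.finite_toSet l).countable
  have hsub : ({0}ᶜ : Set ℝ) ⊆
      Set.image (fun x : ratConstSubring × ℚ => (x.2 : ℝ) * (x.1 : ℝ[X]).coeff 1) (S ×ˢ Set.univ) := by
    intro r hr
    have hr : r ≠ 0 := hr
    obtain ⟨l', hl', hrel⟩ := hF {(RCS.mono r), (RCS.mono r⁻¹)} (by
      intro p hp
      simp only [Multiset.insert_eq_cons, Multiset.mem_cons, Multiset.mem_singleton] at hp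
      rcases hp with rfl | rfl
      · exact RCS.irreducible_monomial hr
      · exact RCS.irreducible_monomial (inv_ne_zero hr)) (by
      rw [Multiset.insert_eq_cons, Multiset.prod_cons, Multiset.prod_singleton]
      apply Subtype.ext
      change (C r * X) * (C r⁻¹ * X) = (C 1 * X) * (C 1 * X)
      have h1 : C r * C r⁻¹ = (1 : ℝ[X]) := by
        rw [← C_mul, mul_inv_cancel₀ hr, C_1]
      rw [C_1]
      linear_combination X ^ 2 * h1)
    obtain ⟨s, hs, has⟩ := Multiset.exists_mem_of_rel_of_mem hrel
      (a := (RCS.mono r)) (by simp)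
    obtain ⟨c, hc⟩ := RCS.exists_of_associated has.symm
    refine ⟨(s, c), ⟨Set.mem_biUnion hl' hs, trivial⟩, ?_⟩
    have := congrArg (fun f => coeff f 1) hc
    simpa [RCS.coe_mono] using this.symm
  have hcount : ({0}ᶜ : Set ℝ).Countable :=
    ((hSc.prod Set.countable_univ).image _).mono hsub
  have hall : (Set.univ : Set ℝ).Countable := by
    rw [← Set.union_compl_self ({0} : Set ℝ)]
    exact (Set.countable_singleton 0).union hcount
  exact Cardinal.not_countable_real hall

/-- Example 2.6: `ℚ + X·ℝ[X]` is an IDPD but neither a UFD nor an FFD. -/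
theorem ratConstSubring_isIDPD_not_ufd_not_ffd :
    IsIDPD ratConstSubring ∧ ¬ UniqueFactorizationMonoid ratConstSubring ∧
      ¬ IsFFD ratConstSubring := by
  refine ⟨⟨inferInstance, RCS.atomic, ?_⟩, RCS.not_ufd, RCS.not_ffd⟩
  intro z p q _ _ hp hq hpz hqz hpq
  exact RCS.pair hp hq hpz hqz hpq
end
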